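/- Fix ν ∈ (0,1). There exists a sequence (a_n)_{n≥1} of real numbers with 0 ≤ a_n ≤ 2 for all n which satisfies condition R(ν), and such that for every integer k ≥ 1 the asymptotic formula S_k(x) ~ k·x·(log x)^{k−1} as x → ∞ fails. -/

import Mathlib

open Finset Filter

/-- The generalized von Mangoldt function `Λ_k(n) = ∑_{d ∣ n} μ(d) (log (n/d))^k`. -/
noncomputable def Lambdak (k : ℕ) (n : ℕ) : ℝ :=
  ∑ d ∈ n.divisors, (ArithmeticFunction.moebius d : ℝ) * (Real.log ((n : ℝ) / (d : ℝ))) ^ k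

/-- `S_k(x) = ∑_{n ≤ x} a_n Λ_k(n)`. -/
noncomputable def Ssum (a : ℕ → ℝ) (k : ℕ) (x : ℝ) : ℝ :=
  ∑ n ∈ Finset.Icc 1 ⌊x⌋₊, a n * Lambdak k n

/-- Condition `R(ν)`: for every `B > 0` there is `C_B` with
`∑_{d ≤ x^ν} |∑_{n ≤ x, d ∣ n} a_n − x/d| ≤ C_B · x (log x)^{−B}` for all `x ≥ 2`. -/
noncomputable def Rcond (ν : ℝ) (a : ℕ → ℝ) : Prop :=
  ∀ B : ℝ, 0 < B → ∃ C : ℝ, ∀ x : ℝ, 2 ≤ x →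
    ∑ d ∈ Finset.Icc 1 ⌊x ^ ν⌋₊,
      |(∑ n ∈ (Finset.Icc 1 ⌊x⌋₊).filter (fun n => d ∣ n), a n) - x / d|
      ≤ C * x * Real.log x ^ (-B)

namespace BS

lemma term_bound (a : ℝ) (ha : 0 < a) (s : ℂ) (hs : 0 < s.re) (h1 : s ≠ 1) :
    ‖(a:ℂ)^(-s) - (((a+1:ℝ):ℂ)^(1-s) - (a:ℂ)^(1-s))/(1-s)‖ ≤ ‖s‖ * a^(-s.re-1) := by
  have hs0 : -s ≠ 0 := by
    intro h
    have : s = 0 := by simpa using h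
    rw [this] at hs; simp at hs
  have hs1 : (1:ℂ) - s ≠ 0 := sub_ne_zero.mpr (Ne.symm h1)
  have key1 : ∀ x ∈ Set.Icc a (a+1), ‖(x:ℂ)^(-s) - (a:ℂ)^(-s)‖ ≤ (‖s‖ * a^(-s.re-1)) * (x - a) := by
    apply norm_image_sub_le_of_norm_deriv_le_segment' (f' := fun x : ℝ => -s * (x:ℂ)^(-s-1))
    · intro x hx
      exact (hasDerivAt_ofReal_cpow_const (by linarith [hx.1]) hs0).hasDerivWithinAt
    · intro x hx
      have hx0 : 0 < x := by linarith [hx.1]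
      rw [norm_mul, norm_neg, Complex.norm_cpow_eq_rpow_re_of_pos hx0]
      simp only [Complex.sub_re, Complex.neg_re, Complex.one_re]
      gcongr ?_ * ?_
      exact Real.rpow_le_rpow_of_nonpos ha hx.1 (by linarith)
  have key2 := norm_image_sub_le_of_norm_deriv_le_segment'
    (f := fun x : ℝ => (x:ℂ)^(1-s)/(1-s) - (x:ℂ) * (a:ℂ)^(-s))
    (f' := fun x : ℝ => (x:ℂ)^(-s) - (a:ℂ)^(-s)) (a := a) (b := a+1) (C := ‖s‖ * a^(-s.re-1))
    (by
      intro x hx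
      have hx0 : x ≠ 0 := by linarith [hx.1]
      have h2 := hasDerivAt_ofReal_cpow_const' (x := x) hx0 (r := -s) (by
        intro h; apply h1; simpa using h)
      have e : -s + 1 = 1 - s := by ring
      rw [e] at h2
      have h3 : HasDerivAt (fun x : ℝ => (x:ℂ) * (a:ℂ)^(-s)) (1 * (a:ℂ)^(-s)) x :=
        (Complex.ofRealCLM.hasDerivAt (x := x)).mul_const _
      rw [one_mul] at h3
      exact (h2.sub h3).hasDerivWithinAt)
    (by
      intro x hx
      refine (key1 x ⟨hx.1, hx.2.le⟩).trans ?_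
      have : 0 ≤ ‖s‖ * a^(-s.re-1) := by positivity
      nlinarith [hx.2])
    (a+1) ⟨by linarith, le_rfl⟩
  have e2 : (a:ℂ)^(-s) - (((a+1:ℝ):ℂ)^(1-s) - (a:ℂ)^(1-s))/(1-s) =
    -((((a+1:ℝ):ℂ)^(1-s)/(1-s) - ((a+1:ℝ):ℂ) * (a:ℂ)^(-s)) - ((a:ℂ)^(1-s)/(1-s) - (a:ℂ) * (a:ℂ)^(-s))) := by
    push_cast; ring
  rw [e2, norm_neg]
  simpa using key2

noncomputable def Tz (n : ℕ) (s : ℂ) : ℂ :=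
  (((n+1:ℕ):ℝ):ℂ)^(-s) - (((((n+1:ℕ):ℝ)+1:ℝ):ℂ)^(1-s) - (((n+1:ℕ):ℝ):ℂ)^(1-s))/(1-s)

lemma Tz_bound (n : ℕ) (s : ℂ) (hs : 0 < s.re) (h1 : s ≠ 1) :
    ‖Tz n s‖ ≤ ‖s‖ * ((n+1:ℕ):ℝ)^(-s.re-1) := 
  term_bound _ (by positivity) s hs h1

lemma Tz_sum (N : ℕ) (s : ℂ) :
    ∑ n ∈ range N, Tz n s = ∑ n ∈ range N, ((n+1:ℕ):ℂ)^(-s) - (((N+1:ℕ):ℂ)^(1-s) - 1)/(1-s) := by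
  induction N with
  | zero => simp
  | succ N ih =>
    rw [sum_range_succ, sum_range_succ, ih, Tz]
    push_cast
    ring

lemma summable_aux {r : ℝ} (hr : 0 < r) : Summable (fun n : ℕ => ((n+1:ℕ):ℝ)^(-r-1)) := by
  have := (Real.summable_nat_rpow (p := -r-1)).2 (by linarith)
  exact (summable_nat_add_iff 1).2 this

lemma Tz_summable (s : ℂ) (hs : 0 < s.re) (h1 : s ≠ 1) : Summable (fun n => Tz n s) :=
  Summable.of_norm_bounded ((summable_aux hs).mul_left ‖s‖) (fun n => Tz_bound n s hs h1)

lemma zeta_formula_right (s : ℂ) (hs : 1 < s.re) :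
    riemannZeta s = 1/(s-1) + ∑' n, Tz n s := by
  have h1 : s ≠ 1 := by rintro rfl; simp at hs
  have hT := (Tz_summable s (by linarith) h1).hasSum.tendsto_sum_nat
  have hz : Tendsto (fun N => ∑ n ∈ range N, ((n+1:ℕ):ℂ)^(-s)) atTop (nhds (riemannZeta s)) := by
    rw [zeta_eq_tsum_one_div_nat_add_one_cpow hs]
    have : Summable (fun n : ℕ => 1 / ((n:ℂ)+1)^s) := by
      have := (Complex.summable_one_div_nat_cpow (p := s)).2 hs
      have := (summable_nat_add_iff 1).2 this
      simpa using this
    have := this.hasSum.tendsto_sum_nat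
    refine this.congr (fun N => sum_congr rfl (fun n _ => ?_))
    rw [Complex.cpow_neg]; push_cast; simp
  have hp : Tendsto (fun N : ℕ => ((N+1:ℕ):ℂ)^(1-s)) atTop (nhds 0) := by
    rw [tendsto_zero_iff_norm_tendsto_zero]
    have h2 : Tendsto (fun N : ℕ => ((N+1:ℕ):ℝ)^(-(s.re-1))) atTop (nhds 0) :=
      ((tendsto_rpow_neg_atTop (y := s.re-1) (by linarith)).comp tendsto_natCast_atTop_atTop).comp (tendsto_add_atTop_nat 1)
    refine h2.congr (fun N => ?_)
    rw [Complex.norm_natCast_cpow_of_pos (by omega)]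
    simp
  have h3 := hz.sub ((hp.sub_const 1).div_const (1-s))
  have h4 : Tendsto (fun N => ∑ n ∈ range N, Tz n s) atTop (nhds (riemannZeta s - (0-1)/(1-s))) :=
    h3.congr (fun N => (Tz_sum N s).symm)
  have := tendsto_nhds_unique hT h4
  rw [this]
  have a1 : s - 1 ≠ 0 := sub_ne_zero.2 h1
  have a2 : 1 - s ≠ 0 := sub_ne_zero.2 (Ne.symm h1)
  field_simp
  ring

lemma zeta_formula (s : ℂ) (hs : 0 < s.re) (ht : 0 < s.im) :
    riemannZeta s = 1/(s-1) + ∑' n, Tz n s := by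
  set U : Set ℂ := {z | 0 < z.re ∧ 0 < z.im} with hU
  have hUo : IsOpen U := (isOpen_lt continuous_const Complex.continuous_re).inter
    (isOpen_lt continuous_const Complex.continuous_im)
  have hUc : Convex ℝ U := by
    have := (convex_halfSpace_re_gt 0).inter (convex_halfSpace_im_gt 0)
    exact this
  have hne : ∀ z ∈ U, z ≠ 1 := by
    rintro z hz rfl
    simp [hU] at hz
  have hTd : ∀ n, Differentiable ℂ (fun z => (1 - z) * Tz n z) ∧ DifferentiableOn ℂ (Tz n) U := by
    intro n
    have hn : ((n+1:ℕ):ℝ) ≠ 0 := by positivity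
    have hn2 : (((n+1:ℕ):ℝ)+1) ≠ 0 := by positivity
    have g1 : ∀ a : ℝ, a ≠ 0 → Differentiable ℂ (fun z : ℂ => (a:ℂ)^(1-z)) := by
      intro a ha z
      exact DifferentiableAt.const_cpow (by fun_prop) (Or.inl (by exact_mod_cast ha))
    have g2 : ∀ a : ℝ, a ≠ 0 → Differentiable ℂ (fun z : ℂ => (a:ℂ)^(-z)) := by
      intro a ha z
      exact DifferentiableAt.const_cpow (by fun_prop) (Or.inl (by exact_mod_cast ha))
    have hU2 : DifferentiableOn ℂ (Tz n) U := by
      unfold Tz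
      refine (g2 _ hn).differentiableOn.sub ?_
      refine ((g1 _ hn2).differentiableOn.sub (g1 _ hn).differentiableOn).div (by fun_prop) ?_
      intro z hz
      exact sub_ne_zero.2 (Ne.symm (hne z hz))
    refine ⟨?_, hU2⟩
    have : (fun z => (1 - z) * Tz n z) = fun z => (1-z) * (((n+1:ℕ):ℝ):ℂ)^(-z) - (((((n+1:ℕ):ℝ)+1:ℝ):ℂ)^(1-z) - (((n+1:ℕ):ℝ):ℂ)^(1-z)) := by
      funext z
      unfold Tz
      by_cases h : 1 - z = 0
      · have : z = 1 := by linear_combination -h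
        subst this
        simp
      · field_simp
    rw [this]
    exact (((differentiable_const _).sub differentiable_id).mul (g2 _ hn)).sub ((g1 _ hn2).sub (g1 _ hn))
  have hR : DifferentiableOn ℂ (fun z => 1/(z-1) + ∑' n, Tz n z) U := by
    apply DifferentiableOn.add
    · intro z hz
      have : z - 1 ≠ 0 := sub_ne_zero.2 (hne z hz)
      exact (DifferentiableAt.div (c := fun _ : ℂ => (1:ℂ)) (d := fun z : ℂ => z - 1) (differentiableAt_const _) (by fun_prop) this).differentiableWithinAt
    · intro z hz
      -- local bound
      set V : Set ℂ := U ∩ ({w | z.re/2 < w.re} ∩ Metric.ball 0 (‖z‖+1))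
      have hVo : IsOpen V := hUo.inter ((isOpen_lt continuous_const Complex.continuous_re).inter Metric.isOpen_ball)
      have hzV : z ∈ V := ⟨hz, by simp; linarith [hz.1], by simp⟩
      have hr : 0 < z.re/2 := by linarith [hz.1]
      have := Complex.differentiableOn_tsum_of_summable_norm (U := V) (F := fun n w => Tz n w)
        ((summable_aux hr).mul_left (‖z‖+1)) (fun n => (hTd n).2.mono Set.inter_subset_left) hVo
        (by
          intro n w hw
          have hw1 : z.re/2 < w.re := hw.2.1
          have hw2 : ‖w‖ < ‖z‖+1 := by simpa using hw.2.2
          refine (Tz_bound n w hw.1.1 (hne w hw.1)).trans ?_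
          gcongr
          · simp)
      exact (this.differentiableAt (hVo.mem_nhds hzV)).differentiableWithinAt
  have hL : DifferentiableOn ℂ riemannZeta U := fun z hz =>
    (differentiableAt_riemannZeta (hne z hz)).differentiableWithinAt
  have := (hL.analyticOnNhd hUo).eqOn_of_preconnected_of_eventuallyEq (hR.analyticOnNhd hUo) hUc.isPreconnected
    (z₀ := (⟨2,1⟩:ℂ)) (by simp [hU]) (by
      have : IsOpen {z : ℂ | 1 < z.re} := isOpen_lt continuous_const Complex.continuous_re
      filter_upwards [this.mem_nhds (show (⟨2,1⟩:ℂ) ∈ {z : ℂ | 1 < z.re} by simp)] with z hz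
      exact zeta_formula_right z hz)
  exact this ⟨hs, ht⟩

lemma zeta_formula_N (N : ℕ) (s : ℂ) (hs : 0 < s.re) (ht : 0 < s.im) :
    riemannZeta s = ∑ n ∈ range N, ((n+1:ℕ):ℂ)^(-s) + ((N+1:ℕ):ℂ)^(1-s)/(s-1) + ∑' n, Tz (n+N) s := by
  have h1 : s ≠ 1 := by rintro rfl; simp at ht
  rw [zeta_formula s hs ht, ← (Tz_summable s hs h1).sum_add_tsum_nat_add N, Tz_sum]
  have a1 : s - 1 ≠ 0 := sub_ne_zero.2 h1
  have a2 : 1 - s ≠ 0 := sub_ne_zero.2 (Ne.symm h1)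
  have : (((N+1:ℕ):ℂ)^(1-s) - 1)/(1-s) = 1/(s-1) - ((N+1:ℕ):ℂ)^(1-s)/(s-1) := by
    rw [← sub_div, ← neg_sub s 1, div_neg, ← neg_div]; ring
  rw [this]; ring

lemma zeta_upper_pos : ∃ C : ℝ, 1 ≤ C ∧ ∀ s : ℂ, 2 ≤ s.im → 1 - 1/(2*Real.log (s.im+3)) ≤ s.re → s.re ≤ 3 →
    ‖riemannZeta s‖ ≤ C * Real.log (s.im+3) := by
  set K := ∑' n : ℕ, ((n+1:ℕ):ℝ)^(-(1/2:ℝ)-1) with hK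
  have hK0 : 0 ≤ K := tsum_nonneg (fun n => by positivity)
  refine ⟨Real.exp 2 * 3 + Real.exp 2 + 5 * Real.exp 2 * (1 + K), ?_, ?_⟩
  · have := Real.add_one_le_exp 2
    nlinarith
  intro s ht hσ hσ3
  set t := s.im with htdef
  set l := Real.log (t+3) with hl
  have hl1 : 1 < l := by
    rw [hl, Real.lt_log_iff_exp_lt (by linarith)]
    linarith [Real.exp_one_lt_d9]
  have hσh : 1/2 < s.re := by
    have : 1/(2*l) < 1/2 := by
      apply one_div_lt_one_div_of_lt <;> linarith
    linarith
  have hσ0 : 0 < s.re := by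
    linarith
  have hN : ∃ N : ℕ, t^2 ≤ N ∧ (N:ℝ)+1 ≤ (t+3)^2 := by
    refine ⟨⌈t^2⌉₊, Nat.le_ceil _, ?_⟩
    have := Nat.ceil_lt_add_one (show 0 ≤ t^2 by positivity)
    nlinarith
  obtain ⟨N, hN1, hN2⟩ := hN
  have hlogn : ∀ m : ℕ, 1 ≤ m → m ≤ N+1 → (m:ℝ)^(1-s.re) ≤ Real.exp 2 := by
    intro m hm hmN
    have hm0 : (1:ℝ) ≤ m := by exact_mod_cast hm
    have hm1 : (m:ℝ) ≤ (t+3)^2 := by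
      have : (m:ℝ) ≤ N+1 := by exact_mod_cast hmN
      linarith
    calc (m:ℝ)^(1-s.re) ≤ (m:ℝ)^(1/(2*l)) := Real.rpow_le_rpow_of_exponent_le hm0 (by linarith)
      _ ≤ ((t+3)^2)^(1/(2*l)) := Real.rpow_le_rpow (by positivity) hm1 (by positivity)
      _ = Real.exp 1 := by
        rw [Real.rpow_def_of_pos (by positivity), Real.log_pow, ← hl]
        congr 1; push_cast; field_simp
      _ ≤ Real.exp 2 := Real.exp_le_exp.2 (by norm_num)
  rw [zeta_formula_N N s hσ0 (by linarith)]
  have b1 : ‖∑ n ∈ range N, ((n+1:ℕ):ℂ)^(-s)‖ ≤ Real.exp 2 * (1 + 2*l) := by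
    refine (norm_sum_le _ _).trans ?_
    have : ∀ n ∈ range N, ‖((n+1:ℕ):ℂ)^(-s)‖ ≤ Real.exp 2 * ((n:ℝ)+1)⁻¹ := by
      intro n hn
      rw [Complex.norm_natCast_cpow_of_pos (by omega), Complex.neg_re]
      have e : ((n+1:ℕ):ℝ)^(-s.re) = ((n+1:ℕ):ℝ)^(1-s.re) * ((n+1:ℕ):ℝ)^(-1:ℝ) := by
        rw [← Real.rpow_add (by positivity)]; congr 1; ring
      rw [e, Real.rpow_neg_one]
      push_cast
      gcongr
      have := hlogn (n+1) (by omega) (by have := mem_range.1 hn; omega)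
      push_cast at this; exact this
    refine (sum_le_sum this).trans ?_
    rw [← mul_sum]
    gcongr
    have h2 := harmonic_le_one_add_log N
    rw [harmonic] at h2
    push_cast at h2
    refine h2.trans ?_
    have : Real.log N ≤ 2 * l := by
      by_cases h0 : (N:ℝ) = 0
      · rw [h0]; simp; linarith
      have : 2 * l = Real.log ((t+3)^2) := by rw [Real.log_pow]; push_cast; rfl
      rw [this]
      apply Real.log_le_log (by positivity)
      linarith
    linarith
  have hs1 : 2 ≤ ‖s-1‖ := by
    refine le_trans ?_ (Complex.abs_im_le_norm _)
    simp only [Complex.sub_im, Complex.one_im, sub_zero]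
    exact le_trans ht (le_abs_self _)
  have b2 : ‖((N+1:ℕ):ℂ)^(1-s)/(s-1)‖ ≤ Real.exp 2 := by
    rw [norm_div, Complex.norm_natCast_cpow_of_pos (by omega), div_le_iff₀ (by linarith)]
    have := hlogn (N+1) (by omega) le_rfl
    simp only [Complex.sub_re, Complex.one_re]
    nlinarith [Real.exp_pos 2]
  have h1 : s ≠ 1 := by
    intro h; rw [h] at hs1; simp at hs1; linarith
  have b3 : ‖∑' n, Tz (n+N) s‖ ≤ 5 * Real.exp 2 * K := by
    have hb : ∀ n, ‖Tz (n+N) s‖ ≤ (5 * Real.exp 2) * ((n+1:ℕ):ℝ)^(-(1/2:ℝ)-1) := by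
      intro n
      refine (Tz_bound _ s hσ0 h1).trans ?_
      -- m = n+N+1
      set m : ℝ := ((n+N+1:ℕ):ℝ) with hm
      have hm0 : 0 < m := by positivity
      have hmN : (N:ℝ)+1 ≤ m := by rw [hm]; push_cast; linarith [Nat.cast_nonneg (α := ℝ) n]
      have hmn : ((n+1:ℕ):ℝ) ≤ m := by rw [hm]; push_cast; linarith [Nat.cast_nonneg (α := ℝ) N]
      have e : m^(-s.re-1) = m^(1/2 - s.re) * m^(-(1/2:ℝ)-1) := by
        rw [← Real.rpow_add hm0]; congr 1; ring
      have hmle : m^(-(1/2:ℝ)-1) ≤ ((n+1:ℕ):ℝ)^(-(1/2:ℝ)-1) :=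
        Real.rpow_le_rpow_of_nonpos (by positivity) hmn (by norm_num)
      have hsn : ‖s‖ ≤ t + 3 := by
        refine (Complex.norm_le_abs_re_add_abs_im s).trans ?_
        rw [abs_of_pos hσ0, abs_of_nonneg (show 0 ≤ s.im by linarith)]
        linarith
      have hm3 : m^(1/2 - s.re) ≤ Real.exp 2 * t⁻¹ := by
        calc m^(1/2 - s.re) ≤ ((N:ℝ)+1)^(1/2-s.re) :=
              Real.rpow_le_rpow_of_nonpos (by positivity) hmN (by linarith)
          _ = ((N:ℝ)+1)^(1-s.re) * ((N:ℝ)+1)^(-(1/2:ℝ)) := by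
              rw [← Real.rpow_add (by positivity)]; congr 1; ring
          _ ≤ Real.exp 2 * t⁻¹ := by
              gcongr
              · have := hlogn (N+1) (by omega) le_rfl
                push_cast at this; exact this
              · rw [Real.rpow_neg (by positivity), ← Real.sqrt_eq_rpow]
                apply inv_anti₀ (by linarith)
                apply Real.le_sqrt_of_sq_le
                linarith
      rw [e]
      calc ‖s‖ * (m^(1/2 - s.re) * m^(-(1/2:ℝ)-1)) ≤ (t+3) * ((Real.exp 2 * t⁻¹) * ((n+1:ℕ):ℝ)^(-(1/2:ℝ)-1)) := by
            gcongr
        _ = ((t+3)*t⁻¹) * (Real.exp 2 * ((n+1:ℕ):ℝ)^(-(1/2:ℝ)-1)) := by ring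
        _ ≤ 5 * (Real.exp 2 * ((n+1:ℕ):ℝ)^(-(1/2:ℝ)-1)) := by
            gcongr
            rw [← div_eq_mul_inv, div_le_iff₀ (by linarith)]; linarith
        _ = _ := by ring
    have hsum := (summable_aux (r := 1/2) (by norm_num)).mul_left (5 * Real.exp 2)
    have := tsum_of_norm_bounded hsum.hasSum hb
    rwa [tsum_mul_left] at this
  have e0 := norm_add₃_le (a := ∑ n ∈ range N, ((n+1:ℕ):ℂ)^(-s)) (b := ((N+1:ℕ):ℂ)^(1-s)/(s-1)) (c := ∑' n, Tz (n+N) s)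
  have hexp := Real.exp_pos 2
  have : Real.exp 2 * 1 ≤ Real.exp 2 * l := by gcongr
  have h5 : 5 * Real.exp 2 * K * 1 ≤ 5 * Real.exp 2 * K * l := by gcongr
  nlinarith

lemma zeta_upper : ∃ C : ℝ, 1 ≤ C ∧ ∀ s : ℂ, 2 ≤ |s.im| → 1 - 1/(2*Real.log (|s.im|+3)) ≤ s.re → s.re ≤ 3 →
    ‖riemannZeta s‖ ≤ C * Real.log (|s.im|+3) := by
  obtain ⟨C, hC1, hC⟩ := zeta_upper_pos
  refine ⟨C, hC1, fun s h1 h2 h3 => ?_⟩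
  rcases le_total 0 s.im with h | h
  · rw [abs_of_nonneg h] at *
    exact hC s h1 h2 h3
  · rw [abs_of_nonpos h] at *
    have := hC ((starRingEnd ℂ) s) (by simpa using h1) (by simpa using h2) (by simpa using h3)
    rw [riemannZeta_conj, Complex.norm_conj] at this
    simpa using this

end BS

namespace BS

noncomputable def ll (t : ℝ) : ℝ := Real.log (|t| + 3)

lemma ll_gt (t : ℝ) : 1 < ll t := by
  unfold ll
  rw [Real.lt_log_iff_exp_lt (by positivity)]
  have := abs_nonneg t
  linarith [Real.exp_one_lt_d9]

lemma ll_near (t u : ℝ) (h : |u| ≤ |t| + 1) : ll u ≤ 2 * ll t := by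
  unfold ll
  have h0 := abs_nonneg t
  have h1 := abs_nonneg u
  have : 2 * Real.log (|t|+3) = Real.log ((|t|+3)^2) := by rw [Real.log_pow]; push_cast; rfl
  rw [this]
  apply Real.log_le_log (by positivity)
  nlinarith

lemma ll_double (t u : ℝ) (h : |u| ≤ 2*|t|) : ll u ≤ 2 * ll t := by
  unfold ll
  have h0 := abs_nonneg t
  have h1 := abs_nonneg u
  have : 2 * Real.log (|t|+3) = Real.log ((|t|+3)^2) := by rw [Real.log_pow]; push_cast; rfl
  rw [this]
  apply Real.log_le_log (by positivity)
  nlinarith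

lemma im_near {s w : ℂ} {r : ℝ} (h : ‖w - s‖ ≤ r) : |w.im| ≤ |s.im| + r ∧ |s.im| - r ≤ |w.im| ∧
    w.re ≤ s.re + r ∧ s.re - r ≤ w.re := by
  have h1 := Complex.abs_im_le_norm (w - s)
  have h2 := Complex.abs_re_le_norm (w - s)
  simp only [Complex.sub_im, Complex.sub_re] at h1 h2
  have h3 := abs_sub_abs_le_abs_sub w.im s.im
  have h4 := abs_sub_abs_le_abs_sub s.im w.im
  rw [abs_sub_comm] at h4
  have h5 := abs_le.1 (h2.trans h)
  refine ⟨by linarith, by linarith, by linarith, by linarith⟩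

lemma zeta_deriv_bound : ∃ C : ℝ, 1 ≤ C ∧ ∀ s : ℂ, 3 ≤ |s.im| → 1 - 1/(8*ll s.im) ≤ s.re → s.re ≤ 2 →
    ‖deriv riemannZeta s‖ ≤ C * (ll s.im)^2 := by
  obtain ⟨C, hC1, hC⟩ := zeta_upper
  refine ⟨16*C, by linarith, fun s h1 h2 h3 => ?_⟩
  have hl := ll_gt s.im
  have hr1 : 1/(8*ll s.im) ≤ 1 := by rw [div_le_one (by linarith)]; linarith
  have hr0 : 0 < 1/(8*ll s.im) := by positivity
  have hne : ∀ w ∈ Metric.closedBall s (1/(8*ll s.im)), w ≠ 1 := by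
    rintro w hw rfl
    have := im_near (mem_closedBall_iff_norm.1 hw)
    have h4 := this.2.1
    simp only [Complex.one_im, abs_zero] at h4
    linarith
  have := Complex.norm_deriv_le_of_forall_mem_sphere_norm_le (c := s) (R := 1/(8*ll s.im)) (C := C * (2 * ll s.im))
    (f := riemannZeta) hr0 (by
      apply DifferentiableOn.diffContOnCl
      rw [closure_ball _ hr0.ne']
      exact fun w hw => (differentiableAt_riemannZeta (hne w hw)).differentiableWithinAt)
    (by
      intro w hw
      have hw' : ‖w - s‖ ≤ 1/(8*ll s.im) := (mem_sphere_iff_norm.1 hw).le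
      obtain ⟨a1, a2, a3, a4⟩ := im_near hw'
      have hlw := ll_near s.im w.im (by linarith)
      have hlw0 := ll_gt w.im
      refine (hC w (by linarith) ?_ (by linarith)).trans ?_
      · change 1 - 1/(2*ll w.im) ≤ w.re
        have : 1/(8*ll s.im) + 1/(8*ll s.im) ≤ 1/(2 * ll w.im) := by
          have : 1/(8*ll s.im) + 1/(8*ll s.im) = 1/(4 * ll s.im) := by field_simp; norm_num
          rw [this]
          apply one_div_le_one_div_of_le <;> linarith
        linarith
      · change C * ll w.im ≤ _
        gcongr)
  refine this.trans (le_of_eq ?_)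
  field_simp; ring

lemma zeta_near_one : ∃ A : ℝ, 1 ≤ A ∧ ∀ x : ℝ, 0 < x → x ≤ 1 → ‖riemannZeta (1+x)‖ ≤ A / x := by
  have hc : ContinuousOn (fun x : ℝ => riemannZeta₁ (1 + x)) (Set.Icc 0 1) := by
    apply Continuous.continuousOn
    exact differentiable_riemannZeta₁.continuous.comp (by fun_prop)
  obtain ⟨A, hA⟩ := isCompact_Icc.exists_bound_of_continuousOn hc
  refine ⟨max A 1, le_max_right _ _, fun x h0 h1 => ?_⟩
  have hne : (1 + (x:ℂ)) ≠ 1 := by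
    simp; exact h0.ne'
  rw [riemannZeta_eq_inv_sub_mul hne]
  have := hA x ⟨h0.le, h1⟩
  rw [norm_mul]
  have e : ‖((1 + (x:ℂ)) - 1)⁻¹‖ = x⁻¹ := by
    simp [abs_of_pos h0]
  rw [e, div_eq_inv_mul]
  gcongr
  exact this.trans (le_max_left _ _)

lemma zeta_prod (x : ℝ) (hx : 0 < x) (y : ℝ) :
    1 ≤ ‖riemannZeta (1+x)‖^3 * ‖riemannZeta (1 + x + Complex.I * y)‖^4 * ‖riemannZeta (1 + x + 2*Complex.I * y)‖ := by
  have := DirichletCharacter.norm_LFunction_product_ge_one (N := 1) 1 hx y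
  simpa [DirichletCharacter.LFunctionTrivChar, DirichletCharacter.LFunction_modOne_eq] using this

lemma zeta_lower : ∃ c : ℝ, 0 < c ∧ c ≤ 1/8 ∧ ∀ s : ℂ, 3 ≤ |s.im| → 1 - c/(ll s.im)^9 ≤ s.re → s.re ≤ 2 →
    c / (ll s.im)^7 ≤ ‖riemannZeta s‖ := by
  obtain ⟨C1, hC11, hC1⟩ := zeta_upper
  obtain ⟨C2, hC21, hC2⟩ := zeta_deriv_bound
  obtain ⟨A, hA1, hA⟩ := zeta_near_one
  set q := 1/(2*A^3*C1) with hq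
  have hA3 : 1 ≤ A^3 := one_le_pow₀ hA1
  have hq0 : 0 < q := by positivity
  have hq1 : q ≤ 1 := by
    rw [hq, div_le_one (by positivity)]
    nlinarith
  set κ := q/(4*C2) with hκ
  have hκ0 : 0 < κ := by positivity
  have hκ1 : κ ≤ 1/4 := by
    rw [hκ, div_le_div_iff₀ (by positivity) (by norm_num)]; nlinarith
  have hκ4 : κ^4 ≤ 1/8 := by
    calc κ^4 ≤ (1/4)^4 := by gcongr
      _ ≤ 1/8 := by norm_num
  -- large range
  have big : ∀ s : ℂ, 3 ≤ |s.im| → 1 + κ^4/(ll s.im)^9 ≤ s.re → s.re ≤ 2 → q*κ^3 / (ll s.im)^7 ≤ ‖riemannZeta s‖ := by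
    intro s h1 h2 h3
    have hl := ll_gt s.im
    set l := ll s.im with hldef
    set x := s.re - 1 with hx
    have hx0 : 0 < x := by
      have : 0 < κ^4/l^9 := by positivity
      linarith
    have hx2 : κ^4/l^9 ≤ x := by linarith
    have hp := zeta_prod x hx0 s.im
    have e1 : (1:ℂ) + x + Complex.I * s.im = s := by
      apply Complex.ext <;> simp [hx]
    rw [e1] at hp
    have u1 := hA x hx0 (by linarith)
    have u2 : ‖riemannZeta (1 + x + 2*Complex.I * s.im)‖ ≤ C1 * (2*l) := by
      have him : ((1:ℂ) + x + 2*Complex.I * s.im).im = 2 * s.im := by simp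
      have hre : ((1:ℂ) + x + 2*Complex.I * s.im).re = 1 + x := by simp
      have ha : |2 * s.im| = 2 * |s.im| := by rw [abs_mul]; norm_num
      have hpos : 0 ≤ 1/(2*Real.log (2*|s.im|+3)) := by
        have : 0 ≤ Real.log (2*|s.im|+3) := Real.log_nonneg (by linarith)
        positivity
      have := hC1 ((1:ℂ) + x + 2*Complex.I * s.im) (by rw [him, ha]; linarith)
        (by rw [him, hre, ha]; linarith) (by rw [hre]; linarith)
      refine this.trans ?_
      gcongr
      rw [him]
      exact ll_double _ _ (le_of_eq ha)
    have hz0 : 0 ≤ ‖riemannZeta s‖ := norm_nonneg _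
    have h4 : 1 ≤ (A/x)^3 * ‖riemannZeta s‖^4 * (C1*(2*l)) := by
      refine hp.trans ?_
      gcongr
    have h5 : x^3 ≤ A^3 * ‖riemannZeta s‖^4 * (C1*(2*l)) := by
      have : (A/x)^3 * ‖riemannZeta s‖^4 * (C1*(2*l)) = (A^3 * ‖riemannZeta s‖^4 * (C1*(2*l)))/x^3 := by
        rw [div_pow]; ring
      rw [this, le_div_iff₀ (by positivity)] at h4
      linarith
    have h6 : (q*κ^3/l^7)^4 ≤ ‖riemannZeta s‖^4 := by
      have hx3 : (κ^4/l^9)^3 ≤ x^3 := by gcongr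
      have : q * ((κ^4/l^9)^3 / l) ≤ ‖riemannZeta s‖^4 := by
        rw [hq, div_mul_eq_mul_div, one_mul, div_le_iff₀ (by positivity), div_le_iff₀ (by positivity)]
        refine (hx3.trans h5).trans (le_of_eq ?_)
        ring
      refine le_trans ?_ this
      have e : (q*κ^3/l^7)^4 = q^4 * ((κ^4/l^9)^3/l) := by
        field_simp
      rw [e]
      have : q^4 ≤ q := by
        calc q^4 = q * q^3 := by ring
          _ ≤ q * 1 := by gcongr; exact pow_le_one₀ hq0.le hq1
          _ = q := mul_one q
      gcongr
    exact (pow_le_pow_iff_left₀ (by positivity) hz0 (by norm_num)).1 h6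
  refine ⟨min (κ^4) (q*κ^3/2), by positivity, (min_le_left _ _).trans hκ4, fun s h1 h2 h3 => ?_⟩
  have hl := ll_gt s.im
  set l := ll s.im with hldef
  have hc1 : min (κ^4) (q*κ^3/2) / l^7 ≤ q*κ^3/2/l^7 := by gcongr; exact min_le_right _ _
  have hc2 : min (κ^4) (q*κ^3/2) / l^9 ≤ κ^4/l^9 := by gcongr; exact min_le_left _ _
  refine hc1.trans ?_
  by_cases hcase : 1 + κ^4/l^9 ≤ s.re
  · refine le_trans ?_ (big s h1 hcase h3)
    gcongr
    have : 0 < q * κ^3 := by positivity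
    linarith
  push Not at hcase
  have hl9 : κ^4/l^9 ≤ 1/(8*l) := by
    calc κ^4/l^9 ≤ (1/8)/l^9 := by gcongr
      _ = 1/(8*l^9) := by field_simp
      _ ≤ 1/(8*l) := by
        apply one_div_le_one_div_of_le (by linarith)
        have : l ≤ l^9 := le_self_pow₀ hl.le (by norm_num)
        linarith
  have hl8 : 1/(8*l) ≤ 1 := by rw [div_le_one (by linarith)]; linarith
  set s0 : ℂ := ⟨1 + κ^4/l^9, s.im⟩ with hs0
  have hb := big s0 h1 (le_refl _) (by simp [hs0]; linarith)
  have hmv := Convex.norm_image_sub_le_of_norm_deriv_le (f := riemannZeta) (C := C2 * l^2)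
    (s := {w : ℂ | 1 - 1/(8*l) ≤ w.re} ∩ ({w : ℂ | w.re ≤ 2} ∩ {w : ℂ | w.im = s.im})) (x := s) (y := s0)
    (by
      rintro w ⟨hw1, hw3, hw2⟩
      apply differentiableAt_riemannZeta
      rintro rfl
      have hw2 : (1:ℂ).im = s.im := hw2
      rw [← hw2] at h1; simp at h1; linarith)
    (by
      rintro w ⟨hw1, hw3, hw2⟩
      have hw2 : w.im = s.im := hw2
      have := hC2 w (by rw [hw2]; exact h1) (by rw [hw2]; exact hw1) hw3
      rwa [hw2] at this)
    ((convex_halfSpace_re_ge _).inter ((convex_halfSpace_re_le _).inter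
      (convex_hyperplane (𝕜 := ℝ) (f := Complex.im) ⟨Complex.add_im, fun c x => by simp⟩ _)))
    (by
      refine ⟨?_, h3, rfl⟩
      change 1 - 1/(8*l) ≤ s.re
      linarith)
    (by
      have : 0 < κ^4/l^9 := by positivity
      have : 0 < 1/(8*l) := by positivity
      refine ⟨?_, ?_, rfl⟩
      · change 1 - 1/(8*l) ≤ 1 + κ^4/l^9
        linarith
      · change 1 + κ^4/l^9 ≤ 2
        linarith)
  have hd : ‖s0 - s‖ ≤ 2*(κ^4/l^9) := by
    refine (Complex.norm_le_abs_re_add_abs_im _).trans ?_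
    simp only [Complex.sub_re, Complex.sub_im, hs0, sub_self, abs_zero, add_zero]
    rw [abs_le]; constructor <;> linarith
  have h7 : ‖riemannZeta s0 - riemannZeta s‖ ≤ q*κ^3/2/l^7 := by
    refine hmv.trans ?_
    calc C2 * l^2 * ‖s0 - s‖ ≤ C2 * l^2 * (2*(κ^4/l^9)) := by gcongr
      _ = 2*C2*κ*κ^3/l^7 := by field_simp
      _ = q*κ^3/2/l^7 := by rw [hκ]; field_simp; norm_num
  have h8 := norm_sub_norm_le (riemannZeta s0) (riemannZeta s)
  have h9 : q*κ^3/l^7 = q*κ^3/2/l^7 + q*κ^3/2/l^7 := by ring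
  have hb' : q*κ^3/l^7 ≤ ‖riemannZeta s0‖ := hb
  linarith

end BS

namespace BS

noncomputable def lamC (n : ℕ) : ℂ := ((ArithmeticFunction.liouville n : ℤ) : ℂ)

lemma norm_lamC_le (n : ℕ) : ‖lamC n‖ ≤ 1 := by
  unfold lamC
  by_cases h : n = 0
  · simp [h]
  · rw [ArithmeticFunction.liouville_apply h]; simp

noncomputable def lamHom {s : ℂ} (hs : s ≠ 0) : ℕ →*₀ ℂ where
  toFun n := lamC n * riemannZetaSummandHom hs n
  map_zero' := by simp [lamC]
  map_one' := by simp [lamC, ArithmeticFunction.liouville_apply]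
  map_mul' a b := by
    simp only [lamC, ArithmeticFunction.liouville_apply_mul, map_mul]
    push_cast
    ring

noncomputable def DD (s : ℂ) : ℂ := riemannZeta (2*s) * (s-1) / riemannZeta₁ s

lemma DD_eq {s : ℂ} (hs : s ≠ 1) : DD s = riemannZeta (2*s) / riemannZeta s := by
  have h : s - 1 ≠ 0 := sub_ne_zero.2 hs
  rw [DD, riemannZeta_eq_inv_sub_mul hs, div_mul_eq_div_div, div_inv_eq_mul]

lemma zeta1_ne {s : ℂ} (hs : 1 ≤ s.re) : riemannZeta₁ s ≠ 0 := by
  by_cases h : s = 1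
  · rw [h, riemannZeta₁_one]; exact one_ne_zero
  · have := riemannZeta_ne_zero_of_one_le_re hs
    rw [riemannZeta_eq_inv_sub_mul h] at this
    exact right_ne_zero_of_mul this

lemma LSeries_lam {s : ℂ} (hs : 1 < s.re) : LSeries lamC s = DD s := by
  have hs0 : s ≠ 0 := by rintro rfl; simp at hs; linarith
  have hs1 : s ≠ 1 := by rintro rfl; simp at hs
  have hsum : Summable (fun n => ‖lamHom hs0 n‖) := by
    refine Summable.of_nonneg_of_le (fun _ => norm_nonneg _) (fun n => ?_) (summable_riemannZetaSummand hs)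
    change ‖lamC n * riemannZetaSummandHom hs0 n‖ ≤ _
    rw [norm_mul]
    refine (mul_le_of_le_one_left (norm_nonneg _) (norm_lamC_le n)).trans (le_of_eq rfl)
  have h1 := EulerProduct.eulerProduct_completely_multiplicative_hasProd hsum
  have h2 := riemannZeta_eulerProduct_hasProd hs
  have h3 := riemannZeta_eulerProduct_hasProd (s := 2*s) (by simp; linarith)
  have h4 := h1.mul h2
  have e : (fun p : Nat.Primes => (1 - lamHom hs0 (p:ℕ))⁻¹ * (1 - ((p:ℕ):ℂ) ^ (-s))⁻¹) =
      (fun p : Nat.Primes => (1 - ((p:ℕ):ℂ) ^ (-(2*s)))⁻¹) := by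
    funext p
    rw [← mul_inv]
    congr 1
    have : lamHom hs0 (p:ℕ) = - ((p:ℕ):ℂ)^(-s) := by
      change lamC p * ((p:ℕ):ℂ)^(-s) = _
      rw [lamC, ArithmeticFunction.liouville_apply p.2.ne_zero, ArithmeticFunction.cardFactors_apply_prime p.2]
      simp
    rw [this]
    have : ((p:ℕ):ℂ)^(-(2*s)) = ((p:ℕ):ℂ)^(-s) * ((p:ℕ):ℂ)^(-s) := by
      rw [← Complex.cpow_add _ _ (by exact_mod_cast p.2.ne_zero)]
      congr 1; ring
    rw [this]; ring
  rw [e] at h4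
  have h5 := h4.unique h3
  have hz : riemannZeta s ≠ 0 := riemannZeta_ne_zero_of_one_le_re hs.le
  rw [DD_eq hs1, eq_div_iff hz, ← h5]
  congr 1
  rw [LSeries]
  apply tsum_congr
  intro n
  change _ = lamC n * (n:ℂ)^(-s)
  by_cases hn : n = 0
  · simp [hn, lamC]
  · rw [LSeries.term_of_ne_zero hn, Complex.cpow_neg, div_eq_mul_inv]

lemma zeta_bdd : ∃ M : ℝ, 1 ≤ M ∧ ∀ s : ℂ, 3/2 ≤ s.re → ‖riemannZeta s‖ ≤ M := by
  have hs : Summable (fun n : ℕ => 1 / (n:ℝ)^(3/2:ℝ)) := Real.summable_one_div_nat_rpow.2 (by norm_num)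
  refine ⟨max 1 (∑' n : ℕ, 1 / (n:ℝ)^(3/2:ℝ)), le_max_left _ _, fun s h => le_trans ?_ (le_max_right _ _)⟩
  rw [zeta_eq_tsum_one_div_nat_cpow (by linarith)]
  refine tsum_of_norm_bounded hs.hasSum (fun n => ?_)
  by_cases hn : n = 0
  · subst hn
    have : s ≠ 0 := by rintro rfl; simp at h; linarith
    simp [this]
  · rw [norm_div, norm_one, Complex.norm_natCast_cpow_of_pos (by omega)]
    have : (1:ℝ) ≤ n := by exact_mod_cast Nat.one_le_iff_ne_zero.2 hn
    apply one_div_le_one_div_of_le (by positivity)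
    exact Real.rpow_le_rpow_of_exponent_le this h

lemma ll_pow (m : ℕ) (hm : 1 ≤ m) : ∃ C : ℝ, 0 < C ∧ ∀ t : ℝ, (ll t)^m ≤ C * (1+|t|)^(1/2:ℝ) := by
  refine ⟨(2*m)^m * 2, by positivity, fun t => ?_⟩
  have ht := abs_nonneg t
  have hm0 : (0:ℝ) < m := by exact_mod_cast hm
  have h1 := Real.log_le_rpow_div (x := |t|+3) (ε := 1/(2*m)) (by positivity) (by positivity)
  have h2 : (ll t)^m ≤ ((|t|+3)^(1/(2*m:ℝ)) / (1/(2*m)))^m :=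
    pow_le_pow_left₀ (a := ll t) (by linarith [ll_gt t]) h1 m
  refine h2.trans ?_
  have h3 : ((|t|+3)^(1/(2*m:ℝ)) / (1/(2*m)))^m = (2*m)^m * (|t|+3)^(1/2:ℝ) := by
    rw [div_eq_mul_inv]
    rw [mul_pow, ← Real.rpow_natCast ((|t|+3)^_), ← Real.rpow_mul (by positivity)]
    rw [mul_comm]
    congr 1
    · field_simp
    · congr 1; field_simp
  rw [h3, mul_assoc]
  gcongr
  calc (|t|+3)^(1/2:ℝ) ≤ (4*(1+|t|))^(1/2:ℝ) := by
        apply Real.rpow_le_rpow (by positivity) (by linarith) (by norm_num)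
    _ = 4^(1/2:ℝ) * (1+|t|)^(1/2:ℝ) := Real.mul_rpow (by norm_num) (by positivity)
    _ = 2 * (1+|t|)^(1/2:ℝ) := by
      congr 1
      rw [← Real.sqrt_eq_rpow, show (4:ℝ) = 2^2 by norm_num]
      exact Real.sqrt_sq (by norm_num)

lemma DD_analyticAt {s : ℂ} (h : 1 ≤ s.re) : AnalyticAt ℂ DD s := by
  have h2 : AnalyticAt ℂ (fun s => riemannZeta (2*s)) s := by
    have : DifferentiableOn ℂ (fun s => riemannZeta (2*s)) {s | 1/2 < s.re} := by
      intro w hw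
      have hw : 1/2 < w.re := hw
      apply DifferentiableAt.differentiableWithinAt
      have hne : 2 * w ≠ 1 := by
        intro hh
        have := congrArg Complex.re hh
        simp at this
        linarith
      exact (differentiableAt_riemannZeta hne).comp w (by fun_prop)
    exact this.analyticAt ((isOpen_lt continuous_const Complex.continuous_re).mem_nhds (by
      change 1/2 < s.re; linarith))
  have h3 : AnalyticAt ℂ riemannZeta₁ s := differentiable_riemannZeta₁.analyticAt s
  exact (h2.mul (by fun_prop)).div h3 (zeta1_ne h)

lemma DD_iter_bound (k : ℕ) : ∃ C : ℝ, 0 < C ∧ ∀ s : ℂ, 1 < s.re → s.re ≤ 3/2 →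
    ‖iteratedDeriv k DD s‖ ≤ C * (1+|s.im|)^(1/2:ℝ) := by
  obtain ⟨c, hc0, hc8, hc⟩ := zeta_lower
  obtain ⟨M, hM1, hM⟩ := zeta_bdd
  obtain ⟨C1, hC10, hC1⟩ := ll_pow (7+9*k) (by omega)
  -- compact part
  have hcomp : ∃ C2 : ℝ, ∀ s ∈ (Set.Icc (1:ℝ) (3/2)) ×ℂ (Set.Icc (-4:ℝ) 4), ‖iteratedDeriv k DD s‖ ≤ C2 := by
    apply (isCompact_Icc.reProdIm isCompact_Icc).exists_bound_of_continuousOn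
    have : AnalyticOnNhd ℂ DD {s | 1 ≤ s.re} := fun s hs => DD_analyticAt hs
    have := this.iterated_deriv k
    rw [iteratedDeriv_eq_iterate]
    refine this.continuousOn.mono ?_
    intro s hs
    exact (Complex.mem_reProdIm.1 hs).1.1
  obtain ⟨C2, hC2⟩ := hcomp
  refine ⟨max C2 (k.factorial * (128*M/c) * (512/c)^k * C1), lt_of_lt_of_le (by positivity) (le_max_right _ _), fun s h1 h2 => ?_⟩
  have h1t : 1 ≤ (1+|s.im|)^(1/2:ℝ) := Real.one_le_rpow (by linarith [abs_nonneg s.im]) (by norm_num)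
  by_cases ht : |s.im| ≤ 4
  · have hb := hC2 s (Complex.mem_reProdIm.2 ⟨⟨h1.le, h2⟩, abs_le.1 ht⟩)
    have h0 := (norm_nonneg _).trans hb
    calc _ ≤ C2 := hb
      _ ≤ max C2 (k.factorial * (128*M/c) * (512/c)^k * C1) * 1 := by rw [mul_one]; exact le_max_left _ _
      _ ≤ _ := by
        gcongr
  push Not at ht
  have hl := ll_gt s.im
  set l := ll s.im with hldef
  set r := c/(512*l^9) with hr
  have hr0 : 0 < r := by positivity
  have hl9 : 1 ≤ l^9 := one_le_pow₀ hl.le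
  have hr8 : r ≤ 1/8 := by
    rw [hr, div_le_iff₀ (by positivity)]; nlinarith
  have key : ∀ w ∈ Metric.closedBall s r, w ≠ 1 ∧ riemannZeta w ≠ 0 ∧ ‖DD w‖ ≤ 128*M/c*l^7 ∧ 1/2 < w.re := by
    intro w hw
    obtain ⟨a1, a2, a3, a4⟩ := im_near (mem_closedBall_iff_norm.1 hw)
    have hw3 : 3 ≤ |w.im| := by linarith
    have hlw := ll_near s.im w.im (by linarith)
    have hlw1 := ll_gt w.im
    have hne : w ≠ 1 := by rintro rfl; simp at hw3; linarith
    have hz := hc w hw3 (by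
      have : r ≤ c/(ll w.im)^9 := by
        rw [hr]
        apply div_le_div_of_nonneg_left hc0.le (by positivity)
        calc (ll w.im)^9 ≤ (2*l)^9 := by gcongr
          _ = 512*l^9 := by ring
      linarith) (by linarith)
    have hzpos : 0 < c/(ll w.im)^7 := by positivity
    have hz' : c/(128*l^7) ≤ ‖riemannZeta w‖ := by
      refine le_trans ?_ hz
      apply div_le_div_of_nonneg_left hc0.le (by positivity)
      calc (ll w.im)^7 ≤ (2*l)^7 := by gcongr
          _ = 128*l^7 := by ring
    refine ⟨hne, norm_pos_iff.1 (hzpos.trans_le hz), ?_, by linarith⟩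
    rw [DD_eq hne, norm_div]
    have hM' := hM (2*w) (by simp; linarith)
    calc ‖riemannZeta (2*w)‖/‖riemannZeta w‖ ≤ M/(c/(128*l^7)) := by gcongr
      _ = 128*M/c*l^7 := by field_simp
  have hC := Complex.norm_iteratedDeriv_le_of_forall_mem_sphere_norm_le (f := DD) (c := s) (R := r) (C := 128*M/c*l^7) k hr0
    (by
      apply DifferentiableOn.diffContOnCl
      rw [closure_ball _ hr0.ne']
      intro w hw
      obtain ⟨b1, b2, b3, b4⟩ := key w hw
      apply DifferentiableAt.differentiableWithinAt
      have hne2 : 2 * w ≠ 1 := by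
        intro hh
        have := congrArg Complex.re hh
        simp at this
        linarith
      have hz1 : riemannZeta₁ w ≠ 0 := by
        rw [riemannZeta_eq_inv_sub_mul b1] at b2
        exact right_ne_zero_of_mul b2
      have hA : DifferentiableAt ℂ (fun s => riemannZeta (2*s)) w :=
        (differentiableAt_riemannZeta hne2).comp w (by fun_prop)
      exact (hA.mul (by fun_prop)).div (differentiable_riemannZeta₁ w) hz1)
    (fun z hz => (key z (Metric.sphere_subset_closedBall hz)).2.2.1)
  refine hC.trans ?_
  calc k.factorial * (128*M/c*l^7) / r^k = k.factorial * (128*M/c) * (512/c)^k * l^(7+9*k) := by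
        rw [hr, div_pow, div_pow, mul_pow, ← pow_mul, pow_add]
        field_simp
    _ ≤ k.factorial * (128*M/c) * (512/c)^k * (C1 * (1+|s.im|)^(1/2:ℝ)) := by
        gcongr
        exact hC1 _
    _ = (k.factorial * (128*M/c) * (512/c)^k * C1) * (1+|s.im|)^(1/2:ℝ) := by ring
    _ ≤ _ := by
      gcongr
      exact le_max_right _ _

lemma LSeries_log_bound (k : ℕ) : ∃ C : ℝ, 0 < C ∧ ∀ s : ℂ, 1 < s.re → s.re ≤ 3/2 →
    ‖LSeries (LSeries.logMul^[k] lamC) s‖ ≤ C * (1+|s.im|)^(1/2:ℝ) := by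
  obtain ⟨C, hC0, hC⟩ := DD_iter_bound k
  refine ⟨C, hC0, fun s h1 h2 => ?_⟩
  have hab : LSeries.abscissaOfAbsConv lamC < s.re :=
    lt_of_le_of_lt (LSeries.abscissaOfAbsConv_le_of_le_const ⟨1, fun n _ => norm_lamC_le n⟩) (by exact_mod_cast h1)
  have h := LSeries_iteratedDeriv (f := lamC) k hab
  have heq : LSeries lamC =ᶠ[nhds s] DD := by
    filter_upwards [(isOpen_lt continuous_const Complex.continuous_re).mem_nhds h1] with w hw
    exact LSeries_lam hw
  rw [heq.iteratedDeriv_eq] at h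
  have h3 := hC s h1 h2
  rw [h, norm_mul] at h3
  simpa using h3

end BS

namespace BS

noncomputable def ff (y : ℝ) : ℂ := ((max (1-y) 0 : ℝ) : ℂ)

lemma ff_mellin {s : ℂ} (hs : 0 < s.re) : MellinConvergent ff s ∧ mellin ff s = 1/s - 1/(s+1) := by
  have h1 := hasMellin_one_Ioc hs
  have h2 := hasMellin_cpow_Ioc 1 (s := s) (by simp; linarith)
  have h3 := hasMellin_sub h1.1 h2.1
  rw [h1.2, h2.2] at h3
  have e : ∀ t ∈ Set.Ioi (0:ℝ), (fun t => ((Set.Ioc (0:ℝ) 1).indicator (fun _ => (1:ℂ)) t -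
      (Set.Ioc (0:ℝ) 1).indicator (fun t => (t:ℂ)^(1:ℂ)) t)) t = ff t := by
    intro t ht
    have ht : 0 < t := ht
    by_cases h : t ≤ 1
    · have : t ∈ Set.Ioc (0:ℝ) 1 := ⟨ht, h⟩
      simp only [Set.indicator_of_mem this, ff, Complex.cpow_one]
      rw [max_eq_left (by linarith)]; push_cast; ring
    · have : t ∉ Set.Ioc (0:ℝ) 1 := fun hh => h hh.2
      simp only [Set.indicator_of_notMem this, ff]
      rw [max_eq_right (by linarith)]; simp
  constructor
  · refine (MeasureTheory.integrableOn_congr_fun ?_ measurableSet_Ioi).1 h3.1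
    intro t ht
    simp only [← e t ht]
  · rw [← h3.2]
    apply MeasureTheory.setIntegral_congr_fun measurableSet_Ioi
    intro t ht
    simp only [← e t ht]

lemma G_bound (σ t : ℝ) (hσ : 1 ≤ σ) : ‖1/((σ:ℂ)+t*Complex.I) - 1/((σ:ℂ)+t*Complex.I+1)‖ ≤ 4 * (1+|t|)^(-2:ℝ) := by
  set s : ℂ := (σ:ℂ)+t*Complex.I with hs
  have hre : s.re = σ := by simp [hs]
  have him : s.im = t := by simp [hs]
  have h0 : s ≠ 0 := by intro h; rw [h] at hre; simp at hre; linarith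
  have h1 : s + 1 ≠ 0 := by
    intro h
    have := congrArg Complex.re h
    simp [hre] at this; linarith
  have e : 1/s - 1/(s+1) = 1/(s*(s+1)) := by field_simp; ring
  rw [e, norm_div, norm_one, norm_mul]
  have a1 : (1+|t|)/2 ≤ ‖s‖ := by
    have := Complex.abs_re_le_norm s
    have := Complex.abs_im_le_norm s
    rw [him] at this
    have := (le_abs_self σ)
    rw [hre] at *
    linarith
  have a2 : (1+|t|)/2 ≤ ‖s+1‖ := by
    have h1 := Complex.abs_re_le_norm (s+1)
    have h2 := Complex.abs_im_le_norm (s+1)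
    simp only [Complex.add_re, Complex.add_im, Complex.one_re, Complex.one_im, him, hre, add_zero] at h1 h2
    have := (le_abs_self (σ+1))
    linarith
  have ht := abs_nonneg t
  rw [Real.rpow_neg (by linarith), ← div_eq_mul_inv]
  have h2 : (1+|t|)^(2:ℝ) = (1+|t|)^2 := by norm_cast
  rw [h2, div_le_div_iff₀ (by positivity) (by positivity), one_mul]
  nlinarith [mul_le_mul a1 a2 (by positivity) (by positivity)]

lemma G_cont (σ : ℝ) (hσ : 1 ≤ σ) : Continuous (fun t : ℝ => 1/((σ:ℂ)+t*Complex.I) - 1/((σ:ℂ)+t*Complex.I+1)) := by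
  have h0 : ∀ t : ℝ, (σ:ℂ)+t*Complex.I ≠ 0 := by
    intro t h
    have := congrArg Complex.re h
    simp at this; linarith
  have h1 : ∀ t : ℝ, (σ:ℂ)+t*Complex.I + 1 ≠ 0 := by
    intro t h
    have := congrArg Complex.re h
    simp at this; linarith
  exact (continuous_const.div (by fun_prop) h0).sub (continuous_const.div (by fun_prop) h1)

lemma pint (r : ℝ) (hr : 1 < r) : MeasureTheory.Integrable (fun t : ℝ => (1+|t|)^(-r)) := by
  have := integrable_one_add_norm (E := ℝ) (μ := MeasureTheory.volume) (r := r) (by simpa using hr)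
  simpa using this

lemma G_int (σ : ℝ) (hσ : 1 ≤ σ) : MeasureTheory.Integrable (fun t : ℝ => 1/((σ:ℂ)+t*Complex.I) - 1/((σ:ℂ)+t*Complex.I+1)) := by
  refine MeasureTheory.Integrable.mono' ((pint 2 (by norm_num)).const_mul 4) (G_cont σ hσ).aestronglyMeasurable ?_
  exact Eventually.of_forall (fun t => G_bound σ t hσ)

lemma ff_inv (σ : ℝ) (hσ : 1 ≤ σ) (y : ℝ) (hy : 0 < y) :
    ff y = (1/(2*Real.pi)) • ∫ t : ℝ, (y:ℂ)^(-((σ:ℂ)+t*Complex.I)) • (1/((σ:ℂ)+t*Complex.I) - 1/((σ:ℂ)+t*Complex.I+1)) := by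
  have hm : ∀ t : ℝ, mellin ff ((σ:ℂ)+t*Complex.I) = 1/((σ:ℂ)+t*Complex.I) - 1/((σ:ℂ)+t*Complex.I+1) := by
    intro t
    exact (ff_mellin (by simp; linarith)).2
  have := mellinInv_mellin_eq σ ff hy (ff_mellin (by simp; linarith)).1
    (by
      unfold Complex.VerticalIntegrable
      simp_rw [hm]
      exact G_int σ hσ) (by unfold ff; fun_prop)
  rw [← this, mellinInv]
  simp_rw [hm]

lemma logMul_iter (f : ℕ → ℂ) (k n : ℕ) : LSeries.logMul^[k] f n = (Complex.log n)^k * f n := by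
  induction k with
  | zero => simp
  | succ k ih =>
    rw [Function.iterate_succ_apply', LSeries.logMul, ih]; ring

lemma perron (k : ℕ) : ∃ C : ℝ, 0 < C ∧ ∀ x : ℝ, 9 ≤ x →
    ‖∑ n ∈ Icc 1 ⌊x⌋₊, LSeries.logMul^[k] lamC n * (1 - n/x)‖ ≤ C * x := by
  obtain ⟨C, hC0, hC⟩ := LSeries_log_bound k
  set I0 := ∫ t : ℝ, (1+|t|)^(-(3/2:ℝ)) with hI0
  have hI0n : 0 ≤ I0 := MeasureTheory.integral_nonneg (fun t => by positivity)
  refine ⟨(1/(2*Real.pi)) * (C * Real.exp 1 * 4 * I0) + 1, by positivity, fun x hx => ?_⟩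
  set a := LSeries.logMul^[k] lamC with ha
  have hlog : 2 ≤ Real.log x := by
    rw [Real.le_log_iff_exp_le (by linarith)]
    have := Real.exp_one_lt_d9
    have e2 : Real.exp 2 = Real.exp 1 * Real.exp 1 := by rw [← Real.exp_add]; norm_num
    rw [e2]
    nlinarith [Real.exp_pos 1]
  set σ := 1 + 1/Real.log x with hσ
  have hσ1 : 1 < σ := by
    have : 0 < 1/Real.log x := by positivity
    linarith
  have hσ2 : σ ≤ 3/2 := by
    have : 1/Real.log x ≤ 1/2 := one_div_le_one_div_of_le (by norm_num) hlog
    linarith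
  have hx0 : (0:ℝ) < x := by linarith
  have hxσ : x^σ = Real.exp 1 * x := by
    rw [hσ, Real.rpow_add hx0, Real.rpow_one, mul_comm]
    congr 1
    rw [Real.rpow_def_of_pos hx0]
    congr 1; field_simp
  let G : ℝ → ℂ := fun t => 1/((σ:ℂ)+t*Complex.I) - 1/((σ:ℂ)+t*Complex.I+1)
  let s : ℝ → ℂ := fun t => (σ:ℂ)+t*Complex.I
  have hsre : ∀ t, (s t).re = σ := by intro t; simp [s]
  have hsim : ∀ t, (s t).im = t := by intro t; simp [s]
  let F : ℕ → ℝ → ℂ := fun n t => LSeries.term a (s t) n * ((x:ℂ)^(s t) * G t)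
  have hFnorm : ∀ n t, ‖F n t‖ = ‖LSeries.term a σ n‖ * (x^σ * ‖G t‖) := by
    intro n t
    simp only [F, norm_mul]
    rw [Complex.norm_cpow_eq_rpow_re_of_pos hx0, hsre]
    congr 1
    rw [LSeries.norm_term_eq, LSeries.norm_term_eq, hsre]; simp
  have hab : LSeries.abscissaOfAbsConv a < (σ:ℂ).re := by
    rw [ha, LSeries.absicssaOfAbsConv_logPowMul]
    exact lt_of_le_of_lt (LSeries.abscissaOfAbsConv_le_of_le_const ⟨1, fun n _ => norm_lamC_le n⟩) (by rw [Complex.ofReal_re]; exact_mod_cast hσ1)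
  have hsum : Summable (fun n => ‖LSeries.term a σ n‖) := (LSeriesSummable_of_abscissaOfAbsConv_lt_re hab).norm
  have hFint : ∀ n, MeasureTheory.Integrable (F n) := by
    intro n
    have : MeasureTheory.Integrable (fun t => ‖LSeries.term a σ n‖ * (x^σ * ‖G t‖)) :=
      ((G_int σ hσ1.le).norm.const_mul _).const_mul _
    refine this.mono' ?_ (Eventually.of_forall (fun t => (hFnorm n t).le))
    apply Continuous.aestronglyMeasurable
    refine Continuous.mul ?_ (Continuous.mul ?_ (G_cont σ hσ1.le))
    · by_cases hn : n = 0
      · simp [hn]; exact continuous_const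
      · simp only [LSeries.term_of_ne_zero hn]
        have hn' : (n:ℂ) ≠ 0 := by exact_mod_cast hn
        refine continuous_const.div ?_ (fun t => by rw [Ne, Complex.cpow_eq_zero_iff]; tauto)
        exact Continuous.const_cpow (by fun_prop) (Or.inl hn')
    · exact Continuous.const_cpow (by fun_prop) (Or.inl (by exact_mod_cast hx0.ne'))
  have hhs := MeasureTheory.hasSum_integral_of_summable_integral_norm hFint (by
    simp_rw [hFnorm, MeasureTheory.integral_const_mul]
    exact hsum.mul_right _)
  -- each integral
  have hFn : ∀ n, n ≠ 0 → ∫ t, F n t = a n * ((2*Real.pi:ℝ) * ff (n/x)) := by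
    intro n hn
    have hn0 : (0:ℝ) < n := by exact_mod_cast Nat.pos_of_ne_zero hn
    rw [ff_inv σ hσ1.le (n/x) (by positivity)]
    have : ∀ t : ℝ, F n t = a n * ((((n/x:ℝ):ℂ))^(-((σ:ℂ)+t*Complex.I)) • (1/((σ:ℂ)+t*Complex.I) - 1/((σ:ℂ)+t*Complex.I+1))) := by
      intro t
      simp only [F, LSeries.term_of_ne_zero hn, smul_eq_mul]
      rw [div_mul_eq_mul_div, mul_div_assoc]
      congr 1
      change _ = _ * G t
      rw [mul_div_right_comm]
      congr 1
      rw [Complex.cpow_neg, ← Complex.inv_cpow]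
      · rw [← Complex.ofReal_inv, inv_div]
        rw [Complex.ofReal_div, Complex.div_cpow_ofReal_nonneg] <;> first | positivity | simp [s]
      · rw [Complex.arg_ofReal_of_nonneg (by positivity)]
        exact Real.pi_pos.ne
    simp_rw [this]
    rw [MeasureTheory.integral_const_mul]
    congr 1
    rw [Complex.real_smul, ← mul_assoc, ← Complex.ofReal_mul]
    have : 2 * Real.pi * (1/(2*Real.pi)) = 1 := by field_simp
    rw [this]; simp
  have htot : (2*Real.pi:ℝ) * ∑ n ∈ Icc 1 ⌊x⌋₊, a n * (1 - n/x) = ∫ t, ∑' n, F n t := by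
    rw [← hhs.tsum_eq, tsum_eq_sum (s := Icc 1 ⌊x⌋₊), Finset.mul_sum]
    · apply Finset.sum_congr rfl
      intro n hn
      rw [Finset.mem_Icc] at hn
      have hnx : (n:ℝ) ≤ x := (Nat.le_floor_iff hx0.le).1 hn.2
      rw [hFn n (by omega), ff, max_eq_left]
      · push_cast; ring
      · rw [sub_nonneg, div_le_one hx0]; exact hnx
    · intro n hn
      by_cases h0 : n = 0
      · simp [F, h0]
      · rw [hFn n h0, ff, max_eq_right]
        · simp
        · have : x < n := by
            by_contra hh
            push Not at hh
            exact hn (Finset.mem_Icc.2 ⟨by omega, Nat.le_floor hh⟩)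
          rw [sub_nonpos, one_le_div hx0]; exact this.le
  have hbound : ‖∫ t, ∑' n, F n t‖ ≤ ∫ t : ℝ, (C * Real.exp 1 * 4 * x) * (1+|t|)^(-(3/2:ℝ)) := by
    refine MeasureTheory.norm_integral_le_of_norm_le ((pint (3/2) (by norm_num)).const_mul _) (Eventually.of_forall (fun t => ?_))
    have ht := abs_nonneg t
    simp only [F]
    rw [tsum_mul_right, norm_mul, norm_mul]
    change ‖LSeries a (s t)‖ * _ ≤ _
    have b1 := hC (s t) (by rw [hsre]; exact hσ1) (by rw [hsre]; exact hσ2)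
    rw [hsim] at b1
    rw [Complex.norm_cpow_eq_rpow_re_of_pos hx0, hsre, hxσ]
    have b2 : ‖G t‖ ≤ 4 * (1+|t|)^(-2:ℝ) := G_bound σ t hσ1.le
    have b3 : (1+|t|)^(-(3/2:ℝ)) = (1+|t|)^(1/2:ℝ) * (1+|t|)^(-2:ℝ) := by
      rw [← Real.rpow_add (by linarith)]; norm_num
    rw [b3]
    calc ‖LSeries a (s t)‖ * (Real.exp 1 * x * ‖G t‖) ≤ (C * (1+|t|)^(1/2:ℝ)) * (Real.exp 1 * x * (4 * (1+|t|)^(-2:ℝ))) := by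
          gcongr
      _ = _ := by ring
  rw [← htot, MeasureTheory.integral_const_mul, ← hI0, norm_mul] at hbound
  have h2pi : ‖((2*Real.pi:ℝ):ℂ)‖ = 2*Real.pi := by
    rw [Complex.norm_real, Real.norm_of_nonneg (by positivity)]
  rw [h2pi] at hbound
  have hfin : ‖∑ n ∈ Icc 1 ⌊x⌋₊, a n * (1 - n/x)‖ ≤ (C * Real.exp 1 * 4 * x * I0)/(2*Real.pi) := by
    rw [le_div_iff₀ (by positivity)]; linarith
  refine hfin.trans ?_
  have : (C * Real.exp 1 * 4 * x * I0)/(2*Real.pi) = (1/(2*Real.pi)) * (C * Real.exp 1 * 4 * I0) * x := by ring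
  rw [this]
  nlinarith

noncomputable def lam (n : ℕ) : ℝ := ((ArithmeticFunction.liouville n : ℤ) : ℝ)

lemma perronR (k : ℕ) : ∃ C : ℝ, 0 < C ∧ ∀ x : ℝ, 9 ≤ x →
    |∑ n ∈ Icc 1 ⌊x⌋₊, (Real.log n)^k * lam n * (x - n)| ≤ C * x^2 := by
  obtain ⟨C, h0, h⟩ := perron k
  refine ⟨C, h0, fun x hx => ?_⟩
  have := h x hx
  have hx0 : 0 < x := by linarith
  have e : (∑ n ∈ Icc 1 ⌊x⌋₊, LSeries.logMul^[k] lamC n * (1 - n/x)) =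
      (((∑ n ∈ Icc 1 ⌊x⌋₊, (Real.log n)^k * lam n * (x - n)) / x : ℝ) : ℂ) := by
    push_cast
    rw [Finset.sum_div]
    apply Finset.sum_congr rfl
    intro n hn
    rw [logMul_iter, lamC, lam]
    have : (x:ℂ) ≠ 0 := by exact_mod_cast hx0.ne'
    push_cast
    field_simp
  rw [e, Complex.norm_real, Real.norm_eq_abs, abs_div, abs_of_pos hx0, div_le_iff₀ hx0] at this
  linarith [sq x]

end BS

namespace BS

lemma log_pow_le (m : ℕ) (ε : ℝ) (hε : 0 < ε) : ∃ C : ℝ, 0 < C ∧ ∀ x : ℝ, 1 ≤ x → (Real.log x)^m ≤ C * x^ε := by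
  have hm0 : (0:ℝ) < (m:ℝ) + 1 := by positivity
  refine ⟨(((m:ℝ)+1)/ε)^m, by positivity, fun x hx => ?_⟩
  have h1 := Real.log_le_rpow_div (x := x) (ε := ε/((m:ℝ)+1)) (by linarith) (by positivity)
  have h2 : (Real.log x)^m ≤ (x^(ε/((m:ℝ)+1)) / (ε/((m:ℝ)+1)))^m :=
    pow_le_pow_left₀ (Real.log_nonneg hx) h1 m
  refine h2.trans ?_
  rw [div_eq_mul_inv, inv_div, mul_pow, mul_comm]
  gcongr
  rw [← Real.rpow_natCast (x^_), ← Real.rpow_mul (by linarith)]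
  apply Real.rpow_le_rpow_of_exponent_le hx
  rw [div_mul_eq_mul_div, div_le_iff₀ hm0]
  nlinarith

lemma abs_lam_le (n : ℕ) : |lam n| ≤ 1 := by
  unfold lam
  by_cases h : n = 0
  · simp [h]
  · rw [ArithmeticFunction.liouville_apply h]; simp

lemma abel_ineq (f w : ℕ → ℝ) (hw : Antitone w) (hw0 : ∀ i, 0 ≤ w i) (M : ℝ) (n : ℕ)
    (h : ∀ j ≤ n, |∑ i ∈ range j, f i| ≤ M) : |∑ i ∈ range n, f i * w i| ≤ M * w 0 := by
  have key : ∀ j ≤ n, |∑ i ∈ range j, f i * w i - (∑ i ∈ range j, f i) * w j| ≤ M * (w 0 - w j) := by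
    intro j
    induction j with
    | zero => simp
    | succ j ih =>
      intro hj
      have h1 := ih (by omega)
      have h2 := h (j+1) hj
      have e : ∑ i ∈ range (j+1), f i * w i - (∑ i ∈ range (j+1), f i) * w (j+1) =
        (∑ i ∈ range j, f i * w i - (∑ i ∈ range j, f i) * w j) + (∑ i ∈ range (j+1), f i) * (w j - w (j+1)) := by
        rw [sum_range_succ, sum_range_succ]; ring
      rw [e]
      have h3 : 0 ≤ w j - w (j+1) := sub_nonneg.2 (hw (Nat.le_succ j))
      refine (abs_add_le _ _).trans ?_
      rw [abs_mul, abs_of_nonneg h3]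
      nlinarith
  have h1 := key n le_rfl
  have h2 := h n le_rfl
  have h3 := abs_sub_abs_le_abs_sub (∑ i ∈ range n, f i * w i) ((∑ i ∈ range n, f i) * w n)
  rw [abs_mul, abs_of_nonneg (hw0 n)] at h3
  nlinarith [hw0 n]

noncomputable def Ak (k : ℕ) (x : ℝ) : ℝ := ∑ n ∈ Icc 1 ⌊x⌋₊, (Real.log n)^k * lam n

lemma log_two_mul_le {x : ℝ} (hx : 2 ≤ x) : Real.log (2*x) ≤ 2 * Real.log x := by
  rw [Real.log_mul (by norm_num) (by linarith)]
  have := Real.log_le_log (by norm_num) hx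
  linarith

lemma one_le_log {x : ℝ} (hx : 3 ≤ x) : 1 ≤ Real.log x := by
  rw [Real.le_log_iff_exp_le (by linarith)]
  linarith [Real.exp_one_lt_d9]

lemma Ak_bound (m : ℕ) : ∃ C : ℝ, 0 < C ∧ ∀ x : ℝ, 9 ≤ x → |Ak (2*m) x| ≤ C * x * (Real.log x)^m := by
  obtain ⟨C, hC0, hC⟩ := perronR (2*m)
  obtain ⟨C1, hC10, hC1⟩ := log_pow_le (2*m) 1 one_pos
  refine ⟨5*C + 2^(2*m) + 2^(2*m)*C1, by positivity, fun x hx => ?_⟩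
  have hx0 : 0 < x := by linarith
  have hl : 1 ≤ Real.log x := one_le_log (by linarith)
  set l := Real.log x with hldef
  have hlm : 1 ≤ l^m := one_le_pow₀ hl
  set h := x / l^m with hh
  have hh0 : 0 < h := by positivity
  have hhx : h ≤ x := div_le_self hx0.le hlm
  have r1 := hC x hx
  have r2 := hC (x+h) (by linarith)
  have hfl : ⌊x⌋₊ ≤ ⌊x+h⌋₊ := Nat.floor_le_floor (by linarith)
  have split : ∑ n ∈ Icc 1 ⌊x+h⌋₊, (Real.log n)^(2*m) * lam n * (x + h - n) =
      ∑ n ∈ Icc 1 ⌊x⌋₊, (Real.log n)^(2*m) * lam n * (x - n) + h * Ak (2*m) x +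
      ∑ n ∈ Ioc ⌊x⌋₊ ⌊x+h⌋₊, (Real.log n)^(2*m) * lam n * (x + h - n) := by
    have : Icc 1 ⌊x+h⌋₊ = Icc 1 ⌊x⌋₊ ∪ Ioc ⌊x⌋₊ ⌊x+h⌋₊ := by
      ext n; simp only [Finset.mem_union, Finset.mem_Icc, Finset.mem_Ioc]; omega
    rw [this, sum_union]
    · congr 1
      rw [Ak, mul_sum, ← sum_add_distrib]
      apply sum_congr rfl
      intros; ring
    · rw [disjoint_left]; intro n; simp only [Finset.mem_Icc, Finset.mem_Ioc]; omega
  have tail : |∑ n ∈ Ioc ⌊x⌋₊ ⌊x+h⌋₊, (Real.log n)^(2*m) * lam n * (x + h - n)| ≤ (h+1) * ((2*l)^(2*m) * h) := by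
    refine (abs_sum_le_sum_abs _ _).trans ?_
    calc _ ≤ ∑ n ∈ Ioc ⌊x⌋₊ ⌊x+h⌋₊, ((2*l)^(2*m) * h) := by
          apply sum_le_sum
          intro n hn
          rw [Finset.mem_Ioc] at hn
          have hn1 : x < n := (Nat.floor_lt hx0.le).1 hn.1
          have hn2 : (n:ℝ) ≤ x + h := (Nat.le_floor_iff (by linarith)).1 hn.2
          have hln : Real.log n ≤ 2*l := (Real.log_le_log (by linarith) (by linarith)).trans (log_two_mul_le (x := x) (by linarith))
          have hln0 : 0 ≤ Real.log n := Real.log_nonneg (by linarith)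
          rw [abs_mul, abs_mul, abs_of_nonneg (by positivity : 0 ≤ (Real.log n)^(2*m)), abs_of_nonneg (by linarith : 0 ≤ x + h - n)]
          calc (Real.log n)^(2*m) * |lam n| * (x+h-n) ≤ (2*l)^(2*m) * 1 * h := by
                gcongr
                · exact abs_lam_le n
                · linarith
            _ = _ := by ring
      _ = ((⌊x+h⌋₊ - ⌊x⌋₊ : ℕ):ℝ) * ((2*l)^(2*m) * h) := by simp
      _ ≤ _ := by
        gcongr
        rw [Nat.cast_sub hfl]
        have := Nat.floor_le (show 0 ≤ x+h by linarith)
        have := Nat.lt_floor_add_one x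
        linarith
  have e2 : h * Ak (2*m) x = ∑ n ∈ Icc 1 ⌊x+h⌋₊, (Real.log n)^(2*m) * lam n * (x + h - n) -
     ∑ n ∈ Icc 1 ⌊x⌋₊, (Real.log n)^(2*m) * lam n * (x - n) -
      ∑ n ∈ Ioc ⌊x⌋₊ ⌊x+h⌋₊, (Real.log n)^(2*m) * lam n * (x + h - n) := by rw [split]; ring
  have b1 : h * |Ak (2*m) x| ≤ C * (x+h)^2 + C*x^2 + (h+1) * ((2*l)^(2*m) * h) := by
    rw [← abs_of_pos hh0, ← abs_mul, abs_of_pos hh0, e2]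
    refine (abs_sub _ _).trans ?_
    have := (abs_sub (∑ n ∈ Icc 1 ⌊x+h⌋₊, (Real.log n)^(2*m) * lam n * (x + h - n)) (∑ n ∈ Icc 1 ⌊x⌋₊, (Real.log n)^(2*m) * lam n * (x - n)))
    linarith
  have b2 : C * (x+h)^2 + C*x^2 ≤ 5*C*x^2 := by
    have : (x+h)^2 ≤ (2*x)^2 := by gcongr; linarith
    nlinarith
  have b3 : |Ak (2*m) x| ≤ 5*C*(x^2/h) + (h+1) * (2*l)^(2*m) := by
    have : h * (5*C*(x^2/h) + (h+1) * (2*l)^(2*m)) = 5*C*x^2 + (h+1) * ((2*l)^(2*m) * h) := by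
      field_simp
    refine le_of_mul_le_mul_left ?_ hh0
    rw [this]; linarith
  refine b3.trans ?_
  have c1 : x^2/h = x * l^m := by rw [hh]; field_simp
  have c2 : h * (2*l)^(2*m) = 2^(2*m) * (x * l^m) := by
    rw [hh, mul_pow, show 2*m = m + m by ring, pow_add l]; field_simp
  have c3 : (2*l)^(2*m) ≤ 2^(2*m)*C1 * (x * l^m) := by
    rw [mul_pow, mul_assoc]
    gcongr
    have := hC1 x (by linarith)
    rw [Real.rpow_one] at this
    refine this.trans ?_
    gcongr
    nlinarith
  rw [c1, add_mul, c2]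
  linarith

lemma L_bound (m : ℕ) : ∃ C : ℝ, 1 ≤ C ∧ ∀ x : ℝ, 2 ≤ x →
    |∑ n ∈ Icc 1 ⌊x⌋₊, lam n| ≤ C * x / (Real.log x)^m := by
  obtain ⟨C, hC0, hC⟩ := Ak_bound m
  obtain ⟨C1, hC10, hC1⟩ := log_pow_le m (1/2) (by norm_num)
  refine ⟨max 1 (5^m + C1 + 2*C*4^m), le_max_left _ _, fun x hx => ?_⟩
  suffices h : |∑ n ∈ Icc 1 ⌊x⌋₊, lam n| ≤ (5^m + C1 + 2*C*4^m) * x / (Real.log x)^m by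
    refine h.trans ?_
    have : 0 ≤ Real.log x := Real.log_nonneg (by linarith)
    gcongr
    exact le_max_right _ _
  have hx0 : 0 < x := by linarith
  have hlpos : 0 < Real.log x := Real.log_pos (by linarith)
  have triv : ∀ y : ℝ, 0 ≤ y → |∑ n ∈ Icc 1 ⌊y⌋₊, lam n| ≤ y := by
    intro y hy
    refine (abs_sum_le_sum_abs _ _).trans ((sum_le_sum (fun n _ => abs_lam_le n)).trans ?_)
    simp
    exact Nat.floor_le hy
  by_cases hs : x < 100
  · refine (triv x hx0.le).trans ?_
    rw [le_div_iff₀ (by positivity)]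
    have : Real.log x ≤ 5 := by
      have h1 : Real.log x ≤ Real.log 128 := Real.log_le_log hx0 (by linarith)
      have h2 : Real.log 128 = 7 * Real.log 2 := by
        rw [show (128:ℝ) = 2^7 by norm_num, Real.log_pow]; norm_num
      have := Real.log_two_lt_d9
      linarith
    have : Real.log x^m ≤ 5^m := by gcongr
    have : 0 ≤ 2*C*4^m := by positivity
    nlinarith
  push Not at hs
  set l := Real.log x with hl
  set N := ⌊Real.sqrt x⌋₊ with hN
  set K := ⌊x⌋₊ with hK
  have hsq : Real.sqrt x ^ 2 = x := Real.sq_sqrt hx0.le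
  have hsq10 : 10 ≤ Real.sqrt x := Real.le_sqrt_of_sq_le (by norm_num; linarith)
  have hN10 : 10 ≤ N := Nat.le_floor (by exact_mod_cast hsq10)
  have hNle : (N:ℝ) ≤ Real.sqrt x := Nat.floor_le (by positivity)
  have hNlt : Real.sqrt x < N + 1 := Nat.lt_floor_add_one _
  have hsx : Real.sqrt x ≤ x := by nlinarith
  have hNK : N ≤ K := Nat.floor_le_floor hsx
  have hKx : (K:ℝ) ≤ x := Nat.floor_le hx0.le
  have split : ∑ n ∈ Icc 1 K, lam n = ∑ n ∈ Icc 1 N, lam n + ∑ i ∈ range (K - N), lam (N+1+i) := by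
    have h1 : Icc 1 K = Icc 1 N ∪ Ioc N K := by
      ext n; simp only [Finset.mem_union, Finset.mem_Icc, Finset.mem_Ioc]; omega
    have h2 : ∑ n ∈ Ioc N K, lam n = ∑ i ∈ range (K - N), lam (N+1+i) := by
      have : Ioc N K = Ico (N+1) (K+1) := by ext n; simp only [Finset.mem_Ioc, Finset.mem_Ico]; omega
      rw [this, Finset.sum_Ico_eq_sum_range]
      congr 2
      omega
    rw [h1, sum_union, h2]
    rw [disjoint_left]; intro n; simp only [Finset.mem_Icc, Finset.mem_Ioc]; omega
  have hlogpos : ∀ i : ℕ, l/2 ≤ Real.log ((N+1+i : ℕ):ℝ) := by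
    intro i
    have : l/2 = Real.log (Real.sqrt x) := by rw [Real.log_sqrt hx0.le]
    rw [this]
    apply Real.log_le_log (by linarith)
    push_cast
    have : (0:ℝ) ≤ i := by positivity
    linarith
  have hab := abel_ineq (fun i => (Real.log ((N+1+i : ℕ):ℝ))^(2*m) * lam (N+1+i)) (fun i => ((Real.log ((N+1+i : ℕ):ℝ))^(2*m))⁻¹)
    (by
      intro i j hij
      have := hlogpos i
      have hp : 0 < Real.log ((N+1+i : ℕ):ℝ) := by linarith
      have hle : Real.log ((N+1+i : ℕ):ℝ) ≤ Real.log ((N+1+j : ℕ):ℝ) := by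
        apply Real.log_le_log (by positivity)
        exact_mod_cast (by omega)
      simp only
      gcongr) (fun i => by
      have := hlogpos i
      have hp : 0 < Real.log ((N+1+i : ℕ):ℝ) := by linarith
      positivity) (2*(C*x*l^m)) (K-N) (by
      intro j hj
      have e : ∑ i ∈ range j, (Real.log ((N+1+i : ℕ):ℝ))^(2*m) * lam (N+1+i) = Ak (2*m) ((N+j:ℕ):ℝ) - Ak (2*m) (N:ℝ) := by
        rw [Ak, Ak, Nat.floor_natCast, Nat.floor_natCast]
        rw [eq_sub_iff_add_eq, add_comm]
        have h1 : Icc 1 (N+j) = Icc 1 N ∪ Ico (N+1) (N+1+j) := by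
          ext n; simp only [Finset.mem_union, Finset.mem_Icc, Finset.mem_Ico]; omega
        rw [h1, sum_union, Finset.sum_Ico_eq_sum_range]
        · congr 2; congr 1; omega
        · rw [disjoint_left]; intro n; simp only [Finset.mem_Icc, Finset.mem_Ico]; omega
      rw [e]
      have hAy : ∀ y : ℕ, N ≤ y → y ≤ K → |Ak (2*m) (y:ℝ)| ≤ C * x * l^m := by
        intro y h1 h2
        have hy9 : (9:ℝ) ≤ y := by exact_mod_cast (by omega : 9 ≤ y)
        have hyx : (y:ℝ) ≤ x := le_trans (by exact_mod_cast h2) hKx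
        refine (hC y hy9).trans ?_
        have : 0 ≤ Real.log y := Real.log_nonneg (by linarith)
        have hll : Real.log y ≤ l := Real.log_le_log (by linarith) hyx
        gcongr
      have h1 := hAy (N+j) (by omega) (by omega)
      have h2 := hAy N le_rfl hNK
      refine (abs_sub _ _).trans ?_
      linarith)
  have e : ∑ i ∈ range (K-N), (Real.log ((N+1+i : ℕ):ℝ))^(2*m) * lam (N+1+i) * ((Real.log ((N+1+i : ℕ):ℝ))^(2*m))⁻¹ = ∑ i ∈ range (K - N), lam (N+1+i) := by
    apply sum_congr rfl
    intro i _
    have := hlogpos i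
    have hp : 0 < Real.log ((N+1+i : ℕ):ℝ) := by linarith
    field_simp
  rw [e] at hab
  have hw0 : ((Real.log ((N+1+0 : ℕ):ℝ))^(2*m))⁻¹ ≤ ((l/2)^(2*m))⁻¹ := by
    have := hlogpos 0
    gcongr
  have b1 : |∑ i ∈ range (K - N), lam (N+1+i)| ≤ 2*C*4^m * x / l^m := by
    refine hab.trans ?_
    calc _ ≤ 2*(C*x*l^m) * ((l/2)^(2*m))⁻¹ := by gcongr
      _ = 2*C*4^m * x / l^m := by
        rw [div_pow, pow_mul 2, show 2*m = m + m by ring, pow_add l]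
        norm_num
        field_simp
  have b2 : |∑ n ∈ Icc 1 N, lam n| ≤ C1 * x / l^m := by
    refine (triv _ (by positivity)).trans ?_
    rw [le_div_iff₀ (by positivity)]
    have := hC1 x (by linarith)
    rw [← Real.sqrt_eq_rpow] at this
    calc Real.sqrt x * l^m ≤ Real.sqrt x * (C1 * Real.sqrt x) := by gcongr
      _ = C1 * Real.sqrt x ^2 := by ring
      _ = C1 * x := by rw [hsq]
  rw [split]
  refine (abs_add_le _ _).trans ?_
  have : 0 ≤ 5^m * x / l^m := by positivity
  have e3 : (5^m + C1 + 2*C*4^m) * x / l^m = 5^m * x / l^m + C1 * x / l^m + 2*C*4^m*x/l^m := by ring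
  rw [e3]
  linarith

end BS

namespace BS

open ArithmeticFunction in
noncomputable def lpow (k : ℕ) : ArithmeticFunction ℝ := ⟨fun n => if n = 0 then 0 else (Real.log n)^k, by simp⟩

lemma lpow_apply {k n : ℕ} (h : n ≠ 0) : lpow k n = (Real.log n)^k := by
  simp [lpow, h]

noncomputable def muR : ArithmeticFunction ℝ := ((ArithmeticFunction.moebius : ArithmeticFunction ℤ) : ArithmeticFunction ℝ)

lemma Lam_eq (k n : ℕ) : Lambdak k n = (muR * lpow k) n := by
  rw [ArithmeticFunction.mul_apply, Lambdak, Nat.sum_divisorsAntidiagonal (fun a b => muR a * lpow k b)]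
  apply sum_congr rfl
  intro d hd
  have hdn := Nat.dvd_of_mem_divisors hd
  have hn : n ≠ 0 := (Nat.mem_divisors.1 hd).2
  have hd0 : d ≠ 0 := by rintro rfl; simp at hdn; exact hn hdn
  have : n / d ≠ 0 := (Nat.div_pos (Nat.le_of_dvd (Nat.pos_of_ne_zero hn) hdn) (Nat.pos_of_ne_zero hd0)).ne'
  rw [lpow_apply this, Nat.cast_div hdn (by exact_mod_cast hd0)]
  simp [muR]

noncomputable def DL (f : ArithmeticFunction ℝ) : ArithmeticFunction ℝ := ⟨fun n => Real.log n * f n, by simp⟩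

lemma DL_apply (f : ArithmeticFunction ℝ) (n : ℕ) : DL f n = Real.log n * f n := rfl

lemma DL_mul (f g : ArithmeticFunction ℝ) : DL (f * g) = DL f * g + f * DL g := by
  ext n
  rw [DL_apply, ArithmeticFunction.add_apply, ArithmeticFunction.mul_apply, ArithmeticFunction.mul_apply,
    ArithmeticFunction.mul_apply, mul_sum, ← sum_add_distrib]
  apply sum_congr rfl
  rintro ⟨a, b⟩ h
  have h1 := Nat.mem_divisorsAntidiagonal.1 h
  have ha : (a:ℝ) ≠ 0 := by
    have : a ≠ 0 := by rintro rfl; simp at h1; exact h1.2 h1.1.symm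
    exact_mod_cast this
  have hb : (b:ℝ) ≠ 0 := by
    have : b ≠ 0 := by rintro rfl; simp at h1; exact h1.2 h1.1.symm
    exact_mod_cast this
  have : Real.log n = Real.log a + Real.log b := by
    rw [← h1.1]; push_cast; exact Real.log_mul ha hb
  simp only [DL_apply, this]; ring

lemma DL_mu : DL muR = - (ArithmeticFunction.vonMangoldt * muR) := by
  have h1 : muR * ((ArithmeticFunction.zeta : ArithmeticFunction ℕ) : ArithmeticFunction ℝ) = 1 :=
    ArithmeticFunction.coe_moebius_mul_coe_zeta
  have h2 : DL (1 : ArithmeticFunction ℝ) = 0 := by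
    ext n
    rw [DL_apply]
    by_cases h : n = 1
    · simp [h]
    · simp [ArithmeticFunction.one_apply_ne h]
  have h3 : DL ((ArithmeticFunction.zeta : ArithmeticFunction ℕ) : ArithmeticFunction ℝ) = ArithmeticFunction.log := by
    ext n
    rw [DL_apply]
    by_cases h : n = 0
    · simp [h]
    · simp [ArithmeticFunction.log_apply, h]
  have h4 := DL_mul muR ((ArithmeticFunction.zeta : ArithmeticFunction ℕ) : ArithmeticFunction ℝ)
  rw [h1, h2, h3, ← ArithmeticFunction.vonMangoldt_mul_zeta] at h4
  have h5 : (0:ArithmeticFunction ℝ) = (DL muR * ((ArithmeticFunction.zeta : ArithmeticFunction ℕ) : ArithmeticFunction ℝ) + muR * (ArithmeticFunction.vonMangoldt * ((ArithmeticFunction.zeta : ArithmeticFunction ℕ) : ArithmeticFunction ℝ))) * muR := by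
    rw [← h4, zero_mul]
  have h6 : (DL muR * ((ArithmeticFunction.zeta : ArithmeticFunction ℕ) : ArithmeticFunction ℝ) + muR * (ArithmeticFunction.vonMangoldt * ((ArithmeticFunction.zeta : ArithmeticFunction ℕ) : ArithmeticFunction ℝ))) * muR
     = (DL muR + ArithmeticFunction.vonMangoldt * muR) * (muR * ((ArithmeticFunction.zeta : ArithmeticFunction ℕ) : ArithmeticFunction ℝ)) := by ring
  rw [h6, h1, mul_one] at h5
  exact eq_neg_of_add_eq_zero_left h5.symm

lemma Lam_succ (k n : ℕ) : Lambdak (k+1) n = Real.log n * Lambdak k n +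
    ∑ x ∈ n.divisorsAntidiagonal, ArithmeticFunction.vonMangoldt x.1 * Lambdak k x.2 := by
  have h1 : DL (lpow k) = lpow (k+1) := by
    ext n
    rw [DL_apply]
    by_cases h : n = 0
    · simp [h]
    · rw [lpow_apply h, lpow_apply h]; ring
  have h2 : muR * lpow (k+1) = DL (muR * lpow k) + ArithmeticFunction.vonMangoldt * (muR * lpow k) := by
    rw [DL_mul, DL_mu, h1]; ring
  simp_rw [Lam_eq]
  rw [h2, ArithmeticFunction.add_apply, DL_apply, ArithmeticFunction.mul_apply (f := ArithmeticFunction.vonMangoldt)]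

lemma Lam_zero (n : ℕ) : Lambdak 0 n = if n = 1 then 1 else 0 := by
  have : lpow 0 = ((ArithmeticFunction.zeta : ArithmeticFunction ℕ) : ArithmeticFunction ℝ) := by
    ext n
    by_cases h : n = 0
    · simp [h]
    · rw [lpow_apply h]; simp [h]
  rw [Lam_eq, this, muR, ArithmeticFunction.coe_moebius_mul_coe_zeta, ArithmeticFunction.one_apply]

lemma Lam_nonneg (k n : ℕ) : 0 ≤ Lambdak k n := by
  induction k generalizing n with
  | zero => rw [Lam_zero]; split_ifs <;> norm_num
  | succ k ih =>
    rw [Lam_succ]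
    apply add_nonneg
    · exact mul_nonneg (Real.log_natCast_nonneg n) (ih n)
    · exact sum_nonneg (fun x _ => mul_nonneg ArithmeticFunction.vonMangoldt_nonneg (ih _))

lemma Lam_vanish (k n : ℕ) (h : k < n.primeFactors.card) : Lambdak k n = 0 := by
  induction k generalizing n with
  | zero =>
    rw [Lam_zero, if_neg]
    rintro rfl; simp at h
  | succ k ih =>
    rw [Lam_succ, ih n (by omega), mul_zero, zero_add]
    apply sum_eq_zero
    rintro ⟨a, b⟩ hab
    have h1 := Nat.mem_divisorsAntidiagonal.1 hab
    by_cases ha : IsPrimePow a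
    · simp only
      rw [ih b, mul_zero]
      obtain ⟨p, j, hp, hj, rfl⟩ := ha
      have hp := hp.nat_prime
      have hb : b ≠ 0 := by rintro rfl; simp at h1; exact h1.2 h1.1.symm
      have : n.primeFactors = {p} ∪ b.primeFactors := by
        rw [← h1.1, Nat.primeFactors_mul (pow_ne_zero _ hp.ne_zero) hb, Nat.primeFactors_prime_pow hj.ne' hp]
      rw [this] at h
      have := card_union_le {p} b.primeFactors
      rw [card_singleton] at this
      omega
    · simp [ArithmeticFunction.vonMangoldt_apply, ha]

lemma Lam_le (k n : ℕ) (hn : n ≠ 0) : Lambdak k n ≤ (Real.log n)^k := by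
  have h1 : (muR * lpow k) * ((ArithmeticFunction.zeta : ArithmeticFunction ℕ) : ArithmeticFunction ℝ) = lpow k := by
    have : muR * ((ArithmeticFunction.zeta : ArithmeticFunction ℕ) : ArithmeticFunction ℝ) = 1 :=
      ArithmeticFunction.coe_moebius_mul_coe_zeta
    calc _ = (muR * ((ArithmeticFunction.zeta : ArithmeticFunction ℕ) : ArithmeticFunction ℝ)) * lpow k := by ring
      _ = _ := by rw [this, one_mul]
  have h2 := congrArg (fun f => f n) h1
  rw [ArithmeticFunction.coe_mul_zeta_apply, lpow_apply hn] at h2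
  rw [← h2]
  simp_rw [← Lam_eq]
  exact single_le_sum (f := fun i => Lambdak k i) (fun i _ => Lam_nonneg k i) (Nat.mem_divisors_self n hn)

lemma Lam_lower (Y : ℝ) (hY : 1 ≤ Y) (k n : ℕ) (hn : Squarefree n) (hc : n.primeFactors.card = k)
    (hp : ∀ p ∈ n.primeFactors, Y ≤ p) : (Real.log Y)^k ≤ Lambdak k n := by
  induction k generalizing n with
  | zero =>
    rw [Finset.card_eq_zero, Nat.primeFactors_eq_empty] at hc
    rcases hc with rfl | rfl
    · exact absurd hn not_squarefree_zero
    · simp [Lam_zero]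
  | succ k ih =>
    have hne : n.primeFactors.Nonempty := by rw [← card_pos]; omega
    obtain ⟨p, hpn⟩ := hne
    have hpp := Nat.prime_of_mem_primeFactors hpn
    obtain ⟨m, rfl⟩ := Nat.dvd_of_mem_primeFactors hpn
    have hcop := Nat.coprime_of_squarefree_mul hn
    have hm0 : m ≠ 0 := by rintro rfl; simp at hn
    have hpf : (p*m).primeFactors = {p} ∪ m.primeFactors := by
      rw [Nat.primeFactors_mul hpp.ne_zero hm0, hpp.primeFactors]
    have hdis : Disjoint {p} m.primeFactors := by
      rw [← hpp.primeFactors]; exact hcop.disjoint_primeFactors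
    have hcm : m.primeFactors.card = k := by
      rw [hpf, card_union_of_disjoint hdis, card_singleton] at hc; omega
    have hih := ih m hn.of_mul_right hcm (fun q hq => hp q (by rw [hpf]; exact mem_union_right _ hq))
    have hYp : Real.log Y ≤ Real.log p := Real.log_le_log (by linarith) (hp p hpn)
    have hmem : (p, m) ∈ (p*m).divisorsAntidiagonal := Nat.mem_divisorsAntidiagonal.2 ⟨rfl, mul_ne_zero hpp.ne_zero hm0⟩
    have h1 := single_le_sum (f := fun x : ℕ × ℕ => ArithmeticFunction.vonMangoldt x.1 * Lambdak k x.2)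
      (fun x _ => mul_nonneg ArithmeticFunction.vonMangoldt_nonneg (Lam_nonneg k _)) hmem
    simp only [ArithmeticFunction.vonMangoldt_apply_prime hpp] at h1
    rw [Lam_succ]
    have h2 := mul_nonneg (Real.log_natCast_nonneg (p*m)) (Lam_nonneg k (p*m))
    have h3 : (Real.log Y)^(k+1) ≤ Real.log p * Lambdak k m := by
      rw [pow_succ']
      have := Real.log_nonneg hY
      gcongr
    linarith

end BS

namespace BS

lemma primes_block : ∃ Y0 : ℝ, 3 ≤ Y0 ∧ ∀ y : ℝ, Y0 ≤ y →
    y ≤ ∑ p ∈ (Ioc ⌊y⌋₊ ⌊4*y⌋₊).filter Nat.Prime, Real.log p := by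
  obtain ⟨C, hC0, hC⟩ := log_pow_le 1 (1/4) (by norm_num)
  have hlim : Tendsto (fun y : ℝ => y^(1/4:ℝ)) atTop atTop := tendsto_rpow_atTop (by norm_num)
  obtain ⟨Y1, hY1⟩ := eventually_atTop.1 (hlim.eventually_ge_atTop (100*(C+1)))
  refine ⟨max 3 Y1, le_max_left _ _, fun y hy => ?_⟩
  have hy3 : 3 ≤ y := (le_max_left _ _).trans hy
  have hq := hY1 y ((le_max_right _ _).trans hy)
  have h1 := Chebyshev.theta_ge' (x := 4*y) (by linarith)
  have h2 := Chebyshev.theta_le_log4_mul_x (x := y) (by linarith)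
  have h4 : Real.log 4 = 2 * Real.log 2 := by
    rw [show (4:ℝ) = 2^2 by norm_num, Real.log_pow]; norm_num
  have hfl : ⌊y⌋₊ ≤ ⌊4*y⌋₊ := Nat.floor_le_floor (by linarith)
  have split : Chebyshev.theta (4*y) = Chebyshev.theta y + ∑ p ∈ (Ioc ⌊y⌋₊ ⌊4*y⌋₊).filter Nat.Prime, Real.log p := by
    rw [Chebyshev.theta, Chebyshev.theta, ← sum_union]
    · congr 1
      rw [← filter_union]
      congr 1
      ext n; simp only [Finset.mem_union, Finset.mem_Ioc]; omega
    · apply disjoint_filter_filter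
      rw [disjoint_left]; intro n; simp only [Finset.mem_Ioc]; omega
  -- estimates
  set u := y^(1/4:ℝ) with hu
  have hu0 : 0 < u := by positivity
  have hu2 : u^2 = Real.sqrt y := by
    rw [Real.sqrt_eq_rpow, hu, ← Real.rpow_natCast, ← Real.rpow_mul (by linarith)]; norm_num
  have hu4 : u^4 = y := by
    rw [hu, ← Real.rpow_natCast, ← Real.rpow_mul (by linarith)]; norm_num
  have hs4 : Real.sqrt (4*y) = 2 * u^2 := by
    rw [Real.sqrt_mul (by norm_num), hu2, show (4:ℝ) = 2^2 by norm_num, Real.sqrt_sq (by norm_num)]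
  have hly : Real.log y ≤ C * u := by
    have := hC y (by linarith)
    rw [pow_one] at this
    exact this
  have hl4 : Real.log (4*y) ≤ 2 + C * u := by
    rw [Real.log_mul (by norm_num) (by linarith), h4]
    linarith [Real.log_two_lt_d9]
  have hl42 : Real.log (4*y+2) ≤ 4 + C*u := by
    have : Real.log (4*y+2) ≤ Real.log (8*y) := Real.log_le_log (by linarith) (by linarith)
    have h8 : Real.log (8*y) = 3 * Real.log 2 + Real.log y := by
      rw [Real.log_mul (by norm_num) (by linarith), show (8:ℝ) = 2^3 by norm_num, Real.log_pow]; norm_num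
    linarith [Real.log_two_lt_d9]
  have hl0 : 0 ≤ Real.log (4*y) := Real.log_nonneg (by linarith)
  rw [hs4] at h1
  have e1 : 2*(2*u^2)*Real.log (4*y) ≤ 4*u^2*(2+C*u) := by nlinarith [sq_nonneg u]
  have hd := Real.log_two_gt_d9
  have hd2 := Real.log_two_lt_d9
  have e2 : (4*y-1)*Real.log 2 - Real.log 4 * y ≥ 1.38*y - 1 := by
    rw [h4]; nlinarith
  have e3 : 4 + C*u + 4*u^2*(2+C*u) + 1 ≤ 0.38*y := by
    rw [← hu4]
    have hu100 : 100 ≤ u := by linarith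
    have a1 : 100*(C+1)*u^3 ≤ u^4 := by
      calc 100*(C+1)*u^3 ≤ u * u^3 := by gcongr
        _ = u^4 := by ring
    have a2 : u ≤ u^3 := le_self_pow₀ (by linarith) (by norm_num)
    have a3 : 100*u^2 ≤ u^3 := by
      calc 100*u^2 ≤ u*u^2 := by gcongr
        _ = u^3 := by ring
    have a4 : C*u ≤ C*u^3 := by gcongr
    nlinarith
  linarith

lemma primes_block_inv : ∃ Y0 : ℝ, 3 ≤ Y0 ∧ ∀ y : ℝ, Y0 ≤ y →
    1/(4*Real.log (4*y)) ≤ ∑ p ∈ (Ioc ⌊y⌋₊ ⌊4*y⌋₊).filter Nat.Prime, (1/(p:ℝ)) := by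
  obtain ⟨Y0, h3, h⟩ := primes_block
  refine ⟨Y0, h3, fun y hy => ?_⟩
  have h1 := h y hy
  have hl : 0 < Real.log (4*y) := Real.log_pos (by linarith)
  have h2 : ∑ p ∈ (Ioc ⌊y⌋₊ ⌊4*y⌋₊).filter Nat.Prime, Real.log p ≤
      ∑ p ∈ (Ioc ⌊y⌋₊ ⌊4*y⌋₊).filter Nat.Prime, (4*y*Real.log (4*y)) * (1/(p:ℝ)) := by
    apply sum_le_sum
    intro p hp
    rw [mem_filter, Finset.mem_Ioc] at hp
    have hp1 : (p:ℝ) ≤ 4*y := (Nat.le_floor_iff (by linarith)).1 hp.1.2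
    have hp0 : (0:ℝ) < p := by exact_mod_cast hp.2.pos
    rw [mul_one_div, le_div_iff₀ hp0]
    have : Real.log p ≤ Real.log (4*y) := Real.log_le_log hp0 hp1
    have : 0 ≤ Real.log p := Real.log_natCast_nonneg p
    nlinarith
  rw [← mul_sum] at h2
  rw [div_le_iff₀ (by positivity)]
  have : y * 1 ≤ y * ((∑ p ∈ (Ioc ⌊y⌋₊ ⌊4*y⌋₊).filter Nat.Prime, (1/(p:ℝ))) * (4*Real.log (4*y))) := by nlinarith
  exact le_of_mul_le_mul_left this (by linarith)

lemma primes_long : ∃ Y0 : ℝ, 3 ≤ Y0 ∧ ∀ y : ℝ, Y0 ≤ y →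
    1/24 ≤ ∑ p ∈ (Ioc ⌊y⌋₊ ⌊y^2⌋₊).filter Nat.Prime, (1/(p:ℝ)) := by
  obtain ⟨Y0, h3, h⟩ := primes_block_inv
  refine ⟨max Y0 100, h3.trans (le_max_left _ _), fun y hy => ?_⟩
  have hy0 : Y0 ≤ y := (le_max_left _ _).trans hy
  have hy100 : 100 ≤ y := (le_max_right _ _).trans hy
  have hlpos : 0 < Real.log y := Real.log_pos (by linarith)
  have ind : ∀ i : ℕ, (4:ℝ)^i ≤ y → i * (1/(8*Real.log y)) ≤ ∑ p ∈ (Ioc ⌊y⌋₊ ⌊4^i*y⌋₊).filter Nat.Prime, (1/(p:ℝ)) := by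
    intro i
    induction i with
    | zero => intro _; simp
    | succ i ih =>
      intro hi
      rw [pow_succ] at hi
      have h4 : (0:ℝ) < 4^i := by positivity
      have h41 : (1:ℝ) ≤ 4^i := one_le_pow₀ (by norm_num)
      have hi' := ih (by linarith)
      have hb := h (4^i*y) (by nlinarith)
      have hfl1 : ⌊y⌋₊ ≤ ⌊4^i*y⌋₊ := Nat.floor_le_floor (by nlinarith)
      have hfl2 : ⌊4^i*y⌋₊ ≤ ⌊4*(4^i*y)⌋₊ := Nat.floor_le_floor (by nlinarith)
      have e : (4:ℝ)^(i+1)*y = 4*(4^i*y) := by ring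
      rw [e]
      have hs : (Ioc ⌊y⌋₊ ⌊4*(4^i*y)⌋₊).filter Nat.Prime = (Ioc ⌊y⌋₊ ⌊4^i*y⌋₊).filter Nat.Prime ∪ (Ioc ⌊4^i*y⌋₊ ⌊4*(4^i*y)⌋₊).filter Nat.Prime := by
        rw [← filter_union]
        congr 1
        ext n; simp only [Finset.mem_union, Finset.mem_Ioc]; omega
      rw [hs, sum_union]
      · have hlb : Real.log (4*(4^i*y)) ≤ 2 * Real.log y := by
          have : 2 * Real.log y = Real.log (y^2) := by rw [Real.log_pow]; norm_num
          rw [this]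
          apply Real.log_le_log (by positivity)
          nlinarith
        have hlb0 : 0 < Real.log (4*(4^i*y)) := Real.log_pos (by nlinarith)
        have : 1/(8*Real.log y) ≤ 1/(4*Real.log (4*(4^i*y))) := by
          apply one_div_le_one_div_of_le (by positivity); linarith
        push_cast
        linarith
      · apply disjoint_filter_filter
        rw [disjoint_left]; intro n; simp only [Finset.mem_Ioc]; omega
  set M := ⌊Real.log y / Real.log 4⌋₊ with hM
  have hlog4 : Real.log 4 = 2 * Real.log 2 := by
    rw [show (4:ℝ) = 2^2 by norm_num, Real.log_pow]; norm_num
  have hl4 : 0 < Real.log 4 := Real.log_pos (by norm_num)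
  have hMle : (M:ℝ) * Real.log 4 ≤ Real.log y := by
    rw [← le_div_iff₀ hl4]; exact Nat.floor_le (by positivity)
  have hMlt : Real.log y < (M+1) * Real.log 4 := by
    rw [← div_lt_iff₀ hl4]; exact Nat.lt_floor_add_one _
  have h4M : (4:ℝ)^M ≤ y := by
    rw [← Real.log_le_log_iff (by positivity) (by linarith), Real.log_pow]; exact hMle
  have hi := ind M h4M
  have hly : 3 * Real.log 4 ≤ Real.log y := by
    rw [show 3 * Real.log 4 = Real.log (4^3) by rw [Real.log_pow]; norm_num]
    apply Real.log_le_log <;> linarith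
  have hM3 : Real.log y ≤ 3 * M := by
    have := Real.log_two_lt_d9
    have : Real.log 4 ≤ 1.4 := by linarith
    nlinarith
  calc (1/24:ℝ) ≤ M * (1/(8*Real.log y)) := by
        rw [mul_one_div, div_le_div_iff₀ (by norm_num) (by positivity)]; linarith
    _ ≤ _ := hi
    _ ≤ _ := by
      apply sum_le_sum_of_subset_of_nonneg
      · apply filter_subset_filter
        apply Ioc_subset_Ioc_right
        apply Nat.floor_le_floor
        nlinarith
      · intros; positivity

lemma E_lemma (j : ℕ) : ∀ β : ℝ, 0 < β → ∃ α : ℝ, 0 < α ∧ α ≤ 1/4 ∧ ∃ c : ℝ, 0 < c ∧ ∃ X0 : ℝ, 3 ≤ X0 ∧ ∀ X : ℝ, X0 ≤ X →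
    ∃ E : Finset ℕ, (∀ e ∈ E, Squarefree e ∧ e.primeFactors.card = j ∧ (∀ p ∈ e.primeFactors, X^α ≤ p) ∧ (e:ℝ) ≤ X^β) ∧
      c ≤ ∑ e ∈ E, (1/(e:ℝ)) := by
  induction j with
  | zero =>
    intro β hβ
    refine ⟨1/4, by norm_num, le_rfl, 1, one_pos, 3, le_rfl, fun X hX => ⟨{1}, ?_, by simp⟩⟩
    intro e he
    rw [mem_singleton] at he
    subst he
    refine ⟨squarefree_one, by simp, by simp, ?_⟩
    rw [Nat.cast_one]
    exact Real.one_le_rpow (by linarith) hβ.le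
  | succ j ih =>
    intro β hβ
    obtain ⟨α, hα, hα4, c, hc, X0, hX0, h⟩ := ih (β/2) (by positivity)
    obtain ⟨Y0, hY0, hY⟩ := primes_long
    set γ := min (α/4) (β/4) with hγ
    have hγ0 : 0 < γ := by positivity
    have hγα : γ ≤ α/4 := min_le_left _ _
    have hγβ : γ ≤ β/4 := min_le_right _ _
    obtain ⟨X1, hX1⟩ := eventually_atTop.1 ((tendsto_rpow_atTop hγ0).eventually_ge_atTop Y0)
    refine ⟨γ, hγ0, by linarith, c*(1/24), by positivity, max X0 X1, hX0.trans (le_max_left _ _), fun X hX => ?_⟩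
    have hXX0 : X0 ≤ X := (le_max_left _ _).trans hX
    have hX3 : 3 ≤ X := hX0.trans hXX0
    have hXpos : 0 < X := by linarith
    obtain ⟨E, hE, hEs⟩ := h X hXX0
    have hYX := hX1 X ((le_max_right _ _).trans hX)
    set Y := X^γ with hYdef
    have hP := hY Y hYX
    set P := (Ioc ⌊Y⌋₊ ⌊Y^2⌋₊).filter Nat.Prime with hPdef
    have hY2 : Y^2 = X^(2*γ) := by
      rw [hYdef, ← Real.rpow_natCast, ← Real.rpow_mul hXpos.le]; congr 1; push_cast; ring
    have hY2α : Y^2 < X^α := by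
      rw [hY2]; apply Real.rpow_lt_rpow_of_exponent_lt (by linarith); linarith
    have hPm : ∀ p ∈ P, p.Prime ∧ Y ≤ p ∧ (p:ℝ) ≤ Y^2 := by
      intro p hp
      rw [hPdef, mem_filter, Finset.mem_Ioc] at hp
      exact ⟨hp.2, ((Nat.floor_lt (by linarith)).1 hp.1.1).le, (Nat.le_floor_iff (by positivity)).1 hp.1.2⟩
    have hnd : ∀ e ∈ E, ∀ p ∈ P, ¬ p ∣ e := by
      intro e he p hp hd
      obtain ⟨e1, e2, e3, e4⟩ := hE e he
      obtain ⟨p1, p2, p3⟩ := hPm p hp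
      have := e3 p (Nat.mem_primeFactors.2 ⟨p1, hd, e1.ne_zero⟩)
      linarith
    have hinj : Set.InjOn (fun x : ℕ × ℕ => x.1 * x.2) (E ×ˢ P : Finset (ℕ × ℕ)) := by
      rintro ⟨e, p⟩ h1 ⟨e', p'⟩ h2 h12
      simp only [coe_product, Set.mem_prod, mem_coe] at h1 h2 h12
      have hp' : p' ∣ e * p := by rw [h12]; exact dvd_mul_left _ _
      have hpp' := (hPm p' h2.2).1
      have hpp := (hPm p h1.2).1
      have : p' ∣ p := (hpp'.dvd_mul.1 hp').resolve_left (hnd e h1.1 p' h2.2)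
      have hpe : p' = p := (Nat.prime_dvd_prime_iff_eq hpp' hpp).1 this
      subst hpe
      have := Nat.eq_of_mul_eq_mul_right hpp.pos h12
      rw [this]
    refine ⟨(E ×ˢ P).image (fun x => x.1 * x.2), ?_, ?_⟩
    · intro n hn
      rw [mem_image] at hn
      obtain ⟨⟨e, p⟩, hep, rfl⟩ := hn
      rw [mem_product] at hep
      obtain ⟨e1, e2, e3, e4⟩ := hE e hep.1
      obtain ⟨p1, p2, p3⟩ := hPm p hep.2
      have hcop : Nat.Coprime e p := ((Nat.Prime.coprime_iff_not_dvd p1).2 (hnd e hep.1 p hep.2)).symm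
      have hpf : (e*p).primeFactors = e.primeFactors ∪ {p} := by
        rw [hcop.primeFactors_mul, p1.primeFactors]
      refine ⟨?_, ?_, ?_, ?_⟩
      · exact (Nat.squarefree_mul hcop).2 ⟨e1, p1.prime.squarefree⟩
      · rw [hpf, card_union_of_disjoint, e2, card_singleton]
        have := hcop.disjoint_primeFactors
        rwa [p1.primeFactors] at this
      · intro q hq
        simp only at hq
        rw [hpf, mem_union, mem_singleton] at hq
        rcases hq with hq | rfl
        · have := e3 q hq
          have h5 : X^γ ≤ X^α := Real.rpow_le_rpow_of_exponent_le (by linarith) (by linarith)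
          linarith
        · exact p2
      · push_cast
        calc (e:ℝ) * p ≤ X^(β/2) * X^(2*γ) := by
              gcongr
              rw [← hY2]; exact p3
          _ = X^(β/2+2*γ) := (Real.rpow_add hXpos _ _).symm
          _ ≤ X^β := Real.rpow_le_rpow_of_exponent_le (by linarith) (by linarith)
    · rw [sum_image hinj, sum_product]
      have : ∑ e ∈ E, ∑ p ∈ P, (1/((e*p:ℕ):ℝ)) = (∑ e ∈ E, (1/(e:ℝ))) * ∑ p ∈ P, (1/(p:ℝ)) := by
        rw [sum_mul_sum]
        apply sum_congr rfl; intro e _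
        apply sum_congr rfl; intro p _
        push_cast
        rw [one_div_mul_one_div]
      rw [this]
      gcongr

lemma E_count (α X : ℝ) (hα : 0 < α) (hX : 1 < X) (E : Finset ℕ)
    (hE : ∀ e ∈ E, Squarefree e ∧ (∀ p ∈ e.primeFactors, X^α ≤ p)) (n : ℕ) (hn : n ≠ 0) (hnX : (n:ℝ) ≤ X^2) :
    (E.filter (· ∣ n)).card ≤ 2^(⌊2/α⌋₊) := by
  set Q := n.primeFactors.filter (fun p : ℕ => X^α ≤ (p:ℝ)) with hQ
  have hX0 : 0 < X := by linarith
  have hQc : Q.card ≤ ⌊2/α⌋₊ := by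
    have h1 : ∏ p ∈ Q, p ∣ n := (prod_dvd_prod_of_subset _ _ _ (filter_subset _ _)).trans (Nat.prod_primeFactors_dvd n)
    have h2 : ((∏ p ∈ Q, p : ℕ):ℝ) ≤ X^2 := le_trans (by exact_mod_cast Nat.le_of_dvd (Nat.pos_of_ne_zero hn) h1) hnX
    have h3 : (X^α)^Q.card ≤ ((∏ p ∈ Q, p : ℕ):ℝ) := by
      push_cast
      rw [← prod_const]
      apply Finset.prod_le_prod
      · intros; positivity
      · intro p hp
        exact (mem_filter.1 hp).2
    have h4 := h3.trans h2
    rw [← Real.rpow_natCast, ← Real.rpow_mul hX0.le, ← Real.rpow_natCast X 2, Real.rpow_le_rpow_left_iff hX] at h4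
    apply Nat.le_floor
    rw [le_div_iff₀ hα]
    push_cast at h4
    linarith
  calc (E.filter (· ∣ n)).card ≤ Q.powerset.card := by
        apply card_le_card_of_injOn Nat.primeFactors
        · intro e he
          rw [mem_coe, mem_filter] at he
          rw [mem_coe, mem_powerset]
          intro p hp
          rw [hQ, mem_filter]
          exact ⟨Nat.primeFactors_mono he.2 hn hp, (hE e he.1).2 p hp⟩
        · intro e he e' he' heq
          rw [mem_coe, mem_filter] at he he'
          rw [← Nat.prod_primeFactors_of_squarefree (hE e he.1).1, heq, Nat.prod_primeFactors_of_squarefree (hE e' he'.1).1]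
    _ = 2^Q.card := card_powerset _
    _ ≤ _ := Nat.pow_le_pow_right (by norm_num) hQc

end BS

namespace BS

lemma lam_mul (m n : ℕ) : lam (m*n) = lam m * lam n := by
  unfold lam
  rw [ArithmeticFunction.liouville_apply_mul]
  push_cast
  rfl

lemma sum_multiples (l N : ℕ) (hl : 1 ≤ l) (f : ℕ → ℝ) :
    ∑ n ∈ (Icc 1 N).filter (fun n => l ∣ n), f n = ∑ m ∈ Icc 1 (N/l), f (l*m) := by
  symm
  apply sum_bij (fun m _ => l*m)
  · intro m hm
    rw [mem_Icc] at hm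
    rw [mem_filter, mem_Icc]
    refine ⟨⟨Nat.mul_pos hl hm.1, ?_⟩, Dvd.intro _ rfl⟩
    calc l * m ≤ l * (N/l) := Nat.mul_le_mul_left _ hm.2
      _ ≤ N := Nat.mul_div_le N l
  · intro m _ m' _ h
    exact Nat.eq_of_mul_eq_mul_left hl h
  · intro n hn
    rw [mem_filter, mem_Icc] at hn
    obtain ⟨⟨h1, h2⟩, m, rfl⟩ := hn
    refine ⟨m, ?_, rfl⟩
    rw [mem_Icc]
    refine ⟨Nat.pos_of_mul_pos_left h1, ?_⟩
    rw [Nat.le_div_iff_mul_le hl]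
    linarith
  · intros; rfl

lemma H_le (N : ℕ) (Y : ℝ) (hY : 1 ≤ Y) (h : (N:ℝ) ≤ Y) : ∑ d ∈ Icc 1 N, 1/(d:ℝ) ≤ 1 + Real.log Y := by
  have h1 := harmonic_le_one_add_log N
  rw [harmonic_eq_sum_Icc] at h1
  push_cast at h1
  simp_rw [one_div]
  refine h1.trans ?_
  by_cases hN : N = 0
  · subst hN
    simp
    exact Real.log_nonneg hY
  · have : (0:ℝ) < N := by exact_mod_cast Nat.pos_of_ne_zero hN
    gcongr

lemma lcm_sum (N : ℕ) :
    ∑ d ∈ Icc 1 N, ∑ e ∈ Icc 1 N, 1/((Nat.lcm d e : ℕ):ℝ) ≤ (∑ d ∈ Icc 1 N, 1/(d:ℝ))^3 := by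
  set H := ∑ d ∈ Icc 1 N, 1/(d:ℝ) with hH
  have hH0 : 0 ≤ H := sum_nonneg (fun i _ => by positivity)
  have key : ∀ d ∈ Icc 1 N, ∀ e ∈ Icc 1 N, 1/((Nat.lcm d e : ℕ):ℝ) ≤
      ∑ g ∈ Icc 1 N, (g:ℝ) * ((if g ∣ d then 1/(d:ℝ) else 0) * (if g ∣ e then 1/(e:ℝ) else 0)) := by
    intro d hd e he
    rw [mem_Icc] at hd he
    have hd0 : (0:ℝ) < d := by exact_mod_cast hd.1
    have he0 : (0:ℝ) < e := by exact_mod_cast he.1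
    have hg0 : 0 < Nat.gcd d e := Nat.gcd_pos_of_pos_left _ hd.1
    have hgm : Nat.gcd d e ∈ Icc 1 N := by
      rw [mem_Icc]; exact ⟨hg0, (Nat.le_of_dvd hd.1 (Nat.gcd_dvd_left d e)).trans hd.2⟩
    refine le_trans (le_of_eq ?_) (single_le_sum (f := fun g : ℕ => (g:ℝ) * ((if g ∣ d then 1/(d:ℝ) else 0) * (if g ∣ e then 1/(e:ℝ) else 0))) (fun g _ => by positivity) hgm)
    rw [if_pos (Nat.gcd_dvd_left d e), if_pos (Nat.gcd_dvd_right d e)]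
    have h1 : ((Nat.gcd d e : ℕ):ℝ) * ((Nat.lcm d e : ℕ):ℝ) = d * e := by exact_mod_cast Nat.gcd_mul_lcm d e
    have h2 : (0:ℝ) < ((Nat.lcm d e : ℕ):ℝ) := by exact_mod_cast Nat.lcm_pos hd.1 he.1
    rw [div_mul_div_comm, one_mul, ← mul_div_assoc, mul_one, div_eq_div_iff h2.ne' (by positivity), one_mul]
    exact h1.symm
  have hin : ∀ g ∈ Icc 1 N, ∑ d ∈ Icc 1 N, (if g ∣ d then 1/(d:ℝ) else 0) ≤ 1/(g:ℝ) * H := by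
    intro g hg
    rw [mem_Icc] at hg
    rw [← sum_filter, sum_multiples g N hg.1]
    push_cast
    simp_rw [← one_div_mul_one_div]
    rw [← mul_sum]
    gcongr
    rw [hH]
    apply sum_le_sum_of_subset_of_nonneg
    · exact Icc_subset_Icc_right (Nat.div_le_self _ _)
    · intros; positivity
  calc _ ≤ ∑ d ∈ Icc 1 N, ∑ e ∈ Icc 1 N, ∑ g ∈ Icc 1 N, (g:ℝ) * ((if g ∣ d then 1/(d:ℝ) else 0) * (if g ∣ e then 1/(e:ℝ) else 0)) :=
        sum_le_sum fun d hd => sum_le_sum fun e he => key d hd e he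
    _ = ∑ g ∈ Icc 1 N, (g:ℝ) * ((∑ d ∈ Icc 1 N, (if g ∣ d then 1/(d:ℝ) else 0)) * (∑ e ∈ Icc 1 N, (if g ∣ e then 1/(e:ℝ) else 0))) := by
        have : ∀ d ∈ Icc 1 N, ∑ e ∈ Icc 1 N, ∑ g ∈ Icc 1 N, (g:ℝ) * ((if g ∣ d then 1/(d:ℝ) else 0) * (if g ∣ e then 1/(e:ℝ) else 0)) = ∑ g ∈ Icc 1 N, ∑ e ∈ Icc 1 N, (g:ℝ) * ((if g ∣ d then 1/(d:ℝ) else 0) * (if g ∣ e then 1/(e:ℝ) else 0)) := fun d _ => sum_comm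
        rw [sum_congr rfl this, sum_comm]
        apply sum_congr rfl
        intro g _
        rw [sum_mul_sum, mul_sum]
        apply sum_congr rfl
        intro d _
        rw [mul_sum]
    _ ≤ ∑ g ∈ Icc 1 N, (g:ℝ) * ((1/(g:ℝ) * H) * (1/(g:ℝ) * H)) := by
        apply sum_le_sum
        intro g hg
        have h0 : 0 ≤ ∑ d ∈ Icc 1 N, (if g ∣ d then 1/(d:ℝ) else 0) := sum_nonneg (fun i _ => by positivity)
        have := hin g hg
        gcongr
    _ = ∑ g ∈ Icc 1 N, 1/(g:ℝ) * H^2 := by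
        apply sum_congr rfl
        intro g hg
        rw [mem_Icc] at hg
        have : (0:ℝ) < g := by exact_mod_cast hg.1
        field_simp
    _ = H^3 := by rw [← sum_mul, ← hH]; ring

noncomputable def Kc (E : Finset ℕ) (n : ℕ) : ℝ := ((E.filter (· ∣ n)).card : ℝ)

noncomputable def bf (X K0 : ℝ) (E : Finset ℕ) (n : ℕ) : ℝ :=
  if n ∈ Ioc ⌊X⌋₊ ⌊4*X⌋₊ then lam n * Kc E n / K0 else 0

lemma Kc_nonneg (E : Finset ℕ) (n : ℕ) : 0 ≤ Kc E n := by unfold Kc; positivity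

lemma Kc_eq (E : Finset ℕ) (n : ℕ) : Kc E n = ∑ e ∈ E, if e ∣ n then (1:ℝ) else 0 := by
  unfold Kc
  rw [← sum_filter]; simp

lemma F_eq (E : Finset ℕ) (hE : ∀ e ∈ E, e ≠ 0) (d N : ℕ) (hd : 1 ≤ d) :
    ∑ n ∈ (Icc 1 N).filter (fun n => d ∣ n), lam n * Kc E n =
      ∑ e ∈ E, lam (Nat.lcm d e) * ∑ m ∈ Icc 1 (N / Nat.lcm d e), lam m := by
  simp_rw [Kc_eq, mul_sum]
  rw [sum_comm]
  apply sum_congr rfl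
  intro e he
  have hl : 1 ≤ Nat.lcm d e := Nat.lcm_pos hd (Nat.pos_of_ne_zero (hE e he))
  simp_rw [← lam_mul]
  rw [← sum_multiples _ N hl (fun n => lam n)]
  simp_rw [mul_ite, mul_one, mul_zero]
  rw [← sum_filter, filter_filter]
  apply sum_congr _ (fun _ _ => rfl)
  ext n
  simp only [mem_filter, Nat.lcm_dvd_iff]

lemma F_bound (m : ℕ) (η : ℝ) (hη : 0 < η) : ∃ C : ℝ, 1 ≤ C ∧ ∀ X : ℝ, 3 ≤ X → 2 ≤ X^η → ∀ E : Finset ℕ,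
    (∀ e ∈ E, e ≠ 0) → ∀ d : ℕ, 1 ≤ d → (∀ e ∈ E, (d:ℝ)*e*X^η ≤ X) → ∀ y : ℝ, X ≤ y → y ≤ 4*X →
    |∑ n ∈ (Icc 1 ⌊y⌋₊).filter (fun n => d ∣ n), lam n * Kc E n| ≤
      C * X / (Real.log X)^m * ∑ e ∈ E, 1/((Nat.lcm d e : ℕ):ℝ) := by
  obtain ⟨C, hC1, hC⟩ := L_bound m
  refine ⟨max 1 (4*C/η^m), le_max_left _ _, fun X hX hX2 E hE d hd hde y hy1 hy2 => ?_⟩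
  have hlX : 1 ≤ Real.log X := one_le_log hX
  rw [F_eq E hE d _ hd, mul_sum]
  refine (abs_sum_le_sum_abs _ _).trans (sum_le_sum fun e he => ?_)
  have he1 : 1 ≤ e := Nat.pos_of_ne_zero (hE e he)
  have hl : 1 ≤ Nat.lcm d e := Nat.lcm_pos hd he1
  have hl0 : (0:ℝ) < ((Nat.lcm d e : ℕ):ℝ) := by exact_mod_cast hl
  have hle : ((Nat.lcm d e : ℕ):ℝ) ≤ d * e := by
    exact_mod_cast Nat.le_of_dvd (Nat.mul_pos hd he1) (Nat.lcm_dvd_mul d e)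
  have hz : X^η ≤ y / ((Nat.lcm d e : ℕ):ℝ) := by
    rw [le_div_iff₀ hl0]
    calc X^η * ((Nat.lcm d e : ℕ):ℝ) ≤ X^η * (d*e) := by gcongr
      _ = d*e*X^η := by ring
      _ ≤ X := hde e he
      _ ≤ y := hy1
  rw [abs_mul, ← Nat.floor_div_natCast]
  have hb := hC (y / ((Nat.lcm d e : ℕ):ℝ)) (hX2.trans hz)
  have hlog : η * Real.log X ≤ Real.log (y / ((Nat.lcm d e : ℕ):ℝ)) := by
    rw [← Real.log_rpow (by linarith)]
    exact Real.log_le_log (by linarith) hz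
  calc _ ≤ 1 * (C * (y / ((Nat.lcm d e : ℕ):ℝ)) / (Real.log (y / ((Nat.lcm d e : ℕ):ℝ)))^m) :=
        mul_le_mul (abs_lam_le _) hb (abs_nonneg _) zero_le_one
    _ ≤ 1 * (C * ((4*X) / ((Nat.lcm d e : ℕ):ℝ)) / (η * Real.log X)^m) := by
        gcongr
    _ = (4*C/η^m) * X / (Real.log X)^m * (1/((Nat.lcm d e : ℕ):ℝ)) := by
        rw [mul_pow]
        field_simp
    _ ≤ _ := by
        gcongr
        exact le_max_right _ _

end BS

namespace BS

lemma bf_sum (X K0 x : ℝ) (hX : 3 ≤ X) (hx : X ≤ x) (E : Finset ℕ) (d : ℕ) :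
    ∑ n ∈ (Icc 1 ⌊x⌋₊).filter (fun n => d ∣ n), bf X K0 E n =
     (∑ n ∈ (Icc 1 ⌊min x (4*X)⌋₊).filter (fun n => d ∣ n), lam n * Kc E n
      - ∑ n ∈ (Icc 1 ⌊X⌋₊).filter (fun n => d ∣ n), lam n * Kc E n) / K0 := by
  have hsub : (Icc 1 ⌊X⌋₊).filter (fun n => d ∣ n) ⊆ (Icc 1 ⌊min x (4*X)⌋₊).filter (fun n => d ∣ n) := by
    apply filter_subset_filter
    apply Icc_subset_Icc_right
    apply Nat.floor_le_floor
    rw [le_min_iff]; constructor <;> linarith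
  rw [← sum_sdiff hsub, add_sub_cancel_right, sum_div]
  unfold bf
  rw [← sum_filter]
  apply sum_congr _ (fun _ _ => rfl)
  ext n
  have hmin : n ≤ ⌊min x (4*X)⌋₊ ↔ n ≤ ⌊x⌋₊ ∧ n ≤ ⌊4*X⌋₊ := by
    rw [Nat.le_floor_iff (by rw [le_min_iff]; constructor <;> linarith), Nat.le_floor_iff (by linarith), Nat.le_floor_iff (by linarith), le_min_iff]
  simp only [mem_filter, Finset.mem_sdiff, mem_Icc, mem_Ioc, hmin]
  constructor
  · rintro ⟨⟨⟨h1, h2⟩, h3⟩, h4, h5⟩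
    refine ⟨⟨⟨h1, h2, h5⟩, h3⟩, ?_⟩
    rintro ⟨⟨_, h6⟩, _⟩
    omega
  · rintro ⟨⟨⟨h1, h2, h5⟩, h3⟩, h4⟩
    refine ⟨⟨⟨h1, h2⟩, h3⟩, ?_, h5⟩
    by_contra h
    exact h4 ⟨⟨h1, by omega⟩, h3⟩

lemma bf_triv (X K0 x : ℝ) (hX : 3 ≤ X) (E : Finset ℕ) (hb : ∀ n, |bf X K0 E n| ≤ 1) (d : ℕ) (hd : 1 ≤ d) :
    |∑ n ∈ (Icc 1 ⌊x⌋₊).filter (fun n => d ∣ n), bf X K0 E n| ≤ 4*X*(1/(d:ℝ)) := by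
  have hd0 : (0:ℝ) < d := by exact_mod_cast hd
  calc _ ≤ ∑ n ∈ (Icc 1 ⌊x⌋₊).filter (fun n => d ∣ n), |bf X K0 E n| := abs_sum_le_sum_abs _ _
    _ ≤ ∑ n ∈ (Icc 1 ⌊x⌋₊).filter (fun n => d ∣ n), if n ≤ ⌊4*X⌋₊ then (1:ℝ) else 0 := by
        apply sum_le_sum
        intro n _
        split_ifs with h
        · exact hb n
        · have : bf X K0 E n = 0 := by
            unfold bf
            rw [if_neg]
            rw [mem_Ioc]; tauto
          rw [this, abs_zero]
    _ ≤ ∑ n ∈ (Icc 1 ⌊4*X⌋₊).filter (fun n => d ∣ n), (1:ℝ) := by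
        rw [← sum_filter]
        apply sum_le_sum_of_subset_of_nonneg
        · intro n
          simp only [mem_filter, mem_Icc]
          tauto
        · intros; positivity
    _ = ((⌊4*X⌋₊/d : ℕ):ℝ) := by
        rw [sum_multiples d _ hd (fun _ => 1)]; simp
    _ ≤ (⌊4*X⌋₊:ℝ)/d := Nat.cast_div_le
    _ ≤ 4*X/d := by
        gcongr
        exact Nat.floor_le (by linarith)
    _ = _ := by ring

lemma level (ν : ℝ) (h0 : 0 < ν) (h1 : ν < 1) : ∃ X0 : ℝ, 3 ≤ X0 ∧ ∀ m : ℕ, ∃ C : ℝ, 1 ≤ C ∧ ∀ X : ℝ, X0 ≤ X →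
    ∀ K0 : ℝ, 1 ≤ K0 → ∀ E : Finset ℕ, (∀ e ∈ E, e ≠ 0 ∧ (e:ℝ) ≤ X^((1-ν)/4)) → (∀ n, |bf X K0 E n| ≤ 1) →
    ∀ x : ℝ, X ≤ x →
    ∑ d ∈ Icc 1 ⌊x^ν⌋₊, |∑ n ∈ (Icc 1 ⌊x⌋₊).filter (fun n => d ∣ n), bf X K0 E n| ≤ C * x / (Real.log x)^m := by
  set δ := 1 - ν with hδ
  have hδ0 : 0 < δ := by linarith
  have hlim : Tendsto (fun y : ℝ => y^(δ/4)) atTop atTop := tendsto_rpow_atTop (by linarith)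
  obtain ⟨X1, hX1⟩ := eventually_atTop.1 (hlim.eventually_ge_atTop 2)
  refine ⟨max 3 X1, le_max_left _ _, fun m => ?_⟩
  set θ := 1 - 1/(1+δ/2) with hθ
  have hθ0 : 0 < θ := by
    have : 1/(1+δ/2) < 1 := by rw [div_lt_one (by linarith)]; linarith
    linarith
  obtain ⟨C1, hC11, hC1⟩ := F_bound (m+3) (δ/4) (by linarith)
  obtain ⟨C2, hC20, hC2⟩ := log_pow_le (m+1) θ hθ0
  refine ⟨16*C1*2^m + 8*C2, ?_, fun X hX K0 hK0 E hE hb x hx => ?_⟩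
  · have : (1:ℝ) ≤ 2^m := one_le_pow₀ (by norm_num)
    nlinarith
  have hX3 : 3 ≤ X := (le_max_left _ _).trans hX
  have hXp : 0 < X := by linarith
  have hX2 : 2 ≤ X^(δ/4) := hX1 X ((le_max_right _ _).trans hX)
  have hlX : 1 ≤ Real.log X := one_le_log hX3
  have hlx : 1 ≤ Real.log x := one_le_log (hX3.trans hx)
  have hxp : 0 < x := by linarith
  have hxn : x^ν ≤ x := by
    conv_rhs => rw [← Real.rpow_one x]
    exact Real.rpow_le_rpow_of_exponent_le (by linarith) h1.le
  by_cases hc : x ≤ X^(1+δ/2)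
  · have hll : Real.log x ≤ 2 * Real.log X := by
      have := Real.log_le_log hxp hc
      rw [Real.log_rpow hXp] at this
      nlinarith
    have hxnu : x^ν ≤ X^((1+δ/2)*ν) := by
      rw [Real.rpow_mul hXp.le]
      exact Real.rpow_le_rpow hxp.le hc h0.le
    have hXX : X^((1+δ/2)*ν) * X^(δ/4) * X^(δ/4) ≤ X := by
      rw [← Real.rpow_add hXp, ← Real.rpow_add hXp]
      conv_rhs => rw [← Real.rpow_one X]
      apply Real.rpow_le_rpow_of_exponent_le (by linarith)
      have : ν = 1 - δ := by linarith
      rw [this]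
      nlinarith
    have hXX1 : X^((1+δ/2)*ν) ≤ X := by
      refine le_trans ?_ hXX
      have h3 : 0 ≤ X^((1+δ/2)*ν) := by positivity
      rw [mul_assoc]
      apply le_mul_of_one_le_right h3
      nlinarith
    have hXX2 : X^(δ/4) ≤ X := by
      conv_rhs => rw [← Real.rpow_one X]
      apply Real.rpow_le_rpow_of_exponent_le (by linarith)
      linarith
    have hdle : ∀ d ∈ Icc 1 ⌊x^ν⌋₊, 1 ≤ d ∧ (d:ℝ) ≤ X^((1+δ/2)*ν) := by
      intro d hd
      rw [mem_Icc] at hd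
      refine ⟨hd.1, le_trans ?_ hxnu⟩
      exact (Nat.le_floor_iff (by positivity)).1 hd.2
    have hEs : E ⊆ Icc 1 ⌊X⌋₊ := by
      intro e he
      rw [mem_Icc]
      exact ⟨Nat.pos_of_ne_zero (hE e he).1, Nat.le_floor ((hE e he).2.trans hXX2)⟩
    have hDs : Icc 1 ⌊x^ν⌋₊ ⊆ Icc 1 ⌊X⌋₊ := by
      intro d hd
      rw [mem_Icc]
      exact ⟨(hdle d hd).1, Nat.le_floor ((hdle d hd).2.trans hXX1)⟩
    have hd1 : ∀ d ∈ Icc 1 ⌊x^ν⌋₊, |∑ n ∈ (Icc 1 ⌊x⌋₊).filter (fun n => d ∣ n), bf X K0 E n| ≤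
        2*C1*X/(Real.log X)^(m+3) * ∑ e ∈ Icc 1 ⌊X⌋₊, 1/((Nat.lcm d e : ℕ):ℝ) := by
      intro d hd
      have hd' := hdle d hd
      have hde : ∀ e ∈ E, (d:ℝ)*e*X^(δ/4) ≤ X := by
        intro e he
        refine le_trans ?_ hXX
        have := hE e he
        gcongr
        · exact hd'.2
        · exact this.2
      have hF := hC1 X hX3 hX2 E (fun e he => (hE e he).1) d hd'.1 hde
      have hF1 := hF (min x (4*X)) (by rw [le_min_iff]; constructor <;> linarith) (min_le_right _ _)
      have hF2 := hF X le_rfl (by linarith)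
      rw [bf_sum X K0 x hX3 hx E d, abs_div, abs_of_pos (by linarith : 0 < K0)]
      refine (div_le_self (abs_nonneg _) hK0).trans ?_
      refine (abs_sub _ _).trans ((add_le_add hF1 hF2).trans ?_)
      have hs : ∑ e ∈ E, 1/((Nat.lcm d e : ℕ):ℝ) ≤ ∑ e ∈ Icc 1 ⌊X⌋₊, 1/((Nat.lcm d e : ℕ):ℝ) :=
        sum_le_sum_of_subset_of_nonneg hEs (fun _ _ _ => by positivity)
      calc _ = 2*C1*X/(Real.log X)^(m+3) * ∑ e ∈ E, 1/((Nat.lcm d e : ℕ):ℝ) := by ring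
        _ ≤ _ := by gcongr
    calc _ ≤ ∑ d ∈ Icc 1 ⌊x^ν⌋₊, 2*C1*X/(Real.log X)^(m+3) * ∑ e ∈ Icc 1 ⌊X⌋₊, 1/((Nat.lcm d e : ℕ):ℝ) := sum_le_sum hd1
      _ = 2*C1*X/(Real.log X)^(m+3) * ∑ d ∈ Icc 1 ⌊x^ν⌋₊, ∑ e ∈ Icc 1 ⌊X⌋₊, 1/((Nat.lcm d e : ℕ):ℝ) := by rw [mul_sum]
      _ ≤ 2*C1*X/(Real.log X)^(m+3) * ∑ d ∈ Icc 1 ⌊X⌋₊, ∑ e ∈ Icc 1 ⌊X⌋₊, 1/((Nat.lcm d e : ℕ):ℝ) := by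
          gcongr
      _ ≤ 2*C1*X/(Real.log X)^(m+3) * (∑ d ∈ Icc 1 ⌊X⌋₊, 1/(d:ℝ))^3 := by
          gcongr
          exact lcm_sum _
      _ ≤ 2*C1*X/(Real.log X)^(m+3) * (2*Real.log X)^3 := by
          have := H_le ⌊X⌋₊ X (by linarith) (Nat.floor_le hXp.le)
          gcongr
          linarith
      _ = 16*C1*X/(Real.log X)^m := by
          rw [pow_add]; field_simp; ring
      _ ≤ 16*C1*2^m*x/(Real.log x)^m := by
          rw [div_le_div_iff₀ (by positivity) (by positivity)]
          calc 16*C1*X*(Real.log x)^m ≤ 16*C1*x*(2*Real.log X)^m := by gcongr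
            _ = _ := by rw [mul_pow]; ring
      _ ≤ _ := by
          gcongr
          linarith
  · push Not at hc
    have hXle : X ≤ x^(1-θ) := by
      have h2 : (X^(1+δ/2))^(1-θ) ≤ x^(1-θ) := by
        apply Real.rpow_le_rpow (by positivity) hc.le
        rw [hθ]; simp; positivity
      rw [← Real.rpow_mul hXp.le] at h2
      have : (1+δ/2)*(1-θ) = 1 := by rw [hθ]; field_simp; ring
      rwa [this, Real.rpow_one] at h2
    calc _ ≤ ∑ d ∈ Icc 1 ⌊x^ν⌋₊, 4*X*(1/(d:ℝ)) := by
          apply sum_le_sum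
          intro d hd
          exact bf_triv X K0 x hX3 E hb d (mem_Icc.1 hd).1
      _ = 4*X*∑ d ∈ Icc 1 ⌊x^ν⌋₊, 1/(d:ℝ) := by rw [mul_sum]
      _ ≤ 4*X*(2*Real.log x) := by
          have := H_le ⌊x^ν⌋₊ x (by linarith) ((Nat.floor_le (by positivity)).trans hxn)
          gcongr
          linarith
      _ ≤ 8*C2*x/(Real.log x)^m := by
          rw [le_div_iff₀ (by positivity)]
          calc 4*X*(2*Real.log x)*(Real.log x)^m = 8*X*(Real.log x)^(m+1) := by ring
            _ ≤ 8*x^(1-θ)*(C2*x^θ) := by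
                have := hC2 x (by linarith)
                gcongr
            _ = 8*C2*(x^(1-θ)*x^θ) := by ring
            _ = 8*C2*x := by rw [← Real.rpow_add hxp]; simp
      _ ≤ _ := by
          gcongr
          have : 0 ≤ 16*C1*2^m := by positivity
          linarith

end BS

namespace BS

lemma omega_mul {a b : ℕ} (h : a.Coprime b) : (a*b).primeFactors.card = a.primeFactors.card + b.primeFactors.card := by
  rw [h.primeFactors_mul, card_union_of_disjoint h.disjoint_primeFactors]

lemma bad_sq (X α β : ℝ) (hX : 3 ≤ X) (hα : α ≤ 1/4) (hβ : β ≤ 1/4) (j n e : ℕ) (hn : X < n)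
    (hen : e ∣ n) (hc : e.primeFactors.card = j)
    (hp : ∀ p ∈ e.primeFactors, X^α ≤ p) (heb : (e:ℝ) ≤ X^β) (hns : ¬ Squarefree n) (hes : Squarefree e)
    (hw : n.primeFactors.card ≤ j + 1) : ∃ s : ℕ, X^α ≤ s ∧ s^2 ∣ n := by
  have hXp : 0 < X := by linarith
  by_cases h : ∃ q ∈ e.primeFactors, q^2 ∣ n
  · obtain ⟨q, hq, hqn⟩ := h
    exact ⟨q, hp q hq, hqn⟩
  push Not at h
  obtain ⟨m, rfl⟩ := hen
  have he0 : e ≠ 0 := hes.ne_zero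
  have hcop : e.Coprime m := by
    apply Nat.coprime_of_dvd
    intro q hq h1 h2
    apply h q (Nat.mem_primeFactors.2 ⟨hq, h1, he0⟩)
    rw [pow_two]
    exact mul_dvd_mul h1 h2
  have hms : ¬ Squarefree m := fun hm => hns ((Nat.squarefree_mul hcop).2 ⟨hes, hm⟩)
  have hm1 : m ≠ 1 := by rintro rfl; exact hms squarefree_one
  have hm0 : m ≠ 0 := by
    rintro rfl
    simp at hn; linarith
  rw [omega_mul hcop] at hw
  have hpos : 0 < m.primeFactors.card := by
    rw [card_pos, Nat.nonempty_primeFactors]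
    omega
  have hpp : IsPrimePow m := isPrimePow_iff_card_primeFactors_eq_one.2 (by omega)
  rw [isPrimePow_nat_iff] at hpp
  obtain ⟨r, b, hr, hb, rfl⟩ := hpp
  have hb2 : 2 ≤ b := by
    by_contra hb2
    have : b = 1 := by omega
    subst this
    rw [pow_one] at hms
    exact hms hr.prime.squarefree
  have hr1 : (1:ℝ) ≤ r := by exact_mod_cast hr.one_lt.le
  refine ⟨r^(b/2), ?_, ?_⟩
  · have h3 : (r:ℝ)^b ≤ ((r:ℝ)^(b/2))^3 := by
      rw [← pow_mul]
      exact pow_le_pow_right₀ hr1 (by omega)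
    have h4 : X^(3/4:ℝ) ≤ (r:ℝ)^b := by
      push_cast at hn
      have h5 : X^(1/4:ℝ) * X^(3/4:ℝ) = X := by
        rw [← Real.rpow_add hXp]; norm_num
      have h6 : (e:ℝ) ≤ X^(1/4:ℝ) := heb.trans (Real.rpow_le_rpow_of_exponent_le (by linarith) hβ)
      have h7 : X^(1/4:ℝ) * X^(3/4:ℝ) ≤ X^(1/4:ℝ) * (r:ℝ)^b := by
        rw [h5]
        refine hn.le.trans ?_
        gcongr
      exact le_of_mul_le_mul_left h7 (by positivity)
    have h8 : X^(1/4:ℝ) ≤ (r:ℝ)^(b/2) := by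
      apply le_of_pow_le_pow_left₀ (n := 3) (by norm_num) (by positivity)
      refine le_trans (le_of_eq ?_) (h4.trans h3)
      rw [← Real.rpow_natCast, ← Real.rpow_mul hXp.le]
      norm_num
    push_cast
    exact (Real.rpow_le_rpow_of_exponent_le (by linarith) hα).trans h8
  · apply Dvd.dvd.mul_left
    rw [← pow_mul]
    exact pow_dvd_pow _ (by omega)

lemma sqf_sign (k n e : ℕ) (hk : 1 ≤ k) (hn : Squarefree n) (hen : e ∣ n) (hne : e ≠ n)
    (hc : e.primeFactors.card = k - 1) : Lambdak k n = 0 ∨ lam n = (-1)^k := by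
  obtain ⟨m, rfl⟩ := hen
  have hcop := Nat.coprime_of_squarefree_mul hn
  have hm1 : m ≠ 1 := by rintro rfl; simp at hne
  have hm0 : m ≠ 0 := by rintro rfl; simp at hn
  have hpos : 0 < m.primeFactors.card := by
    rw [card_pos, Nat.nonempty_primeFactors]
    omega
  by_cases h : k < (e*m).primeFactors.card
  · left; exact Lam_vanish k _ h
  · right
    have hw : (e*m).primeFactors.card = k := by
      rw [omega_mul hcop] at h ⊢
      omega
    have h1 := (ArithmeticFunction.cardDistinctFactors_eq_cardFactors_iff_squarefree hn.ne_zero).2 hn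
    have h2 : ArithmeticFunction.cardDistinctFactors (e*m) = (e*m).primeFactors.card := rfl
    unfold lam
    rw [ArithmeticFunction.liouville_apply hn.ne_zero, ← h1, h2, hw]
    push_cast
    rfl

lemma bad_count (X S : ℝ) (hX : 3 ≤ X) (hS : 1 ≤ S) (Bd : Finset ℕ)
    (hB : ∀ n ∈ Bd, n ∈ Ioc ⌊X⌋₊ ⌊4*X⌋₊ ∧ ∃ s : ℕ, S ≤ s ∧ s^2 ∣ n) :
    (Bd.card : ℝ) ≤ 8*X/S := by
  set k := ⌈S⌉₊ - 1 with hk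
  have hk1 : k + 1 = ⌈S⌉₊ := by
    have : 0 < ⌈S⌉₊ := Nat.ceil_pos.2 (by linarith)
    omega
  have hkS : S ≤ (k:ℝ) + 1 := by
    have := Nat.le_ceil S
    rw [← hk1] at this
    exact_mod_cast this
  have hsub : Bd ⊆
      (Ioo k (⌊4*X⌋₊+1)).biUnion (fun s => (Ioc 0 ⌊4*X⌋₊).filter (fun n => s^2 ∣ n)) := by
    intro n hn
    obtain ⟨hn1, s, hs, hsn⟩ := hB n hn
    obtain ⟨h1, h2⟩ := mem_Ioc.1 hn1
    rw [mem_biUnion]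
    have hn0 : 0 < n := by omega
    refine ⟨s, ?_, ?_⟩
    · rw [mem_Ioo]
      have : ⌈S⌉₊ ≤ s := Nat.ceil_le.2 hs
      refine ⟨by omega, ?_⟩
      have h3 := Nat.le_of_dvd hn0 hsn
      have : s ≤ s^2 := Nat.le_self_pow (by norm_num) s
      omega
    · rw [mem_filter, mem_Ioc]
      exact ⟨⟨hn0, h2⟩, hsn⟩
  have h1 := (card_le_card hsub).trans card_biUnion_le
  calc _ ≤ ((∑ s ∈ Ioo k (⌊4*X⌋₊+1), ((Ioc 0 ⌊4*X⌋₊).filter (fun n => s^2 ∣ n)).card : ℕ):ℝ) := by exact_mod_cast h1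
    _ ≤ ∑ s ∈ Ioo k (⌊4*X⌋₊+1), 4*X*((s:ℝ)^2)⁻¹ := by
        push_cast
        apply sum_le_sum
        intro s _
        rw [Nat.Ioc_filter_dvd_card_eq_div]
        refine Nat.cast_div_le.trans ?_
        rw [div_eq_mul_inv]
        push_cast
        gcongr
        exact Nat.floor_le (by linarith)
    _ = 4*X*∑ s ∈ Ioo k (⌊4*X⌋₊+1), ((s:ℝ)^2)⁻¹ := by rw [mul_sum]
    _ ≤ 4*X*(2/((k:ℝ)+1)) := by
        gcongr
        exact sum_Ioo_inv_sq_le _ _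
    _ ≤ 4*X*(2/S) := by gcongr
    _ = _ := by ring

end BS

namespace BS

lemma W_lower (k : ℕ) (hk : 1 ≤ k) (α β X Y0 : ℝ) (hα : α ≤ 1/4) (hα0 : 0 < α) (hβ : β ≤ 1/4) (hX : 4 ≤ X)
    (hY0 : ∀ y : ℝ, Y0 ≤ y → y ≤ ∑ p ∈ (Ioc ⌊y⌋₊ ⌊4*y⌋₊).filter Nat.Prime, Real.log p) (hXY : Y0 ≤ X^(3/4:ℝ))
    (e : ℕ) (hes : Squarefree e) (hc : e.primeFactors.card = k - 1) (hp : ∀ p ∈ e.primeFactors, X^α ≤ p)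
    (heb : (e:ℝ) ≤ X^β) :
    X / (2 * Real.log X) * (α * Real.log X)^k * (1/(e:ℝ)) ≤
     ∑ n ∈ Ioc ⌊X⌋₊ ⌊4*X⌋₊, if Squarefree n ∧ e ∣ n then Lambdak k n else 0 := by
  have hXp : 0 < X := by linarith
  have he0 : 0 < e := Nat.pos_of_ne_zero hes.ne_zero
  have he0' : (0:ℝ) < e := by exact_mod_cast he0
  have he1' : (1:ℝ) ≤ e := by exact_mod_cast he0
  have hlX : 1 ≤ Real.log X := one_le_log (by linarith)
  have h6 : (e:ℝ) ≤ X^(1/4:ℝ) := heb.trans (Real.rpow_le_rpow_of_exponent_le (by linarith) hβ)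
  have hy : X^(3/4:ℝ) ≤ X / e := by
    rw [le_div_iff₀ he0']
    calc X^(3/4:ℝ) * e ≤ X^(3/4:ℝ) * X^(1/4:ℝ) := by gcongr
      _ = X := by rw [← Real.rpow_add hXp]; norm_num
  have hXpow : X^(1/4:ℝ) ≤ X^(3/4:ℝ) := Real.rpow_le_rpow_of_exponent_le (by linarith) (by norm_num)
  have hXpa : X^α ≤ X^(1/4:ℝ) := Real.rpow_le_rpow_of_exponent_le (by linarith) hα
  set Q := (Ioc ⌊X/e⌋₊ ⌊4*(X/e)⌋₊).filter Nat.Prime with hQ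
  have hQp : ∀ q ∈ Q, Nat.Prime q ∧ X < (e*q:ℕ) ∧ ((e*q:ℕ):ℝ) ≤ 4*X ∧ X/e < q := by
    intro q hq
    rw [hQ, mem_filter, mem_Ioc, Nat.floor_lt (by positivity), Nat.le_floor_iff (by positivity)] at hq
    obtain ⟨⟨h1, h2⟩, h3⟩ := hq
    refine ⟨h3, ?_, ?_, h1⟩
    · rw [div_lt_iff₀ he0'] at h1
      push_cast; linarith
    · rw [← mul_div_assoc, le_div_iff₀ he0'] at h2
      push_cast; linarith
  have hcard : X / (2 * Real.log X) * (1/(e:ℝ)) ≤ Q.card := by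
    have h1 := hY0 (X/e) (hXY.trans hy)
    have h2 : ∑ p ∈ Q, Real.log p ≤ ∑ p ∈ Q, 2*Real.log X := by
      apply sum_le_sum
      intro q hq
      obtain ⟨a1, a2, a3, a4⟩ := hQp q hq
      have : (q:ℝ) ≤ X^2 := by
        push_cast at a3
        have : (0:ℝ) < q := by exact_mod_cast a1.pos
        nlinarith
      calc Real.log q ≤ Real.log (X^2) := Real.log_le_log (by exact_mod_cast a1.pos) this
        _ = 2*Real.log X := by rw [Real.log_pow]; norm_num
    rw [sum_const, nsmul_eq_mul] at h2
    have h3 := h1.trans h2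
    rw [div_mul_div_comm, mul_one, mul_comm _ (e:ℝ), ← div_div, div_le_iff₀ (by positivity)]
    exact h3
  have himg : ∀ q ∈ Q, e*q ∈ (Ioc ⌊X⌋₊ ⌊4*X⌋₊).filter (fun n => Squarefree n ∧ e ∣ n) ∧
      (α * Real.log X)^k ≤ Lambdak k (e*q) := by
    intro q hq
    obtain ⟨a1, a2, a3, a4⟩ := hQp q hq
    have hqe : e < q := by
      have : (e:ℝ) < q := by linarith
      exact_mod_cast this
    have hcop : e.Coprime q := by
      rw [Nat.coprime_comm]
      exact (Nat.Prime.coprime_iff_not_dvd a1).2 (fun h => by have := Nat.le_of_dvd he0 h; omega)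
    have hsq : Squarefree (e*q) := (Nat.squarefree_mul hcop).2 ⟨hes, a1.prime.squarefree⟩
    constructor
    · rw [mem_filter, mem_Ioc, Nat.floor_lt hXp.le, Nat.le_floor_iff (by linarith)]
      exact ⟨⟨a2, a3⟩, hsq, Dvd.intro _ rfl⟩
    · have h := Lam_lower (X^α) (Real.one_le_rpow (by linarith) hα0.le) k (e*q) hsq ?_ ?_
      · rwa [Real.log_rpow hXp] at h
      · rw [omega_mul hcop, hc, a1.primeFactors]; simp; omega
      · intro p hpm
        rw [hcop.primeFactors_mul, mem_union, a1.primeFactors, mem_singleton] at hpm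
        rcases hpm with hpm | rfl
        · exact hp p hpm
        · linarith
  rw [← sum_filter]
  have hinj : Set.InjOn (fun q => e*q) (Q : Set ℕ) := by
    intro a _ b _ h
    exact Nat.eq_of_mul_eq_mul_left he0 h
  calc X / (2 * Real.log X) * (α * Real.log X)^k * (1/(e:ℝ)) = X / (2 * Real.log X) * (1/(e:ℝ)) * (α * Real.log X)^k := by ring
    _ ≤ Q.card * (α * Real.log X)^k := by gcongr
    _ = ∑ q ∈ Q, (α * Real.log X)^k := by rw [sum_const, nsmul_eq_mul]
    _ ≤ ∑ q ∈ Q, Lambdak k (e*q) := sum_le_sum fun q hq => (himg q hq).2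
    _ = ∑ n ∈ Q.image (fun q => e*q), Lambdak k n := (sum_image hinj).symm
    _ ≤ _ := by
        apply sum_le_sum_of_subset_of_nonneg
        · intro n hn
          rw [mem_image] at hn
          obtain ⟨q, hq, rfl⟩ := hn
          exact (himg q hq).1
        · intro n _ _
          exact Lam_nonneg k n

lemma T_lower (k : ℕ) (hk : 1 ≤ k) (β : ℝ) (hβ0 : 0 < β) (hβ : β ≤ 1/4) : ∃ c0 : ℝ, 0 < c0 ∧ ∃ X1 : ℝ, 4 ≤ X1 ∧
    ∀ X : ℝ, X1 ≤ X → ∃ (E : Finset ℕ) (K0 : ℝ), 1 ≤ K0 ∧ (∀ e ∈ E, e ≠ 0 ∧ (e:ℝ) ≤ X^β) ∧ (∀ n, |bf X K0 E n| ≤ 1) ∧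
    c0 * X * (Real.log X)^(k-1) ≤ |∑ n ∈ Ioc ⌊X⌋₊ ⌊4*X⌋₊, bf X K0 E n * Lambdak k n| := by
  obtain ⟨α, hα0, hα, c, hc0, X0, hX03, hE⟩ := E_lemma (k-1) β hβ0
  obtain ⟨Y0, hY03, hY0⟩ := primes_block
  obtain ⟨C1, hC10, hC1⟩ := log_pow_le 1 (α/2) (by linarith)
  set K0 : ℝ := ((2^⌊2/α⌋₊ : ℕ) : ℝ) with hK0
  have hK01 : 1 ≤ K0 := by
    rw [hK0]; exact_mod_cast Nat.one_le_two_pow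
  set c1 := c * α^k / 2 with hc1
  have hc10 : 0 < c1 := by positivity
  have hlim1 : Tendsto (fun y : ℝ => y^(3/4:ℝ)) atTop atTop := tendsto_rpow_atTop (by norm_num)
  have hlim2 : Tendsto (fun y : ℝ => y^(α/2)) atTop atTop := tendsto_rpow_atTop (by linarith)
  obtain ⟨X2, hX2⟩ := eventually_atTop.1 (hlim1.eventually_ge_atTop Y0)
  obtain ⟨X3, hX3⟩ := eventually_atTop.1 (hlim2.eventually_ge_atTop (K0 * 2^k * 8 * C1 * 2 / c1))
  refine ⟨c1/(2*K0), by positivity, max (max 4 X0) (max X2 X3), (le_max_left _ _).trans (le_max_left _ _), fun X hX => ?_⟩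
  have hX4 : 4 ≤ X := ((le_max_left _ _).trans (le_max_left _ _)).trans hX
  have hX0 : X0 ≤ X := ((le_max_right _ _).trans (le_max_left _ _)).trans hX
  have hX2' := hX2 X (((le_max_left _ _).trans (le_max_right _ _)).trans hX)
  have hX3' := hX3 X (((le_max_right _ _).trans (le_max_right _ _)).trans hX)
  have hXp : 0 < X := by linarith
  have hlX : 1 ≤ Real.log X := one_le_log (by linarith)
  obtain ⟨E, hE1, hE2⟩ := hE X hX0
  have hblk : ∀ n ∈ Ioc ⌊X⌋₊ ⌊4*X⌋₊, n ≠ 0 ∧ X < n ∧ (n:ℝ) ≤ X^2 := by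
    intro n hn
    rw [mem_Ioc, Nat.floor_lt hXp.le, Nat.le_floor_iff (by linarith)] at hn
    refine ⟨?_, hn.1, by nlinarith [hn.2]⟩
    rintro rfl
    have := hn.1
    simp at this; linarith
  have hKc : ∀ n ∈ Ioc ⌊X⌋₊ ⌊4*X⌋₊, Kc E n ≤ K0 := by
    intro n hn
    obtain ⟨a1, a2, a3⟩ := hblk n hn
    rw [hK0]
    unfold Kc
    exact_mod_cast E_count α X hα0 (by linarith) E (fun e he => ⟨(hE1 e he).1, (hE1 e he).2.2.1⟩) n a1 a3
  refine ⟨E, K0, hK01, fun e he => ⟨(hE1 e he).1.ne_zero, (hE1 e he).2.2.2⟩, ?_, ?_⟩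
  · intro n
    unfold bf
    split_ifs with h
    · rw [abs_div, abs_mul, abs_of_nonneg (Kc_nonneg E n), abs_of_pos (by linarith : 0 < K0), div_le_one (by linarith)]
      calc |lam n| * Kc E n ≤ 1 * Kc E n := mul_le_mul_of_nonneg_right (abs_lam_le n) (Kc_nonneg E n)
        _ ≤ K0 := by rw [one_mul]; exact hKc n h
    · simp
  have hEK : ∀ n, Kc E n ≠ 0 → ∃ e ∈ E, e ∣ n := by
    intro n h
    unfold Kc at h
    have : (E.filter (· ∣ n)).card ≠ 0 := by exact_mod_cast h
    obtain ⟨e, he⟩ := card_ne_zero.1 this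
    rw [mem_filter] at he
    exact ⟨e, he.1, he.2⟩
  have hsum : ∑ n ∈ Ioc ⌊X⌋₊ ⌊4*X⌋₊, bf X K0 E n * Lambdak k n = (∑ n ∈ Ioc ⌊X⌋₊ ⌊4*X⌋₊, lam n * Kc E n * Lambdak k n)/K0 := by
    rw [sum_div]
    apply sum_congr rfl
    intro n hn
    unfold bf
    rw [if_pos hn]; ring
  classical
  set W := ∑ n ∈ Ioc ⌊X⌋₊ ⌊4*X⌋₊, (if Squarefree n then Kc E n * Lambdak k n else 0) with hW
  set Bd := (Ioc ⌊X⌋₊ ⌊4*X⌋₊).filter (fun n => ∃ s : ℕ, X^α ≤ s ∧ s^2 ∣ n) with hBd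
  have hBc : (Bd.card:ℝ) ≤ 8*X/X^α := by
    apply bad_count X (X^α) (by linarith) (Real.one_le_rpow (by linarith) hα0.le)
    intro n hn
    rw [hBd, mem_filter] at hn
    exact hn
  have hpt : ∀ n ∈ Ioc ⌊X⌋₊ ⌊4*X⌋₊, (if Squarefree n then Kc E n * Lambdak k n else 0) -
      (if (∃ s : ℕ, X^α ≤ s ∧ s^2 ∣ n) then K0 * (2*Real.log X)^k else 0) ≤ (-1)^k * (lam n * Kc E n * Lambdak k n) := by
    intro n hn
    obtain ⟨a1, a2, a3⟩ := hblk n hn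
    have hL0 := Lam_nonneg k n
    have hK0' := Kc_nonneg E n
    have hI0 : 0 ≤ (if (∃ s : ℕ, X^α ≤ s ∧ s^2 ∣ n) then K0 * (2*Real.log X)^k else 0) := by
      split_ifs
      · positivity
      · exact le_rfl
    by_cases hz : Kc E n = 0
    · rw [hz]; simp; exact_mod_cast hI0
    obtain ⟨e, he, hen⟩ := hEK n hz
    obtain ⟨b1, b2, b3, b4⟩ := hE1 e he
    by_cases hs : Squarefree n
    · rw [if_pos hs]
      have hne : e ≠ n := by
        rintro rfl
        have : X^β ≤ X^(1:ℝ) := Real.rpow_le_rpow_of_exponent_le (by linarith) (by linarith)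
        rw [Real.rpow_one] at this
        linarith
      have heq : (-1)^k * (lam n * Kc E n * Lambdak k n) = Kc E n * Lambdak k n := by
        rcases sqf_sign k n e hk hs hen hne b2 with h | h
        · rw [h]; ring
        · rw [h]
          have : ((-1:ℝ)^k) * (-1)^k = 1 := by rw [← mul_pow]; simp
          linear_combination (Kc E n * Lambdak k n) * this
      rw [heq]; linarith
    · rw [if_neg hs]
      by_cases hw : k < n.primeFactors.card
      · rw [Lam_vanish k n hw]; simp; exact_mod_cast hI0
      · have hbad := bad_sq X α β (by linarith) hα hβ (k-1) n e a2 hen b2 b3 b4 hs b1 (by omega)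
        rw [if_pos hbad]
        have hlog : Lambdak k n ≤ (2*Real.log X)^k := by
          refine (Lam_le k n a1).trans ?_
          have h1 : Real.log n ≤ 2*Real.log X := by
            calc Real.log n ≤ Real.log (X^2) := Real.log_le_log (by linarith) a3
              _ = 2*Real.log X := by rw [Real.log_pow]; norm_num
          exact pow_le_pow_left₀ (Real.log_natCast_nonneg n) h1 k
        have h2 : Kc E n * Lambdak k n ≤ K0 * (2*Real.log X)^k := by
          have := hKc n hn
          gcongr
        have h3 : |(-1)^k * (lam n * Kc E n * Lambdak k n)| ≤ Kc E n * Lambdak k n := by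
          rw [abs_mul, abs_pow, abs_neg, abs_one, one_pow, one_mul, mul_assoc, abs_mul, abs_of_nonneg (mul_nonneg hK0' hL0)]
          exact mul_le_of_le_one_left (mul_nonneg hK0' hL0) (abs_lam_le n)
        have h4 := (abs_le.1 h3).1
        linarith
  have hsum2 := sum_le_sum hpt
  rw [sum_sub_distrib, ← mul_sum, ← sum_filter (fun n => ∃ s : ℕ, X^α ≤ s ∧ s^2 ∣ n), sum_const, nsmul_eq_mul, ← hBd, ← hW] at hsum2
  have hWl : c1 * X * (Real.log X)^(k-1) ≤ W := by
    have h1 : W = ∑ e ∈ E, ∑ n ∈ Ioc ⌊X⌋₊ ⌊4*X⌋₊, if Squarefree n ∧ e ∣ n then Lambdak k n else 0 := by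
      rw [hW, sum_comm]
      apply sum_congr rfl
      intro n _
      split_ifs with h
      · rw [Kc_eq, sum_mul]
        apply sum_congr rfl
        intro e _
        simp [h]
      · simp [h]
    have h2 : ∑ e ∈ E, X / (2 * Real.log X) * (α * Real.log X)^k * (1/(e:ℝ)) ≤ W := by
      rw [h1]
      apply sum_le_sum
      intro e he
      obtain ⟨b1, b2, b3, b4⟩ := hE1 e he
      exact W_lower k hk α β X Y0 hα hα0 hβ hX4 hY0 hX2' e b1 b2 b3 b4
    rw [← mul_sum] at h2
    refine le_trans ?_ h2
    calc c1 * X * (Real.log X)^(k-1) = X / (2 * Real.log X) * (α * Real.log X)^k * c := by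
          obtain ⟨i, rfl⟩ : ∃ i, k = i + 1 := ⟨k-1, by omega⟩
          rw [hc1, mul_pow, Nat.add_sub_cancel]
          field_simp
          ring
      _ ≤ _ := by gcongr
  have hVu : Bd.card * (K0 * (2*Real.log X)^k) ≤ c1/2 * X * (Real.log X)^(k-1) := by
    obtain ⟨i, hi⟩ : ∃ i, k = i + 1 := ⟨k-1, by omega⟩
    have h1 := hC1 X (by linarith)
    rw [pow_one] at h1
    have hxa : X^α = X^(α/2) * X^(α/2) := by rw [← Real.rpow_add hXp]; ring_nf
    have hpp : 0 < X^(α/2) := by positivity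
    rw [div_le_iff₀ hc10] at hX3'
    calc Bd.card * (K0 * (2*Real.log X)^k) ≤ 8*X/X^α * (K0 * (2*Real.log X)^k) := by gcongr
      _ = 8*X/(X^(α/2) * X^(α/2)) * (K0 * (2^k * ((Real.log X)^(k-1) * Real.log X))) := by
          rw [hxa, mul_pow, ← pow_succ, Nat.sub_add_cancel hk]
      _ ≤ 8*X/(X^(α/2) * X^(α/2)) * (K0 * (2^k * ((Real.log X)^(k-1) * (C1 * X^(α/2))))) := by gcongr
      _ = (K0 * 2^k * 8 * C1 * 2) * (X * (Real.log X)^(k-1)) / (2 * X^(α/2)) := by field_simp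
      _ ≤ (X^(α/2) * c1) * (X * (Real.log X)^(k-1)) / (2 * X^(α/2)) := by gcongr
      _ = _ := by field_simp
  rw [hsum, abs_div, abs_of_pos (by linarith : 0 < K0), le_div_iff₀ (by linarith)]
  have hfin : (-1)^k * ∑ n ∈ Ioc ⌊X⌋₊ ⌊4*X⌋₊, lam n * Kc E n * Lambdak k n ≤ |∑ n ∈ Ioc ⌊X⌋₊ ⌊4*X⌋₊, lam n * Kc E n * Lambdak k n| := by
    refine (le_abs_self _).trans ?_
    rw [abs_mul, abs_pow, abs_neg, abs_one, one_pow, one_mul]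
  calc c1/(2*K0) * X * (Real.log X)^(k-1) * K0 = c1/2 * X * (Real.log X)^(k-1) := by field_simp
    _ ≤ _ := by linarith

end BS

namespace BS

noncomputable def Mex (k : ℕ) (X : ℝ) : ℝ := k * (4*X) * Real.log (4*X)^(k-1) - k * X * Real.log X^(k-1)

def Good (ν : ℝ) (C : ℕ → ℝ) (k : ℕ) (c X : ℝ) (b : ℕ → ℝ) : Prop :=
  (∀ n, |b n| ≤ 1) ∧ (∀ n, n ∉ Ioc ⌊X⌋₊ ⌊4*X⌋₊ → b n = 0) ∧
  (∀ m x, X ≤ x → ∑ d ∈ Icc 1 ⌊x^ν⌋₊, |∑ n ∈ (Icc 1 ⌊x⌋₊).filter (fun n => d ∣ n), b n| ≤ C m * x / (Real.log x)^m) ∧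
  c * X * (Real.log X)^(k-1) ≤ |∑ n ∈ Ioc ⌊X⌋₊ ⌊4*X⌋₊, (1 + b n) * Lambdak k n - Mex k X|

lemma scale (ν : ℝ) (h0 : 0 < ν) (h1 : ν < 1) : ∃ (C c0 X1 : ℕ → ℝ), (∀ m, 1 ≤ C m) ∧ (∀ k, 0 < c0 k) ∧
    (∀ k, 4 ≤ X1 k) ∧ ∀ k, ∀ X, X1 k ≤ X → ∃ b, Good ν C (k+1) (c0 k) X b := by
  obtain ⟨X0, hX03, hlev⟩ := level ν h0 h1
  choose C hC1 hC using hlev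
  have hT := fun k : ℕ => T_lower (k+1) (by omega) ((1-ν)/4) (by linarith) (by linarith)
  choose c0 hc0 X1 hX1 hE using hT
  refine ⟨C, fun k => c0 k / 2, fun k => max (X1 k) X0, hC1, fun k => half_pos (hc0 k), fun k => (hX1 k).trans (le_max_left _ _), fun k X hX => ?_⟩
  obtain ⟨E, K0, hK0, hE1, hE2, hE3⟩ := hE k X ((le_max_left _ _).trans hX)
  have hX4 : 4 ≤ X := (hX1 k).trans ((le_max_left _ _).trans hX)
  set A := ∑ n ∈ Ioc ⌊X⌋₊ ⌊4*X⌋₊, Lambdak (k+1) n with hA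
  by_cases hc : c0 k / 2 * X * (Real.log X)^(k+1-1) ≤ |A - Mex (k+1) X|
  · refine ⟨fun _ => 0, by simp, by simp, ?_, ?_⟩
    · intro m x hx
      simp
      have h2 := hC1 m
      have h3 : 0 ≤ Real.log x := Real.log_nonneg (by linarith)
      have : 0 ≤ x := by linarith
      positivity
    · simp only [add_zero, one_mul]
      exact hc
  · refine ⟨bf X K0 E, hE2, ?_, fun m x hx => hC m X ((le_max_right _ _).trans hX) K0 hK0 E hE1 hE2 x hx, ?_⟩
    · intro n hn
      unfold bf
      rw [if_neg hn]
    · push Not at hc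
      simp only [add_mul, one_mul, sum_add_distrib]
      rw [← hA]
      set T := ∑ n ∈ Ioc ⌊X⌋₊ ⌊4*X⌋₊, bf X K0 E n * Lambdak (k+1) n
      have h2 : |T| ≤ |A + T - Mex (k+1) X| + |A - Mex (k+1) X| := by
        have : T = (A + T - Mex (k+1) X) - (A - Mex (k+1) X) := by ring
        conv_lhs => rw [this]
        exact abs_sub _ _
      linarith

noncomputable def Xs (X1 : ℕ → ℝ) : ℕ → ℝ
  | 0 => X1 ((Nat.unpair 0).1)
  | (j+1) => max ((4 * Xs X1 j)^4) (X1 ((Nat.unpair (j+1)).1))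

lemma Xs_ge (X1 : ℕ → ℝ) (j : ℕ) : X1 ((Nat.unpair j).1) ≤ Xs X1 j := by
  cases j with
  | zero => rw [Xs]
  | succ j => rw [Xs]; exact le_max_right _ _

lemma Xs_succ (X1 : ℕ → ℝ) (j : ℕ) : (4 * Xs X1 j)^4 ≤ Xs X1 (j+1) := by
  conv_rhs => rw [Xs]
  exact le_max_left _ _

lemma Xs_step (X1 : ℕ → ℝ) (h4 : ∀ k, 4 ≤ X1 k) (j : ℕ) : 4 * Xs X1 j + 1 ≤ Xs X1 (j+1) := by
  have h1 := (h4 _).trans (Xs_ge X1 j)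
  have h2 := Xs_succ X1 j
  have h3 : 4 * (4 * Xs X1 j) ≤ (4 * Xs X1 j)^4 := by
    have : (4 * Xs X1 j)^4 = (4 * Xs X1 j)^3 * (4 * Xs X1 j) := by ring
    rw [this]
    have h5 : (4:ℝ) ≤ (4 * Xs X1 j)^3 := by
      have : (4:ℝ)^3 ≤ (4 * Xs X1 j)^3 := pow_le_pow_left₀ (by norm_num) (by linarith) 3
      norm_num at this
      linarith
    gcongr
  linarith

lemma Xs_mono (X1 : ℕ → ℝ) (h4 : ∀ k, 4 ≤ X1 k) : StrictMono (Xs X1) := by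
  apply strictMono_nat_of_lt_succ
  intro j
  have h1 := (h4 _).trans (Xs_ge X1 j)
  have := Xs_step X1 h4 j
  linarith

lemma Xs_lower (X1 : ℕ → ℝ) (h4 : ∀ k, 4 ≤ X1 k) (j : ℕ) : (j:ℝ) ≤ Xs X1 j := by
  induction j with
  | zero => have := (h4 _).trans (Xs_ge X1 0); push_cast; linarith
  | succ j ih =>
    have h1 := (h4 _).trans (Xs_ge X1 j)
    have := Xs_step X1 h4 j
    push_cast
    linarith

lemma block_lt (X : ℝ) (hX : 0 ≤ X) (n : ℕ) : n ∈ Ioc ⌊X⌋₊ ⌊4*X⌋₊ ↔ X < n ∧ (n:ℝ) ≤ 4*X := by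
  rw [mem_Ioc, Nat.floor_lt hX, Nat.le_floor_iff (by linarith)]

lemma glue (ν : ℝ) (h0 : 0 < ν) (h1 : ν < 1) : ∃ (C c0 : ℕ → ℝ) (X : ℕ → ℝ) (β : ℕ → ℕ → ℝ) (b : ℕ → ℝ),
    (∀ m, 1 ≤ C m) ∧ (∀ k, 0 < c0 k) ∧ StrictMono X ∧ (∀ j, 4 ≤ X j) ∧ (∀ j : ℕ, (j:ℝ) ≤ X j) ∧ (∀ j, (4 * X j)^4 ≤ X (j+1)) ∧
    (∀ j, Good ν C ((Nat.unpair j).1 + 1) (c0 (Nat.unpair j).1) (X j) (β j)) ∧ (∀ n, |b n| ≤ 1) ∧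
    (∀ n, b n ≠ 0 → ∃ j, X j < n ∧ (n:ℝ) ≤ 4 * X j) ∧ (∀ j n : ℕ, X j < n → (n:ℝ) ≤ 4 * X j → b n = β j n) := by
  obtain ⟨C, c0, X1, hC, hc0, h4, hG⟩ := scale ν h0 h1
  have hG' := fun j => hG (Nat.unpair j).1 (Xs X1 j) (Xs_ge X1 j)
  choose β hβ using hG'
  have hmono := Xs_mono X1 h4
  classical
  let b : ℕ → ℝ := fun n => if h : ∃ j, Xs X1 j < n ∧ (n:ℝ) ≤ 4 * Xs X1 j then β h.choose n else 0
  have huniq : ∀ i j (n:ℕ), Xs X1 i < n → (n:ℝ) ≤ 4 * Xs X1 i → Xs X1 j < n → (n:ℝ) ≤ 4 * Xs X1 j → ¬ i < j := by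
    intro i j n h1 h2 h3 h4' hij
    have : Xs X1 (i+1) ≤ Xs X1 j := hmono.monotone hij
    have := Xs_step X1 h4 i
    linarith
  refine ⟨C, c0, Xs X1, β, b, hC, hc0, hmono, fun j => (h4 _).trans (Xs_ge X1 j), Xs_lower X1 h4, Xs_succ X1, hβ, ?_, ?_, ?_⟩
  · intro n
    by_cases h : ∃ j, Xs X1 j < n ∧ (n:ℝ) ≤ 4 * Xs X1 j
    · simp only [b, dif_pos h]; exact (hβ _).1 n
    · simp only [b, dif_neg h]; simp
  · intro n hn
    by_contra h
    apply hn
    simp only [b, dif_neg h]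
  · intro j n h1 h2
    have h : ∃ j, Xs X1 j < n ∧ (n:ℝ) ≤ 4 * Xs X1 j := ⟨j, h1, h2⟩
    have hs := h.choose_spec
    have e : h.choose = j := by
      have a1 := huniq _ _ n hs.1 hs.2 h1 h2
      have a2 := huniq _ _ n h1 h2 hs.1 hs.2
      omega
    simp only [b, dif_pos h, e]

lemma count_err (d : ℕ) (hd : 1 ≤ d) (x : ℝ) (hx : 0 ≤ x) :
    |∑ n ∈ (Icc 1 ⌊x⌋₊).filter (fun n => d ∣ n), (1:ℝ) - x/d| ≤ 1 := by
  rw [sum_multiples d _ hd (fun _ => 1), ← Nat.floor_div_natCast]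
  simp
  have h1 := Nat.floor_le (by positivity : 0 ≤ x/(d:ℝ))
  have h2 := Nat.lt_floor_add_one (x/(d:ℝ))
  rw [abs_le]; constructor <;> linarith

lemma small_supp (x z : ℝ) (hz : 0 ≤ z) (b : ℕ → ℝ) (hb : ∀ n, |b n| ≤ 1) (hs : ∀ n : ℕ, (n:ℝ) ≤ x → b n ≠ 0 → (n:ℝ) ≤ z)
    (hx : 0 ≤ x) (d : ℕ) (hd : 1 ≤ d) :
    |∑ n ∈ (Icc 1 ⌊x⌋₊).filter (fun n => d ∣ n), b n| ≤ z*(1/(d:ℝ)) := by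
  have hd0 : (0:ℝ) < d := by exact_mod_cast hd
  calc _ ≤ ∑ n ∈ (Icc 1 ⌊x⌋₊).filter (fun n => d ∣ n), |b n| := abs_sum_le_sum_abs _ _
    _ ≤ ∑ n ∈ (Icc 1 ⌊x⌋₊).filter (fun n => d ∣ n), if n ≤ ⌊z⌋₊ then (1:ℝ) else 0 := by
        apply sum_le_sum
        intro n hn
        split_ifs with h
        · exact hb n
        · have : b n = 0 := by
            by_contra hne
            rw [mem_filter, mem_Icc, Nat.le_floor_iff hx] at hn
            exact h (Nat.le_floor (hs n hn.1.2 hne))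
          rw [this, abs_zero]
    _ ≤ ∑ n ∈ (Icc 1 ⌊z⌋₊).filter (fun n => d ∣ n), (1:ℝ) := by
        rw [← sum_filter]
        apply sum_le_sum_of_subset_of_nonneg
        · intro n
          simp only [mem_filter, mem_Icc]
          tauto
        · intros; positivity
    _ = ((⌊z⌋₊/d : ℕ):ℝ) := by
        rw [sum_multiples d _ hd (fun _ => 1)]; simp
    _ ≤ (⌊z⌋₊:ℝ)/d := Nat.cast_div_le
    _ ≤ z/d := by
        gcongr
        exact Nat.floor_le hz
    _ = _ := by ring

end BS

namespace BS

lemma main_bound (ν : ℝ) (h0 : 0 < ν) (h1 : ν < 1) (C : ℕ → ℝ) (c0 : ℕ → ℝ) (X : ℕ → ℝ) (β : ℕ → ℕ → ℝ) (b : ℕ → ℝ)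
    (hC : ∀ m, 1 ≤ C m) (hmono : StrictMono X) (hX4 : ∀ j, 4 ≤ X j) (hXj : ∀ j : ℕ, (j:ℝ) ≤ X j)
    (hXs : ∀ j, (4 * X j)^4 ≤ X (j+1))
    (hG : ∀ j, Good ν C ((Nat.unpair j).1 + 1) (c0 (Nat.unpair j).1) (X j) (β j)) (hb : ∀ n, |b n| ≤ 1)
    (hb1 : ∀ n, b n ≠ 0 → ∃ j, X j < n ∧ (n:ℝ) ≤ 4 * X j) (hb2 : ∀ j n : ℕ, X j < n → (n:ℝ) ≤ 4 * X j → b n = β j n)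
    (m : ℕ) (x : ℝ) (hx : 3 ≤ x) :
    ∑ d ∈ Icc 1 ⌊x^ν⌋₊, |∑ n ∈ (Icc 1 ⌊x⌋₊).filter (fun n => d ∣ n), b n| ≤
      C m * x / (Real.log x)^m + x^(1/4:ℝ) * (2 * Real.log x) := by
  have hlx := one_le_log hx
  have hxp : 0 < x := by linarith
  have hCm := hC m
  by_cases hxX : x < X 0
  · have : ∑ d ∈ Icc 1 ⌊x^ν⌋₊, |∑ n ∈ (Icc 1 ⌊x⌋₊).filter (fun n => d ∣ n), b n| = 0 := by
      apply sum_eq_zero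
      intro d _
      rw [abs_eq_zero]
      apply sum_eq_zero
      intro n hn
      rw [mem_filter, mem_Icc, Nat.le_floor_iff hxp.le] at hn
      by_contra hne
      obtain ⟨j, h2, _⟩ := hb1 n hne
      have := hmono.monotone (Nat.zero_le j)
      linarith [hn.1.2]
    rw [this]
    positivity
  push Not at hxX
  have hex : ∃ j, x < X j := by
    obtain ⟨j, hj⟩ := exists_nat_gt x
    exact ⟨j, lt_of_lt_of_le hj (hXj j)⟩
  classical
  obtain ⟨J, hJ1, hJ2⟩ : ∃ J, X J ≤ x ∧ x < X (J+1) := by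
    have h2 := Nat.find_spec hex
    have h3 : Nat.find hex ≠ 0 := by
      intro h; rw [h] at h2; linarith
    refine ⟨Nat.find hex - 1, ?_, ?_⟩
    · have := Nat.find_min hex (m := Nat.find hex - 1) (by omega)
      exact not_lt.1 this
    · rw [Nat.sub_add_cancel (by omega)]; exact h2
  obtain ⟨g1, g2, g3, g4⟩ := hG J
  have hXJ0 : 0 ≤ X J := by linarith [hX4 J]
  set b' : ℕ → ℝ := fun n => b n - β J n with hb'
  have hb'0 : ∀ n : ℕ, X J < n → (n:ℝ) ≤ 4 * X J → b' n = 0 := by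
    intro n a1 a2
    rw [hb']; simp only; rw [hb2 J n a1 a2, sub_self]
  have hb'b : ∀ n : ℕ, ¬ (X J < n ∧ (n:ℝ) ≤ 4 * X J) → b' n = b n := by
    intro n a
    rw [hb']; simp only
    rw [g2 n (by rw [block_lt _ hXJ0]; exact a), sub_zero]
  have hb'1 : ∀ n, |b' n| ≤ 1 := by
    intro n
    by_cases h : X J < n ∧ (n:ℝ) ≤ 4 * X J
    · rw [hb'0 n h.1 h.2]; simp
    · rw [hb'b n h]; exact hb n
  have hsupp : ∀ n : ℕ, (n:ℝ) ≤ x → b' n ≠ 0 → (n:ℝ) ≤ x^(1/4:ℝ) := by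
    intro n hn hne
    have h : ¬ (X J < n ∧ (n:ℝ) ≤ 4 * X J) := fun h => hne (hb'0 n h.1 h.2)
    rw [hb'b n h] at hne
    obtain ⟨j, j1, j2⟩ := hb1 n hne
    have hjJ : j < J + 1 := by
      rw [← hmono.lt_iff_lt]; linarith
    have hjne : j ≠ J := by rintro rfl; exact h ⟨j1, j2⟩
    have h5 : X (j+1) ≤ X J := hmono.monotone (by omega)
    have h6 : (n:ℝ)^4 ≤ x := by
      calc (n:ℝ)^4 ≤ (4 * X j)^4 := pow_le_pow_left₀ (by positivity) j2 4
        _ ≤ X (j+1) := hXs j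
        _ ≤ x := h5.trans hJ1
    apply le_of_pow_le_pow_left₀ (n := 4) (by norm_num) (by positivity)
    refine h6.trans (le_of_eq ?_)
    rw [← Real.rpow_natCast, ← Real.rpow_mul hxp.le]
    norm_num
  have hxn : x^ν ≤ x := by
    conv_rhs => rw [← Real.rpow_one x]
    exact Real.rpow_le_rpow_of_exponent_le (by linarith) h1.le
  calc _ ≤ ∑ d ∈ Icc 1 ⌊x^ν⌋₊, (|∑ n ∈ (Icc 1 ⌊x⌋₊).filter (fun n => d ∣ n), β J n| + x^(1/4:ℝ) * (1/(d:ℝ))) := by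
        apply sum_le_sum
        intro d hd
        have : ∑ n ∈ (Icc 1 ⌊x⌋₊).filter (fun n => d ∣ n), b n = ∑ n ∈ (Icc 1 ⌊x⌋₊).filter (fun n => d ∣ n), β J n +
            ∑ n ∈ (Icc 1 ⌊x⌋₊).filter (fun n => d ∣ n), b' n := by
          rw [← sum_add_distrib]
          apply sum_congr rfl
          intro n _
          rw [hb']; ring
        rw [this]
        refine (abs_add_le _ _).trans ?_
        gcongr
        exact small_supp x (x^(1/4:ℝ)) (by positivity) b' hb'1 hsupp hxp.le d (mem_Icc.1 hd).1
    _ = ∑ d ∈ Icc 1 ⌊x^ν⌋₊, |∑ n ∈ (Icc 1 ⌊x⌋₊).filter (fun n => d ∣ n), β J n| + x^(1/4:ℝ) * ∑ d ∈ Icc 1 ⌊x^ν⌋₊, (1/(d:ℝ)) := by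
        rw [sum_add_distrib, mul_sum]
    _ ≤ _ := by
        have h7 := H_le ⌊x^ν⌋₊ x (by linarith) ((Nat.floor_le (by positivity)).trans hxn)
        have h8 := g3 m x hJ1
        gcongr
        linarith

lemma R_of_bound (ν : ℝ) (h0 : 0 < ν) (h1 : ν < 1) (b : ℕ → ℝ) (hb3 : ∀ n, n ≤ 3 → b n = 0)
    (C : ℕ → ℝ) (hC : ∀ m, 1 ≤ C m)
    (hbd : ∀ m x, 3 ≤ x → ∑ d ∈ Icc 1 ⌊x^ν⌋₊, |∑ n ∈ (Icc 1 ⌊x⌋₊).filter (fun n => d ∣ n), b n| ≤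
      C m * x / (Real.log x)^m + x^(1/4:ℝ) * (2 * Real.log x)) : Rcond ν (fun n => 1 + b n) := by
  intro B hB
  set m := ⌈B⌉₊ with hm
  obtain ⟨C1, hC10, hC1⟩ := log_pow_le m (1-ν) (by linarith)
  obtain ⟨C2, hC20, hC2⟩ := log_pow_le (m+1) (3/4) (by norm_num)
  refine ⟨(2:ℝ)^B + (C1 + C m + 2*C2), fun x hx => ?_⟩
  have hxp : 0 < x := by linarith
  have hCm := hC m
  have hlx0 : 0 < Real.log x := Real.log_pos (by linarith)
  have h2 : ∑ d ∈ Icc 1 ⌊x^ν⌋₊, |(∑ n ∈ (Icc 1 ⌊x⌋₊).filter (fun n => d ∣ n), (1 + b n)) - x/d| ≤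
      x^ν + ∑ d ∈ Icc 1 ⌊x^ν⌋₊, |∑ n ∈ (Icc 1 ⌊x⌋₊).filter (fun n => d ∣ n), b n| := by
    calc _ ≤ ∑ d ∈ Icc 1 ⌊x^ν⌋₊, (1 + |∑ n ∈ (Icc 1 ⌊x⌋₊).filter (fun n => d ∣ n), b n|) := by
          apply sum_le_sum
          intro d hd
          rw [sum_add_distrib, add_sub_right_comm]
          refine (abs_add_le _ _).trans ?_
          gcongr
          exact count_err d (mem_Icc.1 hd).1 x hxp.le
      _ ≤ _ := by
          rw [sum_add_distrib]
          gcongr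
          simp
          exact Nat.floor_le (by positivity)
  refine h2.trans ?_
  by_cases hx3 : x < 3
  · have : ∑ d ∈ Icc 1 ⌊x^ν⌋₊, |∑ n ∈ (Icc 1 ⌊x⌋₊).filter (fun n => d ∣ n), b n| = 0 := by
      apply sum_eq_zero
      intro d _
      rw [abs_eq_zero]
      apply sum_eq_zero
      intro n hn
      rw [mem_filter, mem_Icc, Nat.le_floor_iff hxp.le] at hn
      apply hb3
      have : (n:ℝ) ≤ 3 := by linarith [hn.1.2]
      exact_mod_cast this
    rw [this, add_zero]
    have hxn : x^ν ≤ x := by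
      conv_rhs => rw [← Real.rpow_one x]
      exact Real.rpow_le_rpow_of_exponent_le (by linarith) h1.le
    have hl2 : Real.log x ≤ 2 := by have := Real.log_le_sub_one_of_pos hxp; linarith
    have h3 : (2:ℝ)^(-B) ≤ Real.log x ^ (-B) := Real.rpow_le_rpow_of_nonpos hlx0 hl2 (by linarith)
    have h4 : (2:ℝ)^B * 2^(-B) = 1 := by rw [← Real.rpow_add (by norm_num)]; simp
    calc x^ν ≤ (2:ℝ)^B * x * 2^(-B) := by
          have : (2:ℝ)^B * x * 2^(-B) = x := by linear_combination x * h4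
          rw [this]; exact hxn
      _ ≤ _ := by
          gcongr
          have : 0 < C1 + C m + 2*C2 := by linarith
          linarith
  · push Not at hx3
    have hlx := one_le_log hx3
    have h3 := hbd m x hx3
    have h4 : 1/(Real.log x)^m ≤ Real.log x ^ (-B) := by
      have : Real.log x ^ (-(m:ℝ)) ≤ Real.log x ^ (-B) := by
        apply Real.rpow_le_rpow_of_exponent_le hlx
        have := Nat.le_ceil B
        linarith
      rw [Real.rpow_neg hlx0.le, Real.rpow_natCast] at this
      rwa [one_div]
    have h5 : x^ν ≤ C1 * x / (Real.log x)^m := by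
      rw [le_div_iff₀ (by positivity)]
      calc x^ν * (Real.log x)^m ≤ x^ν * (C1 * x^(1-ν)) := by
            have := hC1 x (by linarith)
            gcongr
        _ = C1 * (x^ν * x^(1-ν)) := by ring
        _ = C1 * x := by rw [← Real.rpow_add hxp]; simp
    have h6 : x^(1/4:ℝ) * (2 * Real.log x) ≤ 2*C2 * x / (Real.log x)^m := by
      rw [le_div_iff₀ (by positivity)]
      calc x^(1/4:ℝ) * (2 * Real.log x) * (Real.log x)^m = x^(1/4:ℝ) * 2 * (Real.log x)^(m+1) := by ring
        _ ≤ x^(1/4:ℝ) * 2 * (C2 * x^(3/4:ℝ)) := by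
            have := hC2 x (by linarith)
            gcongr
        _ = 2*C2 * (x^(1/4:ℝ) * x^(3/4:ℝ)) := by ring
        _ = 2*C2 * x := by rw [← Real.rpow_add hxp]; norm_num
    have h2B : 0 < (2:ℝ)^B := by positivity
    calc _ ≤ C1 * x / (Real.log x)^m + (C m * x / (Real.log x)^m + 2*C2 * x / (Real.log x)^m) := by linarith
      _ = (C1 + C m + 2*C2) * x * (1/(Real.log x)^m) := by ring
      _ ≤ (C1 + C m + 2*C2) * x * Real.log x ^ (-B) := by gcongr
      _ ≤ ((2:ℝ)^B + (C1 + C m + 2*C2)) * x * Real.log x ^ (-B) := by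
          have h9 : C1 + C m + 2*C2 ≤ (2:ℝ)^B + (C1 + C m + 2*C2) := by linarith
          have h10 : 0 ≤ x * Real.log x ^ (-B) := by positivity
          rw [mul_assoc, mul_assoc]
          exact mul_le_mul_of_nonneg_right h9 h10

lemma fail (k : ℕ) (c : ℝ) (hc : 0 < c) (a : ℕ → ℝ)
    (h : ∀ N : ℝ, ∃ X, N ≤ X ∧ 4 ≤ X ∧ c * X * (Real.log X)^k ≤ |∑ n ∈ Ioc ⌊X⌋₊ ⌊4*X⌋₊, a n * Lambdak (k+1) n - Mex (k+1) X|) :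
    ¬ Tendsto (fun x : ℝ => Ssum a (k+1) x / (((k+1:ℕ):ℝ) * x * Real.log x ^ (k+1-1))) atTop (nhds 1) := by
  intro hT
  simp only [Nat.add_sub_cancel] at hT
  set K : ℝ := ((k+1:ℕ):ℝ) with hK
  have hK0 : 0 < K := by positivity
  set ε := c / (K * (4 * 2^k + 2)) with hε
  have hε0 : 0 < ε := by positivity
  obtain ⟨N, hN⟩ := (Metric.tendsto_atTop.1 hT) ε hε0
  obtain ⟨X, hXN, hX4, hX⟩ := h N
  have hlX := one_le_log (by linarith : 3 ≤ X)
  have hl4 := one_le_log (by linarith : 3 ≤ 4*X)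
  have hXp : 0 < X := by linarith
  have key : ∀ y, N ≤ y → 3 ≤ y → |Ssum a (k+1) y - K * y * Real.log y^k| ≤ ε * (K * y * Real.log y^k) := by
    intro y hy hy3
    have hly := one_le_log hy3
    have hD : 0 < K * y * Real.log y^k := by positivity
    have h2 := hN y hy
    rw [Real.dist_eq] at h2
    have h3 : Ssum a (k+1) y - K * y * Real.log y^k = (Ssum a (k+1) y / (K * y * Real.log y^k) - 1) * (K * y * Real.log y^k) := by
      field_simp
    rw [h3, abs_mul, abs_of_pos hD]
    gcongr
  have k1 := key X hXN (by linarith)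
  have k2 := key (4*X) (by linarith) (by linarith)
  have hdiff : ∑ n ∈ Ioc ⌊X⌋₊ ⌊4*X⌋₊, a n * Lambdak (k+1) n = Ssum a (k+1) (4*X) - Ssum a (k+1) X := by
    unfold Ssum
    have hle : ⌊X⌋₊ ≤ ⌊4*X⌋₊ := Nat.floor_le_floor (by linarith)
    have hu : Icc 1 ⌊4*X⌋₊ = Icc 1 ⌊X⌋₊ ∪ Ioc ⌊X⌋₊ ⌊4*X⌋₊ := by
      ext n; simp only [mem_union, mem_Icc, mem_Ioc]; omega
    rw [hu, sum_union]
    · ring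
    · rw [disjoint_left]; intro n; simp only [mem_Icc, mem_Ioc]; omega
  have hlog4 : Real.log (4*X) ≤ 2 * Real.log X := by
    calc Real.log (4*X) ≤ Real.log (X^2) := Real.log_le_log (by linarith) (by nlinarith)
      _ = 2*Real.log X := by rw [Real.log_pow]; norm_num
  rw [hdiff] at hX
  unfold Mex at hX
  simp only [Nat.add_sub_cancel] at hX
  rw [← hK] at hX
  have h5 : |Ssum a (k+1) (4*X) - Ssum a (k+1) X - (K * (4*X) * Real.log (4*X)^k - K * X * Real.log X^k)| ≤
      ε * (K * (4*X) * Real.log (4*X)^k) + ε * (K * X * Real.log X^k) := by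
    have : Ssum a (k+1) (4*X) - Ssum a (k+1) X - (K * (4*X) * Real.log (4*X)^k - K * X * Real.log X^k) =
      (Ssum a (k+1) (4*X) - K * (4*X) * Real.log (4*X)^k) - (Ssum a (k+1) X - K * X * Real.log X^k) := by ring
    rw [this]
    exact (abs_sub _ _).trans (add_le_add k2 k1)
  have h6 : ε * (K * (4*X) * Real.log (4*X)^k) ≤ ε * (K * (4*X) * (2*Real.log X)^k) := by gcongr
  rw [mul_pow] at h6
  have h7 : c = ε * (K * (4 * 2^k + 2)) := by rw [hε]; field_simp
  have h8 : 0 < ε * (K * X * Real.log X^k) := by positivity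
  rw [h7] at hX
  nlinarith [hX.trans h5]

end BS

/-- Fix `ν ∈ (0,1)`.  There is a sequence `(a_n)` with `0 ≤ a_n ≤ 2`
satisfying `R(ν)`, such that for every `k ≥ 1` the asymptotic formula
`S_k(x) ∼ k x (log x)^{k−1}` fails. -/
theorem bombieri_sieve_stmt0 (ν : ℝ) (hν : ν ∈ Set.Ioo (0 : ℝ) 1) :
    ∃ a : ℕ → ℝ, (∀ n, 0 ≤ a n ∧ a n ≤ 2) ∧ Rcond ν a ∧
      ∀ k : ℕ, 1 ≤ k →
        ¬ Tendsto (fun x : ℝ => Ssum a k x / (k * x * Real.log x ^ (k - 1)))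
            atTop (nhds 1) := by
  obtain ⟨h0, h1⟩ := hν
  obtain ⟨C, c0, X, β, b, hC, hc0, hmono, hX4, hXj, hXs, hG, hb, hb1, hb2⟩ := BS.glue ν h0 h1
  refine ⟨fun n => 1 + b n, ?_, ?_, ?_⟩
  · intro n
    have := abs_le.1 (hb n)
    constructor <;> linarith [this.1, this.2]
  · apply BS.R_of_bound ν h0 h1 b _ C hC
    · exact fun m x hx => BS.main_bound ν h0 h1 C c0 X β b hC hmono hX4 hXj hXs hG hb hb1 hb2 m x hx
    · intro n hn
      by_contra hne
      obtain ⟨j, h2, _⟩ := hb1 n hne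
      have h3 : (n:ℝ) ≤ 3 := by exact_mod_cast hn
      linarith [hX4 j]
  · intro k hk
    obtain ⟨i, rfl⟩ : ∃ i, k = i + 1 := ⟨k-1, by omega⟩
    apply BS.fail i (c0 i) (hc0 i)
    intro N
    obtain ⟨M, hM⟩ := exists_nat_gt N
    have hu : (Nat.unpair (Nat.pair i M)).1 = i := by simp
    refine ⟨X (Nat.pair i M), ?_, hX4 _, ?_⟩
    · have h2 := hXj (Nat.pair i M)
      have h3 : (M:ℝ) ≤ (Nat.pair i M : ℕ) := by exact_mod_cast Nat.right_le_pair i M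
      linarith
    · obtain ⟨g1, g2, g3, g4⟩ := hG (Nat.pair i M)
      rw [hu, Nat.add_sub_cancel] at g4
      have : ∑ n ∈ Ioc ⌊X (Nat.pair i M)⌋₊ ⌊4 * X (Nat.pair i M)⌋₊, (1 + b n) * Lambdak (i+1) n =
          ∑ n ∈ Ioc ⌊X (Nat.pair i M)⌋₊ ⌊4 * X (Nat.pair i M)⌋₊, (1 + β (Nat.pair i M) n) * Lambdak (i+1) n := by
        apply sum_congr rfl
        intro n hn
        rw [BS.block_lt _ (by linarith [hX4 (Nat.pair i M)])] at hn
        rw [hb2 _ n hn.1 hn.2]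
      rw [this]
      exact g4
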